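/- For every h₂ with 0.77 < h₂ < 1.25 and every K ∈ (−1, 1), one has I₁(h₂) + I₂(h₂, K) < 0; that is, for the confined inhomogeneous Muskat problem with this initial interface, the curve undergoes a short-time stability shift, independently of the permeability jump K. -/

import Mathlib

open MeasureTheory Real

/-- First component of the initial interface: `z₁(α) = α - sin(α) e^{-10⁻⁴ α²}`. -/
noncomputable def z₁ (α : ℝ) : ℝ := α - Real.sin α * Real.exp (-(1 / 10000) * α ^ 2)

/-- Second component of the initial interface, depending on the height `h₂` of the
permeability jump. -/
noncomputable def z₂ (h₂ α : ℝ) : ℝ :=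
  if |α| ≤ π then
    h₂ * (3 / π) *
      (Real.sin (3 * α) / 3 -
        Real.sin α / 2.5 * (Real.exp (-(α + 2) ^ 2) + Real.exp (-(α - 2) ^ 2)))
  else 0

/-- The homogeneous part `I₁(h₂)` of `∂ₜ RT(0,0)` (up to a positive constant). -/
noncomputable def I₁ (h₂ : ℝ) : ℝ :=
  2 * deriv (z₂ h₂) 0 *
    ∫ β in Set.Ioi (0 : ℝ),
      (deriv z₁ β * Real.sinh (z₁ β) * Real.sin (z₂ h₂ β) /
          (Real.cosh (z₁ β) - Real.cos (z₂ h₂ β)) ^ 2 +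
        deriv z₁ β * Real.sinh (z₁ β) * Real.sin (z₂ h₂ β) /
          (Real.cosh (z₁ β) + Real.cos (z₂ h₂ β)) ^ 2)

/-- The inhomogeneous part `I₂(h₂, K)` of `∂ₜ RT(0,0)` (up to a positive constant),
a double integral over `(0,∞)²` in the variables `(y, γ)`. -/
noncomputable def I₂ (h₂ K : ℝ) : ℝ :=
  4 * deriv (z₂ h₂) 0 * K *
    ∫ p in Set.Ioi (0 : ℝ) ×ˢ Set.Ioi (0 : ℝ),
      deriv (z₂ h₂) p.2 * Real.cos (z₁ p.2 * p.1) /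
          ((Real.sinh (π * p.1) + K * Real.sinh (2 * h₂ * p.1)) *
            Real.cosh (p.1 * π / 2)) *
        (2 * p.1 * Real.cosh (p.1 * π / 2 - p.1 * h₂) * Real.cosh (p.1 * π / 2) -
          2 * Real.sinh (p.1 * h₂) / Real.tan h₂) *
        Real.cosh (p.1 * z₂ h₂ p.2) * Real.cosh (p.1 * (π / 2 - h₂))

/-! ### The interface functions, their derivatives and elementary bounds -/

noncomputable def Ee (β : ℝ) : ℝ := Real.exp (-(1 / 10000) * β ^ 2)
noncomputable def x1 (β : ℝ) : ℝ := 1 - (Real.cos β - β / 5000 * Real.sin β) * Ee β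
noncomputable def x2 (β : ℝ) : ℝ :=
  (Real.sin β * (5001 / 5000) + 2 * β / 5000 * Real.cos β - (β / 5000) ^ 2 * Real.sin β) * Ee β
noncomputable def x3 (β : ℝ) : ℝ :=
  (Real.cos β * (5001 / 5000) + 2 / 5000 * Real.cos β - 2 * β / 5000 * Real.sin β
    - 2 * β / 5000 ^ 2 * Real.sin β - (β / 5000) ^ 2 * Real.cos β) * Ee β
  - β / 5000 * ((Real.sin β * (5001 / 5000) + 2 * β / 5000 * Real.cos β
    - (β / 5000) ^ 2 * Real.sin β) * Ee β)

theorem hasDerivAt_Ee (β : ℝ) : HasDerivAt Ee (-(β / 5000) * Ee β) β := by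
  have h : HasDerivAt (fun β : ℝ => -(1 / 10000) * β ^ 2) (-(1 / 10000) * (2 * β)) β := by
    have := (hasDerivAt_pow 2 β).const_mul (-(1 / 10000 : ℝ))
    simpa using this
  have := h.exp
  refine this.congr_deriv ?_
  unfold Ee; ring

theorem hasDerivAt_z1 (β : ℝ) : HasDerivAt z₁ (x1 β) β := by
  have h := (hasDerivAt_id β).sub ((Real.hasDerivAt_sin β).mul (hasDerivAt_Ee β))
  refine h.congr_deriv ?_
  unfold x1; ring

theorem hasDerivAt_x1 (β : ℝ) : HasDerivAt x1 (x2 β) β := by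
  have h := (((Real.hasDerivAt_cos β).sub (((hasDerivAt_id β).div_const 5000).mul
    (Real.hasDerivAt_sin β))).mul (hasDerivAt_Ee β)).const_sub 1
  refine h.congr_deriv ?_
  simp only [id, Pi.sub_apply, Pi.mul_apply, x2]; ring

theorem hasDerivAt_x2 (β : ℝ) : HasDerivAt x2 (x3 β) β := by
  have h1 := (Real.hasDerivAt_sin β).mul_const (5001 / 5000 : ℝ)
  have h2 := ((((hasDerivAt_id β).const_mul 2).div_const 5000).mul (Real.hasDerivAt_cos β))
  have h3 := ((((hasDerivAt_id β).div_const 5000).pow 2).mul (Real.hasDerivAt_sin β))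
  have h := ((h1.add h2).sub h3).mul (hasDerivAt_Ee β)
  refine h.congr_deriv ?_
  simp only [id, Pi.sub_apply, Pi.mul_apply, Pi.add_apply, Pi.pow_apply, x3]
  norm_num
  ring

theorem Ee_pos (β : ℝ) : 0 < Ee β := Real.exp_pos _
theorem Ee_le (β : ℝ) : Ee β ≤ 1 := by
  unfold Ee; rw [Real.exp_le_one_iff]; nlinarith [sq_nonneg β]

theorem abs_le_of_sc {β a b c : ℝ} (h : |a| + |b| ≤ c) :
    |a * Real.sin β + b * Real.cos β| ≤ c := by
  refine (abs_add_le _ _).trans ?_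
  rw [abs_mul, abs_mul]
  have h1 := Real.abs_sin_le_one β
  have h2 := Real.abs_cos_le_one β
  have := abs_nonneg a
  have := abs_nonneg b
  nlinarith

theorem abs_mul_Ee {β a c : ℝ} (h : |a| ≤ c) : |a * Ee β| ≤ c := by
  rw [abs_mul, abs_of_pos (Ee_pos β)]
  have := abs_nonneg a
  nlinarith [Ee_le β, Ee_pos β]

theorem x2_abs {β : ℝ} (h0 : 0 ≤ β) (h1 : β ≤ 3.15) : |x2 β| ≤ 1.002 := by
  have e : x2 β = (((5001 / 5000) - (β / 5000) ^ 2) * Real.sin β + (2 * β / 5000) * Real.cos β) * Ee β := by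
    unfold x2; ring
  rw [e]
  apply abs_mul_Ee
  apply abs_le_of_sc
  rw [abs_of_nonneg (by nlinarith), abs_of_nonneg (by positivity)]
  nlinarith

theorem x3_abs {β : ℝ} (h0 : 0 ≤ β) (h1 : β ≤ 3.15) : |x3 β| ≤ 1.01 := by
  have e : x3 β = ((-(2 * β / 5000) - 2 * β / 5000 ^ 2) * Real.sin β
    + ((5003 / 5000) - (β / 5000) ^ 2) * Real.cos β) * Ee β - β / 5000 * x2 β := by
    unfold x3 x2; ring
  rw [e]
  refine (abs_sub _ _).trans ?_
  have h2 := x2_abs h0 h1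
  have h3 : |β / 5000 * x2 β| ≤ 0.001 := by
    rw [abs_mul, abs_of_nonneg (by positivity : 0 ≤ β / 5000)]
    nlinarith [abs_nonneg (x2 β)]
  have h4 : |((-(2 * β / 5000) - 2 * β / 5000 ^ 2) * Real.sin β
    + ((5003 / 5000) - (β / 5000) ^ 2) * Real.cos β) * Ee β| ≤ 1.005 := by
    apply abs_mul_Ee
    apply abs_le_of_sc
    rw [abs_of_nonpos (by nlinarith), abs_of_nonneg (by nlinarith)]
    nlinarith
  linarith

theorem x1_nonneg {β : ℝ} (h0 : 0 ≤ β) (h1 : β ≤ π) : 0 ≤ x1 β := by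
  unfold x1
  have h2 : 0 ≤ Real.sin β := Real.sin_nonneg_of_nonneg_of_le_pi h0 h1
  have h3 : Real.cos β - β / 5000 * Real.sin β ≤ 1 := by
    have := Real.cos_le_one β
    have : 0 ≤ β / 5000 * Real.sin β := by positivity
    linarith
  have := Ee_pos β
  have := Ee_le β
  nlinarith

theorem x1_abs {β : ℝ} (h0 : 0 ≤ β) (h1 : β ≤ 3.15) : |x1 β| ≤ 2.01 := by
  have : |(-(β / 5000) * Real.sin β + 1 * Real.cos β) * Ee β| ≤ 1.01 := by
    apply abs_mul_Ee
    apply abs_le_of_sc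
    rw [abs_of_nonpos (by linarith), abs_of_nonneg (by norm_num)]
    linarith
  have e : x1 β = 1 - (-(β / 5000) * Real.sin β + 1 * Real.cos β) * Ee β := by unfold x1; ring
  rw [e]
  refine (abs_sub _ _).trans ?_
  rw [abs_one]; linarith

theorem z1_pos {β : ℝ} (h0 : 0 < β) : 0 < z₁ β := by
  unfold z₁
  have h1 : Real.sin β < β := Real.sin_lt h0
  have h2 := Ee_pos β
  have h3 := Ee_le β
  change 0 < β - Real.sin β * Ee β
  rcases le_total 0 (Real.sin β) with h | h <;> nlinarith

theorem z1_zero : z₁ 0 = 0 := by simp [z₁]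

/-! the vertical profile -/
noncomputable def pp (β : ℝ) : ℝ := Real.exp (-(β + 2) ^ 2)
noncomputable def qq (β : ℝ) : ℝ := Real.exp (-(β - 2) ^ 2)
noncomputable def v0 (β : ℝ) : ℝ :=
  3 / π * (Real.sin (3 * β) / 3 - Real.sin β / 2.5 * (pp β + qq β))
noncomputable def v1 (β : ℝ) : ℝ :=
  3 / π * (Real.cos (3 * β) - Real.cos β / 2.5 * (pp β + qq β)
    - Real.sin β / 2.5 * (-(2 * (β + 2)) * pp β + -(2 * (β - 2)) * qq β))
noncomputable def v2 (β : ℝ) : ℝ :=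
  3 / π * (-(3 * Real.sin (3 * β)) + Real.sin β / 2.5 * (pp β + qq β)
    - 2 * (Real.cos β / 2.5 * (-(2 * (β + 2)) * pp β + -(2 * (β - 2)) * qq β))
    - Real.sin β / 2.5 * ((4 * (β + 2) ^ 2 - 2) * pp β + (4 * (β - 2) ^ 2 - 2) * qq β))

theorem hasDerivAt_pp (β : ℝ) : HasDerivAt pp (-(2 * (β + 2)) * pp β) β := by
  have := ((((hasDerivAt_id β).add_const 2).pow 2).neg).exp
  refine this.congr_deriv ?_
  simp [pp]; ring
theorem hasDerivAt_qq (β : ℝ) : HasDerivAt qq (-(2 * (β - 2)) * qq β) β := by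
  have := ((((hasDerivAt_id β).sub_const 2).pow 2).neg).exp
  refine this.congr_deriv ?_
  simp [qq]; ring

theorem hasDerivAt_sin3 (β : ℝ) : HasDerivAt (fun β : ℝ => Real.sin (3 * β)) (3 * Real.cos (3 * β)) β := by
  have := ((hasDerivAt_id β).const_mul 3).sin
  refine this.congr_deriv ?_
  simp; ring
theorem hasDerivAt_cos3 (β : ℝ) : HasDerivAt (fun β : ℝ => Real.cos (3 * β)) (-(3 * Real.sin (3 * β))) β := by
  have := ((hasDerivAt_id β).const_mul 3).cos
  refine this.congr_deriv ?_
  simp; ring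

theorem hasDerivAt_v0 (β : ℝ) : HasDerivAt v0 (v1 β) β := by
  have h := (((hasDerivAt_sin3 β).div_const 3).sub (((Real.hasDerivAt_sin β).div_const 2.5).mul
    ((hasDerivAt_pp β).add (hasDerivAt_qq β)))).const_mul (3 / π)
  refine h.congr_deriv ?_
  simp only [Pi.add_apply, v1]; ring

theorem hasDerivAt_v1 (β : ℝ) : HasDerivAt v1 (v2 β) β := by
  have hp1 := (((hasDerivAt_id β).add_const 2).const_mul 2).neg.mul (hasDerivAt_pp β)
  have hq1 := (((hasDerivAt_id β).sub_const 2).const_mul 2).neg.mul (hasDerivAt_qq β)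
  have h := (((hasDerivAt_cos3 β).sub (((Real.hasDerivAt_cos β).div_const 2.5).mul
    ((hasDerivAt_pp β).add (hasDerivAt_qq β)))).sub
      (((Real.hasDerivAt_sin β).div_const 2.5).mul (hp1.add hq1))).const_mul (3 / π)
  refine h.congr_deriv ?_
  simp only [Pi.add_apply, Pi.mul_apply, Pi.neg_apply, id, v2]; ring

theorem three_div_pi : 3 / π ≤ 0.95493 := by
  rw [div_le_iff₀ Real.pi_pos]; have := Real.pi_gt_d6; nlinarith
theorem three_div_pi_pos : 0 < 3 / π := by positivity

theorem exp_neg_four : Real.exp (-4) ≤ 0.0184 := by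
  have h : Real.exp (-4) = (Real.exp (-1)) ^ 4 := by
    rw [← Real.exp_nat_mul]; norm_num
  rw [h]
  have h1 : Real.exp (-1) < 0.3678794412 := Real.exp_neg_one_lt_d9
  have h0 := Real.exp_pos (-1)
  calc Real.exp (-1) ^ 4 ≤ 0.3678794412 ^ 4 := by gcongr
    _ ≤ 0.0184 := by norm_num

/-- Weighted Gaussian bounds. -/
theorem pp_bounds {β : ℝ} (h0 : 0 ≤ β) :
    0 < pp β ∧ pp β ≤ 0.0184 ∧ (2 * (β + 2)) * pp β ≤ 0.0736 ∧ |(4 * (β + 2) ^ 2 - 2) * pp β| ≤ 0.2576 := by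
  have hp : 0 < pp β := Real.exp_pos _
  have e1 : pp β = Real.exp (-4) * Real.exp (-(β ^ 2 + 4 * β)) := by
    unfold pp; rw [← Real.exp_add]; congr 1; ring
  set s := β ^ 2 + 4 * β with hs
  have hs0 : 0 ≤ s := by positivity
  have h2 : Real.exp (-s) * (1 + s) ≤ 1 := by
    have : 1 + s ≤ Real.exp s := by linarith [Real.add_one_le_exp s]
    calc Real.exp (-s) * (1 + s) ≤ Real.exp (-s) * Real.exp s := by gcongr
      _ = 1 := by rw [← Real.exp_add]; simp
  have h3 := exp_neg_four
  have h4 := Real.exp_pos (-4)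
  have h5 := Real.exp_pos (-s)
  have key : ∀ c d : ℝ, 0 ≤ c → c ≤ d * (1 + s) → c * pp β ≤ d * 0.0184 := by
    intro c d hc hcd
    rw [e1]
    have hd : 0 ≤ d := by
      by_contra hneg
      push Not at hneg
      nlinarith
    calc c * (Real.exp (-4) * Real.exp (-s)) ≤ (d * (1 + s)) * (Real.exp (-4) * Real.exp (-s)) := by gcongr
      _ = d * (Real.exp (-4) * (Real.exp (-s) * (1 + s))) := by ring
      _ ≤ d * (0.0184 * 1) := by gcongr
      _ = _ := by ring
  refine ⟨hp, ?_, ?_, ?_⟩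
  · have := key 1 1 (by norm_num) (by linarith)
    linarith
  · have := key (2 * (β + 2)) 4 (by positivity) (by nlinarith)
    linarith
  · rw [abs_of_nonneg (mul_nonneg (by nlinarith) hp.le)]
    have := key (4 * (β + 2) ^ 2 - 2) 14 (by nlinarith) (by nlinarith)
    linarith

theorem qq_bounds (β : ℝ) :
    0 < qq β ∧ qq β ≤ 1 ∧ |(2 * (β - 2)) * qq β| ≤ 0.88 ∧ |(4 * (β - 2) ^ 2 - 2) * qq β| ≤ 2 := by
  have hp : 0 < qq β := Real.exp_pos _
  set s := (β - 2) with hs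
  have h2 : qq β * (1 + s ^ 2 + (s ^ 2) ^ 2 / 2) ≤ 1 := by
    have : 1 + s ^ 2 + (s ^ 2) ^ 2 / 2 ≤ Real.exp (s ^ 2) := Real.quadratic_le_exp_of_nonneg (sq_nonneg s)
    calc qq β * (1 + s ^ 2 + (s ^ 2) ^ 2 / 2) ≤ qq β * Real.exp (s ^ 2) := by gcongr
      _ = 1 := by unfold qq; rw [← Real.exp_add, ← hs]; simp
  have key : ∀ c d : ℝ, 0 ≤ d → |c| ≤ d * (1 + s ^ 2 + (s ^ 2) ^ 2 / 2) → |c * qq β| ≤ d := by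
    intro c d hd hcd
    rw [abs_mul, abs_of_pos hp]
    nlinarith
  refine ⟨hp, ?_, ?_, ?_⟩
  · have := key 1 1 (by norm_num) (by rw [abs_one]; nlinarith [sq_nonneg s, sq_nonneg (s ^ 2)])
    rw [one_mul] at this
    exact (le_abs_self _).trans this
  · apply key _ _ (by norm_num)
    rw [abs_le]
    constructor
    · nlinarith [sq_nonneg (s ^ 2 - 1 / 2), sq_nonneg (s + 5 / 7)]
    · nlinarith [sq_nonneg (s ^ 2 - 1 / 2), sq_nonneg (s - 5 / 7)]
  · apply key _ _ (by norm_num)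
    rw [abs_le]
    constructor
    · nlinarith [sq_nonneg s, sq_nonneg (s ^ 2)]
    · nlinarith [sq_nonneg (s ^ 2 - 1), sq_nonneg s]

theorem v0_abs {β : ℝ} (h0 : 0 ≤ β) : |v0 β| ≤ 0.71 := by
  obtain ⟨a1, a2, a3, a4⟩ := pp_bounds h0
  obtain ⟨b1, b2, b3, b4⟩ := qq_bounds β
  unfold v0
  rw [abs_mul, abs_of_pos three_div_pi_pos]
  have h1 : |Real.sin (3 * β) / 3 - Real.sin β / 2.5 * (pp β + qq β)| ≤ 1 / 3 + 0.4074 := by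
    refine (abs_sub _ _).trans ?_
    rw [abs_div, abs_mul, abs_div]
    have h2 := Real.abs_sin_le_one (3 * β)
    have h3 := Real.abs_sin_le_one β
    rw [abs_of_pos (by linarith : 0 < pp β + qq β), abs_of_pos (by norm_num : (0:ℝ) < 3),
      abs_of_pos (by norm_num : (0:ℝ) < 2.5)]
    have : |Real.sin β| / 2.5 * (pp β + qq β) ≤ 1 / 2.5 * (0.0184 + 1) := by gcongr
    have : |Real.sin (3 * β)| / 3 ≤ 1 / 3 := by gcongr
    norm_num at *
    linarith
  calc _ ≤ 0.95493 * (1 / 3 + 0.4074 : ℝ) := by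
        gcongr
        exact three_div_pi
    _ ≤ _ := by norm_num

theorem v1_abs {β : ℝ} (h0 : 0 ≤ β) : |v1 β| ≤ 1.71 := by
  obtain ⟨a1, a2, a3, a4⟩ := pp_bounds h0
  obtain ⟨b1, b2, b3, b4⟩ := qq_bounds β
  unfold v1
  rw [abs_mul, abs_of_pos three_div_pi_pos]
  have h1 : |Real.cos (3 * β) - Real.cos β / 2.5 * (pp β + qq β)
    - Real.sin β / 2.5 * (-(2 * (β + 2)) * pp β + -(2 * (β - 2)) * qq β)| ≤ 1 + 0.40736 + 0.4 * (0.0736 + 0.88) := by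
    refine (abs_sub _ _).trans (add_le_add ((abs_sub _ _).trans (add_le_add (Real.abs_cos_le_one _) ?_)) ?_)
    · rw [abs_mul, abs_div, abs_of_pos (by linarith : 0 < pp β + qq β),
        abs_of_pos (by norm_num : (0:ℝ) < 2.5)]
      have : |Real.cos β| / 2.5 * (pp β + qq β) ≤ 1 / 2.5 * (0.0184 + 1) := by
        gcongr; exact Real.abs_cos_le_one β
      norm_num at *; linarith
    · rw [abs_mul, abs_div, abs_of_pos (by norm_num : (0:ℝ) < 2.5)]
      have h5 : |-(2 * (β + 2)) * pp β + -(2 * (β - 2)) * qq β| ≤ 0.0736 + 0.88 := by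
        refine (abs_add_le _ _).trans (add_le_add ?_ ?_)
        · rw [neg_mul, abs_neg, abs_of_nonneg (by positivity)]; exact a3
        · rw [neg_mul, abs_neg]; exact b3
      calc _ ≤ 1 / 2.5 * (0.0736 + 0.88 : ℝ) := by
            gcongr; exact Real.abs_sin_le_one β
        _ = _ := by norm_num
  calc _ ≤ 0.95493 * (1 + 0.40736 + 0.4 * (0.0736 + 0.88) : ℝ) := by
        gcongr
        exact three_div_pi
    _ ≤ _ := by norm_num

theorem v2_abs {β : ℝ} (h0 : 0 ≤ β) : |v2 β| ≤ 4.85 := by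
  obtain ⟨a1, a2, a3, a4⟩ := pp_bounds h0
  obtain ⟨b1, b2, b3, b4⟩ := qq_bounds β
  unfold v2
  rw [abs_mul, abs_of_pos three_div_pi_pos]
  have h5 : |-(2 * (β + 2)) * pp β + -(2 * (β - 2)) * qq β| ≤ 0.0736 + 0.88 := by
    refine (abs_add_le _ _).trans (add_le_add ?_ ?_)
    · rw [neg_mul, abs_neg, abs_of_nonneg (by positivity)]; exact a3
    · rw [neg_mul, abs_neg]; exact b3
  have h6 : |(4 * (β + 2) ^ 2 - 2) * pp β + (4 * (β - 2) ^ 2 - 2) * qq β| ≤ 0.2576 + 2 :=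
    (abs_add_le _ _).trans (add_le_add a4 b4)
  have h1 : |-(3 * Real.sin (3 * β)) + Real.sin β / 2.5 * (pp β + qq β)
    - 2 * (Real.cos β / 2.5 * (-(2 * (β + 2)) * pp β + -(2 * (β - 2)) * qq β))
    - Real.sin β / 2.5 * ((4 * (β + 2) ^ 2 - 2) * pp β + (4 * (β - 2) ^ 2 - 2) * qq β)|
     ≤ 3 + 0.40736 + 2 * (0.4 * (0.0736 + 0.88)) + 0.4 * (0.2576 + 2) := by
    refine (abs_sub _ _).trans (add_le_add ((abs_sub _ _).trans (add_le_add
      ((abs_add_le _ _).trans (add_le_add ?_ ?_)) ?_)) ?_)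
    · rw [abs_neg, abs_mul, abs_of_pos (by norm_num : (0:ℝ) < 3)]
      have := Real.abs_sin_le_one (3 * β); linarith
    · rw [abs_mul, abs_div, abs_of_pos (by linarith : 0 < pp β + qq β),
        abs_of_pos (by norm_num : (0:ℝ) < 2.5)]
      have : |Real.sin β| / 2.5 * (pp β + qq β) ≤ 1 / 2.5 * (0.0184 + 1) := by
        gcongr; exact Real.abs_sin_le_one β
      norm_num at *; linarith
    · rw [abs_mul, abs_mul, abs_div, abs_of_pos (by norm_num : (0:ℝ) < 2.5),
        abs_of_pos (by norm_num : (0:ℝ) < 2)]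
      calc _ ≤ 2 * (1 / 2.5 * (0.0736 + 0.88 : ℝ)) := by
            gcongr; exact Real.abs_cos_le_one β
        _ = _ := by norm_num
    · rw [abs_mul, abs_div, abs_of_pos (by norm_num : (0:ℝ) < 2.5)]
      calc _ ≤ 1 / 2.5 * (0.2576 + 2 : ℝ) := by
            gcongr; exact Real.abs_sin_le_one β
        _ = _ := by norm_num
  calc _ ≤ 0.95493 * (3 + 0.40736 + 2 * (0.4 * (0.0736 + 0.88)) + 0.4 * (0.2576 + 2) : ℝ) := by
        gcongr
        exact three_div_pi
    _ ≤ _ := by norm_num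

theorem z2_eq {h β : ℝ} (hb : |β| ≤ π) : z₂ h β = h * v0 β := by
  unfold z₂ v0 pp qq; rw [if_pos hb]; ring
theorem z2_eq_zero {h β : ℝ} (hb : π < |β|) : z₂ h β = 0 := by
  unfold z₂; rw [if_neg (not_le.2 hb)]
theorem v0_zero : v0 0 = 0 := by simp [v0]
theorem v0_pi : v0 π = 0 := by
  have : Real.sin (3 * π) = 0 := by exact_mod_cast Real.sin_nat_mul_pi 3
  simp [v0, this]
theorem deriv_z2 {h β : ℝ} (hb : |β| < π) : deriv (z₂ h) β = h * v1 β := by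
  have : z₂ h =ᶠ[nhds β] fun β => h * v0 β := by
    have : ∀ᶠ b in nhds β, |b| < π := (continuous_abs.tendsto β).eventually_lt_const hb
    filter_upwards [this] with b hb using z2_eq hb.le
  rw [this.deriv_eq]
  exact ((hasDerivAt_v0 β).const_mul h).deriv
theorem deriv_z2_zero {h β : ℝ} (hb : π < |β|) : deriv (z₂ h) β = 0 := by
  have : z₂ h =ᶠ[nhds β] fun _ => 0 := by
    have : ∀ᶠ b in nhds β, π < |b| := (continuous_abs.tendsto β).eventually_const_lt hb
    filter_upwards [this] with b hb using z2_eq_zero hb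
  rw [this.deriv_eq]; simp
theorem v1_zero_pos : 0 < v1 0 := by
  have h := pp_bounds (le_refl (0:ℝ))
  have : qq 0 = pp 0 := by simp [pp, qq]
  unfold v1
  rw [this]
  apply mul_pos three_div_pi_pos
  norm_num
  linarith [h.2.1]
theorem deriv_z1 (β : ℝ) : deriv z₁ β = x1 β := (hasDerivAt_z1 β).deriv

/-! ### Midpoint rule, Taylor bound, interpolation -/

theorem taylor_one {f f1 f2 : ℝ → ℂ} {a b m M : ℝ} (hm : m ∈ Set.Icc a b)
    (h1 : ∀ t ∈ Set.Icc a b, HasDerivAt f (f1 t) t)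
    (h2 : ∀ t ∈ Set.Icc a b, HasDerivAt f1 (f2 t) t)
    (hM : ∀ t ∈ Set.Icc a b, ‖f2 t‖ ≤ M) {t : ℝ} (ht : t ∈ Set.Icc a b) :
    ‖f t - f m - (t - m) * f1 m‖ ≤ M * (t - m) ^ 2 / 2 := by
  have hd : ∀ s ∈ Set.Icc a b, ‖f1 s - f1 m‖ ≤ M * |s - m| := by
    intro s hs
    have := (convex_Icc a b).norm_image_sub_le_of_norm_hasDerivWithin_le
      (fun x hx => (h2 x hx).hasDerivWithinAt) hM hm hs
    simpa using this
  -- reparametrise along the segment from m to t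
  set g : ℝ → ℂ := fun s => f (m + s * (t - m)) - f m - (s * (t - m) : ℝ) * f1 m with hg
  have hmem : ∀ s ∈ Set.Icc (0:ℝ) 1, m + s * (t - m) ∈ Set.Icc a b := by
    intro s hs
    have := (convex_Icc a b).add_smul_sub_mem hm ht hs
    simpa using this
  have hgd : ∀ s ∈ Set.Icc (0:ℝ) 1,
      HasDerivAt g ((t - m : ℝ) * (f1 (m + s * (t - m)) - f1 m)) s := by
    intro s hs
    have e1 : HasDerivAt (fun s : ℝ => m + s * (t - m)) (t - m) s := by
      simpa using ((hasDerivAt_id s).mul_const (t - m)).const_add m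
    have e2 := (h1 _ (hmem s hs)).scomp s e1
    have e3 : HasDerivAt (fun s : ℝ => ((s * (t - m) : ℝ) : ℂ)) ((t - m : ℝ) : ℂ) s := by
      have : HasDerivAt (fun s : ℝ => s * (t - m)) (t - m) s := by
        simpa using (hasDerivAt_id s).mul_const (t - m)
      exact this.ofReal_comp
    have := (e2.sub_const (f m)).sub (e3.mul_const (f1 m))
    refine this.congr_deriv ?_
    simp; ring
  have hB : ∀ s : ℝ, HasDerivAt (fun s : ℝ => M * (t - m) ^ 2 / 2 * s ^ 2) (M * (t - m) ^ 2 * s) s := by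
    intro s
    have := (hasDerivAt_pow 2 s).const_mul (M * (t - m) ^ 2 / 2)
    refine this.congr_deriv ?_
    norm_num; ring
  have key := image_norm_le_of_norm_deriv_right_le_deriv_boundary (f := g) (a := 0) (b := 1)
    (f' := fun s => (t - m : ℝ) * (f1 (m + s * (t - m)) - f1 m))
    (B := fun s : ℝ => M * (t - m) ^ 2 / 2 * s ^ 2) (B' := fun s => M * (t - m) ^ 2 * s)
    (fun s hs => (hgd s hs).continuousAt.continuousWithinAt)
    (fun s hs => (hgd s (Set.Ico_subset_Icc_self hs)).hasDerivWithinAt)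
    (by simp [hg]) hB
    (by
      intro s hs
      have := hd _ (hmem s (Set.Ico_subset_Icc_self hs))
      rw [norm_mul, Complex.norm_real, Real.norm_eq_abs]
      have e : |m + s * (t - m) - m| = s * |t - m| := by
        rw [show m + s * (t - m) - m = s * (t - m) by ring, abs_mul, abs_of_nonneg hs.1]
      rw [e] at this
      calc |t - m| * _ ≤ |t - m| * (M * (s * |t - m|)) := by gcongr
        _ = M * (|t - m| ^ 2) * s := by ring
        _ = _ := by rw [sq_abs])
    (show (1:ℝ) ∈ Set.Icc (0:ℝ) 1 by simp)
  simp only [hg] at key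
  have e : m + 1 * (t - m) = t := by ring
  rw [e] at key
  simpa using key

theorem midpoint_rule {f f1 f2 : ℝ → ℂ} {m r M : ℝ} (hr : 0 ≤ r)
    (h1 : ∀ t ∈ Set.Icc (m - r) (m + r), HasDerivAt f (f1 t) t)
    (h2 : ∀ t ∈ Set.Icc (m - r) (m + r), HasDerivAt f1 (f2 t) t)
    (hM : ∀ t ∈ Set.Icc (m - r) (m + r), ‖f2 t‖ ≤ M) :
    ‖(∫ t in (m - r)..(m + r), f t) - (2 * r : ℝ) * f m‖ ≤ M * (2 * r) ^ 3 / 24 := by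
  have hle : m - r ≤ m + r := by linarith
  have hm : m ∈ Set.Icc (m - r) (m + r) := ⟨by linarith, by linarith⟩
  have hfi : IntervalIntegrable f volume (m - r) (m + r) := by
    apply ContinuousOn.intervalIntegrable
    rw [Set.uIcc_of_le hle]
    exact fun t ht => (h1 t ht).continuousAt.continuousWithinAt
  have hl : ∀ c : ℂ, (∫ t in (m - r)..(m + r), (((t - m : ℝ)) : ℂ) * c) = 0 := by
    intro c
    rw [intervalIntegral.integral_mul_const, intervalIntegral.integral_ofReal]
    have : ∫ t in (m - r)..(m + r), (t - m) = 0 := by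
      rw [intervalIntegral.integral_sub (by simp) (by simp)]
      simp [integral_id]; ring
    rw [this]; simp
  have e : (∫ t in (m - r)..(m + r), f t) - (2 * r : ℝ) * f m
      = ∫ t in (m - r)..(m + r), (f t - f m - (((t - m : ℝ)) : ℂ) * f1 m) := by
    rw [intervalIntegral.integral_sub, intervalIntegral.integral_sub hfi (by simp), hl]
    · rw [intervalIntegral.integral_const, sub_zero, Complex.real_smul]
      congr 3; ring
    · exact hfi.sub (by simp)
    · apply Continuous.intervalIntegrable; fun_prop
  rw [e]
  have hIsq : (∫ t in (m - r)..(m + r), M * (t - m) ^ 2 / 2) = M * (2 * r) ^ 3 / 24 := by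
    have : ∀ t ∈ Set.uIcc (m - r) (m + r), HasDerivAt (fun t : ℝ => M * (t - m) ^ 3 / 6) (M * (t - m) ^ 2 / 2) t := by
      intro t _
      have := ((((hasDerivAt_id t).sub_const m).pow 3).const_mul M).div_const 6
      refine this.congr_deriv ?_
      simp; ring
    rw [intervalIntegral.integral_eq_sub_of_hasDerivAt this (by apply Continuous.intervalIntegrable; fun_prop)]
    ring
  rw [← hIsq]
  apply intervalIntegral.norm_integral_le_of_norm_le hle
  · refine Filter.Eventually.of_forall fun t ht => ?_
    have := taylor_one hm h1 h2 hM (Set.Ioc_subset_Icc_self ht)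
    simpa using this
  · apply Continuous.intervalIntegrable; fun_prop

theorem interp_bound {f f1 f2 : ℝ → ℝ} {a b M : ℝ} (hab : a < b)
    (h1 : ∀ t, HasDerivAt f (f1 t) t)
    (h2 : ∀ t, HasDerivAt f1 (f2 t) t)
    (hM : ∀ t ∈ Set.Icc a b, |f2 t| ≤ M) {t : ℝ} (ht : t ∈ Set.Icc a b) :
    |f t - ((b - t) / (b - a) * f a + (t - a) / (b - a) * f b)| ≤ M * (b - a) ^ 2 / 8 := by
  have hba : 0 < b - a := by linarith
  have key : ∀ (g g1 g2 : ℝ → ℝ), (∀ t, HasDerivAt g (g1 t) t) → (∀ t, HasDerivAt g1 (g2 t) t) →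
      (∀ t ∈ Set.Icc a b, |g2 t| ≤ M) →
      g t - ((b - t) / (b - a) * g a + (t - a) / (b - a) * g b) ≤ M * (b - a) ^ 2 / 8 := by
    intro g g1 g2 d1 d2 hM
    have hc : ConvexOn ℝ (Set.Icc a b) (fun s => g s + M * s ^ 2 / 2) := by
      have hd1 : ∀ s, HasDerivAt (fun s => g s + M * s ^ 2 / 2) (g1 s + M * s) s := by
        intro s
        have := (d1 s).add (((hasDerivAt_pow 2 s).const_mul M).div_const 2)
        refine this.congr_deriv ?_
        norm_num; ring
      have hd2 : ∀ s, HasDerivAt (fun s => g1 s + M * s) (g2 s + M) s := by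
        intro s
        have := (d2 s).add ((hasDerivAt_id s).const_mul M)
        rw [mul_one] at this
        exact this
      apply convexOn_of_hasDerivWithinAt2_nonneg (convex_Icc a b)
        (f' := fun s => g1 s + M * s) (f'' := fun s => g2 s + M)
      · exact fun s _ => (hd1 s).continuousAt.continuousWithinAt
      · exact fun s _ => (hd1 s).hasDerivWithinAt
      · exact fun s _ => (hd2 s).hasDerivWithinAt
      · intro s hs
        have := (abs_le.1 (hM s (interior_subset hs))).1
        linarith
    have p1 : 0 ≤ (b - t) / (b - a) := div_nonneg (by linarith [ht.2]) hba.le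
    have p2 : 0 ≤ (t - a) / (b - a) := div_nonneg (by linarith [ht.1]) hba.le
    have := hc.2 (Set.left_mem_Icc.2 hab.le) (Set.right_mem_Icc.2 hab.le) p1 p2
      (by field_simp; ring)
    simp only [smul_eq_mul] at this
    have e : (b - t) / (b - a) * a + (t - a) / (b - a) * b = t := by
      field_simp; ring
    rw [e] at this
    have hM0 : 0 ≤ M := (abs_nonneg _).trans (hM a (Set.left_mem_Icc.2 hab.le))
    have e2 : (b - t) / (b - a) * (M * a ^ 2 / 2) + (t - a) / (b - a) * (M * b ^ 2 / 2) - M * t ^ 2 / 2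
        = M * ((t - a) * (b - t)) / 2 := by
      field_simp; ring
    have e3 : (t - a) * (b - t) ≤ (b - a) ^ 2 / 4 := by nlinarith [sq_nonneg (2 * t - a - b)]
    nlinarith
  rw [abs_le]
  constructor
  · have := key (fun t => - f t) (fun t => - f1 t) (fun t => -f2 t) (fun t => (h1 t).neg)
      (fun t => (h2 t).neg) (by simpa using hM)
    linarith
  · exact key f f1 f2 h1 h2 hM

noncomputable def wf (h β : ℝ) : ℂ := (z₁ β : ℂ) + ((h * v0 β : ℝ) : ℂ) * Complex.I
noncomputable def wf1 (h β : ℝ) : ℂ := (x1 β : ℂ) + ((h * v1 β : ℝ) : ℂ) * Complex.I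
noncomputable def wf2 (h β : ℝ) : ℂ := (x2 β : ℂ) + ((h * v2 β : ℝ) : ℂ) * Complex.I

theorem hasDerivAt_wf (h β : ℝ) : HasDerivAt (wf h) (wf1 h β) β :=
  (hasDerivAt_z1 β).ofReal_comp.add ((((hasDerivAt_v0 β).const_mul h).ofReal_comp).mul_const Complex.I)
theorem hasDerivAt_wf1 (h β : ℝ) : HasDerivAt (wf1 h) (wf2 h β) β :=
  (hasDerivAt_x1 β).ofReal_comp.add ((((hasDerivAt_v1 β).const_mul h).ofReal_comp).mul_const Complex.I)

theorem wf_re (h β : ℝ) : (wf h β).re = z₁ β := by simp [wf]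
theorem wf_im (h β : ℝ) : (wf h β).im = h * v0 β := by simp [wf]

theorem x1_cell {m r β : ℝ} (hm0 : 0 ≤ m - r) (hm1 : m + r ≤ 3.15)
    (hβ : β ∈ Set.Icc (m - r) (m + r)) : |x1 β - x1 m| ≤ 1.01 * r := by
  have hr : 0 ≤ r := by linarith [hβ.1, hβ.2]
  have := (convex_Icc (m - r) (m + r)).norm_image_sub_le_of_norm_hasDerivWithin_le
      (f := x1) (f' := x2) (C := 1.01) (fun x _ => (hasDerivAt_x1 x).hasDerivWithinAt)
      (fun x hx => by
        have := x2_abs (β := x) (by linarith [hx.1]) (by linarith [hx.2])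
        rw [Real.norm_eq_abs]; linarith)
      (x := m) (y := β) ⟨by linarith, by linarith⟩ hβ
  rw [Real.norm_eq_abs, Real.norm_eq_abs] at this
  have h2 : |β - m| ≤ r := by rw [abs_le]; constructor <;> linarith [hβ.1, hβ.2]
  linarith

theorem v0_cell {m r β : ℝ} (hm0 : 0 ≤ m - r)
    (hβ : β ∈ Set.Icc (m - r) (m + r)) : |v0 β - v0 m| ≤ 1.71 * r := by
  have hr : 0 ≤ r := by linarith [hβ.1, hβ.2]
  have := (convex_Icc (m - r) (m + r)).norm_image_sub_le_of_norm_hasDerivWithin_le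
      (f := v0) (f' := v1) (C := 1.71) (fun x _ => (hasDerivAt_v0 x).hasDerivWithinAt)
      (fun x hx => by
        have := v1_abs (β := x) (by linarith [hx.1])
        rw [Real.norm_eq_abs]; linarith)
      (x := m) (y := β) ⟨by linarith, by linarith⟩ hβ
  rw [Real.norm_eq_abs, Real.norm_eq_abs] at this
  have h2 : |β - m| ≤ r := by rw [abs_le]; constructor <;> linarith [hβ.1, hβ.2]
  linarith

theorem z1_cell {m r β X : ℝ} (hX : ∀ β ∈ Set.Icc (m - r) (m + r), |x1 β| ≤ X)
    (hβ : β ∈ Set.Icc (m - r) (m + r)) : |z₁ β - z₁ m| ≤ X * r := by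
  have hr : 0 ≤ r := by linarith [hβ.1, hβ.2]
  have := (convex_Icc (m - r) (m + r)).norm_image_sub_le_of_norm_hasDerivWithin_le
      (f := z₁) (f' := x1) (C := X) (fun x _ => (hasDerivAt_z1 x).hasDerivWithinAt)
      (fun x hx => hX x hx)
      (x := m) (y := β) ⟨by linarith, by linarith⟩ hβ
  rw [Real.norm_eq_abs, Real.norm_eq_abs] at this
  have h2 : |β - m| ≤ r := by rw [abs_le]; constructor <;> linarith [hβ.1, hβ.2]
  have hX0 : 0 ≤ X := (abs_nonneg _).trans (hX m ⟨by linarith, by linarith⟩)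
  nlinarith

theorem norm_re_im (a b : ℝ) : ‖(a : ℂ) + (b : ℂ) * Complex.I‖ ≤ |a| + |b| := by
  refine (norm_add_le _ _).trans ?_
  simp

/-- The second derivative constant of the cell. -/
noncomputable def Mc (h1 X g0 g1 g2 : ℝ) : ℝ :=
  1.01 * g0 + (2.02 * (X + h1 * 1.71) + X * (1.01 + h1 * 4.85)) * g1
    + X * (X ^ 2 + (h1 * 1.71) ^ 2) * g2

theorem cell_rule {G G1 G2 : ℂ → ℂ} {h h1 m r X g0 g1 g2 : ℝ} (hr : 0 ≤ r)
    (hm0 : 0 ≤ m - r) (hm1 : m + r ≤ 3.15) (hh : 0 ≤ h) (hh1 : h ≤ h1)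
    (hX : ∀ β ∈ Set.Icc (m - r) (m + r), |x1 β| ≤ X)
    (hG : ∀ β ∈ Set.Icc (m - r) (m + r), HasDerivAt G (G1 (wf h β)) (wf h β))
    (hG1 : ∀ β ∈ Set.Icc (m - r) (m + r), HasDerivAt G1 (G2 (wf h β)) (wf h β))
    (b0 : ∀ β ∈ Set.Icc (m - r) (m + r), ‖G (wf h β)‖ ≤ g0)
    (b1 : ∀ β ∈ Set.Icc (m - r) (m + r), ‖G1 (wf h β)‖ ≤ g1)
    (b2 : ∀ β ∈ Set.Icc (m - r) (m + r), ‖G2 (wf h β)‖ ≤ g2) :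
    ‖(∫ t in (m - r)..(m + r), (x1 t : ℂ) * G (wf h t)) - (2 * r : ℝ) * ((x1 m : ℂ) * G (wf h m))‖
      ≤ Mc h1 X g0 g1 g2 * (2 * r) ^ 3 / 24 := by
  have hm : m ∈ Set.Icc (m - r) (m + r) := ⟨by linarith, by linarith⟩
  have hX0 : 0 ≤ X := (abs_nonneg _).trans (hX m hm)
  have g00 : 0 ≤ g0 := (norm_nonneg _).trans (b0 m hm)
  have g10 : 0 ≤ g1 := (norm_nonneg _).trans (b1 m hm)
  have g20 : 0 ≤ g2 := (norm_nonneg _).trans (b2 m hm)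
  apply midpoint_rule (f := fun t => (x1 t : ℂ) * G (wf h t))
    (f1 := fun t => (x2 t : ℂ) * G (wf h t) + (x1 t : ℂ) * (wf1 h t * G1 (wf h t)))
    (f2 := fun t => (x3 t : ℂ) * G (wf h t)
        + (2 * (x2 t : ℂ) * wf1 h t + (x1 t : ℂ) * wf2 h t) * G1 (wf h t)
        + (x1 t : ℂ) * (wf1 h t) ^ 2 * G2 (wf h t)) hr
  · intro t ht
    exact (hasDerivAt_x1 t).ofReal_comp.mul ((hG t ht).scomp t (hasDerivAt_wf h t))
  · intro t ht
    have e1 := (hasDerivAt_x2 t).ofReal_comp.mul ((hG t ht).scomp t (hasDerivAt_wf h t))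
    have e2 := (hasDerivAt_x1 t).ofReal_comp.mul ((hasDerivAt_wf1 h t).mul
      ((hG1 t ht).scomp t (hasDerivAt_wf h t)))
    refine (e1.add e2).congr_deriv ?_
    simp only [smul_eq_mul, Function.comp, Pi.mul_apply]
    ring
  · intro t ht
    have t0 : 0 ≤ t := by linarith [ht.1]
    have t1 : t ≤ 3.15 := by linarith [ht.2]
    have a1 := hX t ht
    have a2 : |x2 t| ≤ 1.01 := (x2_abs t0 t1).trans (by norm_num)
    have a3 := x3_abs t0 t1
    have hv1 : |h * v1 t| ≤ h1 * 1.71 := by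
      rw [abs_mul, abs_of_nonneg hh]
      have := v1_abs t0
      gcongr
      linarith
    have hv2 : |h * v2 t| ≤ h1 * 4.85 := by
      rw [abs_mul, abs_of_nonneg hh]
      have := v2_abs t0
      gcongr
      linarith
    have w1 : ‖wf1 h t‖ ≤ X + h1 * 1.71 := (norm_re_im _ _).trans (add_le_add a1 hv1)
    have w2 : ‖wf2 h t‖ ≤ 1.01 + h1 * 4.85 := (norm_re_im _ _).trans (add_le_add a2 hv2)
    have w1s : ‖wf1 h t‖ ^ 2 ≤ X ^ 2 + (h1 * 1.71) ^ 2 := by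
      rw [← Complex.normSq_eq_norm_sq, wf1, Complex.normSq_add_mul_I]
      have e1 : (x1 t) ^ 2 ≤ X ^ 2 := sq_le_sq' (abs_le.1 a1).1 (abs_le.1 a1).2
      have e2 : (h * v1 t) ^ 2 ≤ (h1 * 1.71) ^ 2 := sq_le_sq' (abs_le.1 hv1).1 (abs_le.1 hv1).2
      exact add_le_add e1 e2
    unfold Mc
    refine (norm_add₃_le).trans (add_le_add (add_le_add ?_ ?_) ?_)
    · rw [norm_mul, Complex.norm_real, Real.norm_eq_abs]
      have := b0 t ht
      gcongr
    · rw [norm_mul]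
      have := b1 t ht
      have h10 : 0 ≤ h1 := hh.trans hh1
      gcongr
      refine (norm_add_le _ _).trans (add_le_add ?_ ?_)
      · rw [norm_mul, norm_mul, Complex.norm_real, Real.norm_eq_abs]
        have : ‖(2:ℂ)‖ = 2 := by simp
        rw [this]
        calc 2 * |x2 t| * ‖wf1 h t‖ ≤ 2 * 1.01 * (X + h1 * 1.71) := by gcongr
          _ = _ := by ring
      · rw [norm_mul, Complex.norm_real, Real.norm_eq_abs]
        gcongr
    · rw [norm_mul, norm_mul, norm_pow, Complex.norm_real, Real.norm_eq_abs]
      have := b2 t ht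
      gcongr

/-! ### Complex fixed-point ball arithmetic -/

/-- A ball with centre `((a - b) + (c - d) i) / 2^64` and radius `e / 2^64`. -/
structure CB where
  a : Nat
  b : Nat
  c : Nat
  d : Nat
  e : Nat

namespace CB

/-- The scaled centre as a complex number. -/
noncomputable def ctr (x : CB) : ℂ := ⟨(x.a : ℝ) - x.b, (x.c : ℝ) - x.d⟩

/-- Membership in a ball. -/
def mem (z : ℂ) (b : CB) : Prop := ‖z * 18446744073709551616 - b.ctr‖ ≤ (b.e : ℝ)

/-- normalised difference -/
def nrmz (p q r s e : Nat) : CB := ⟨Nat.sub p q, Nat.sub q p, Nat.sub r s, Nat.sub s r, e⟩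

def add (x y : CB) : CB :=
  nrmz (Nat.add x.a y.a) (Nat.add x.b y.b) (Nat.add x.c y.c) (Nat.add x.d y.d) (Nat.add x.e y.e)
def neg (x : CB) : CB := ⟨x.b, x.a, x.d, x.c, x.e⟩
def sub (x y : CB) : CB :=
  nrmz (Nat.add x.a y.b) (Nat.add x.b y.a) (Nat.add x.c y.d) (Nat.add x.d y.c) (Nat.add x.e y.e)
/-- upper bound for the norm of the centre -/
def nc (x : CB) : Nat := Nat.add (Nat.add x.a x.b) (Nat.add x.c x.d)
def mul0 (p q r s e : Nat) : CB :=
  ⟨Nat.div (Nat.sub p q) 18446744073709551616, Nat.div (Nat.sub q p) 18446744073709551616,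
   Nat.div (Nat.sub r s) 18446744073709551616, Nat.div (Nat.sub s r) 18446744073709551616,
   Nat.add (Nat.div e 18446744073709551616) 3⟩
def mul (x y : CB) : CB :=
  mul0 (Nat.add (Nat.add (Nat.mul x.a y.a) (Nat.mul x.b y.b)) (Nat.add (Nat.mul x.c y.d) (Nat.mul x.d y.c)))
    (Nat.add (Nat.add (Nat.mul x.a y.b) (Nat.mul x.b y.a)) (Nat.add (Nat.mul x.c y.c) (Nat.mul x.d y.d)))
    (Nat.add (Nat.add (Nat.mul x.a y.c) (Nat.mul x.b y.d)) (Nat.add (Nat.mul x.c y.a) (Nat.mul x.d y.b)))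
    (Nat.add (Nat.add (Nat.mul x.a y.d) (Nat.mul x.b y.c)) (Nat.add (Nat.mul x.c y.b) (Nat.mul x.d y.a)))
    (Nat.add (Nat.add (Nat.mul (nc x) y.e) (Nat.mul (nc y) x.e)) (Nat.mul x.e y.e))
def nmul (n : Nat) (x : CB) : CB :=
  ⟨Nat.mul n x.a, Nat.mul n x.b, Nat.mul n x.c, Nat.mul n x.d, Nat.mul n x.e⟩
def sdiv (x : CB) (k : Nat) : CB :=
  ⟨Nat.div x.a k, Nat.div x.b k, Nat.div x.c k, Nat.div x.d k, Nat.add (Nat.div x.e k) 3⟩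
def mulI (x : CB) : CB := ⟨x.d, x.c, x.a, x.b, x.e⟩
def reP (x : CB) : CB := ⟨x.a, x.b, 0, 0, x.e⟩
def imP (x : CB) : CB := ⟨x.c, x.d, 0, 0, x.e⟩
def widen (x : CB) (r : Nat) : CB := ⟨x.a, x.b, x.c, x.d, Nat.add x.e r⟩
def ofN (n : Nat) : CB := ⟨Nat.mul n 18446744073709551616, 0, 0, 0, 0⟩
def rat (p q : Nat) : CB := sdiv (ofN p) q
/-- an upper bound (scaled) for the norm -/
def nrm (x : CB) : Nat := Nat.add (nc x) x.e
/-- absolute values of the coordinates of the centre -/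
def ar (x : CB) : Nat := Nat.add (Nat.sub x.a x.b) (Nat.sub x.b x.a)
def ai (x : CB) : Nat := Nat.add (Nat.sub x.c x.d) (Nat.sub x.d x.c)
def nsq (x : CB) : Nat := Nat.add (Nat.mul (ar x) (ar x)) (Nat.mul (ai x) (ai x))
def inv0 (x : CB) (n L : Nat) : CB :=
  ⟨Nat.div (Nat.mul 340282366920938463463374607431768211456 x.a) n,
   Nat.div (Nat.mul 340282366920938463463374607431768211456 x.b) n,
   Nat.div (Nat.mul 340282366920938463463374607431768211456 x.d) n,
   Nat.div (Nat.mul 340282366920938463463374607431768211456 x.c) n,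
   Nat.add (Nat.div (Nat.mul 340282366920938463463374607431768211456 x.e)
     (Nat.mul L (Nat.sub L x.e))) 3⟩

theorem mem_iff {z : ℂ} {b : CB} :
    mem z b ↔ ‖z * 18446744073709551616 - b.ctr‖ ≤ (b.e : ℝ) := Iff.rfl

theorem sub_sub_cast (p q : ℕ) : ((p - q : ℕ) : ℝ) - ((q - p : ℕ) : ℝ) = (p : ℝ) - q := by
  rcases le_total p q with h | h
  · rw [Nat.sub_eq_zero_of_le h, Nat.cast_sub h]; simp
  · rw [Nat.sub_eq_zero_of_le h, Nat.cast_sub h]; simp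

theorem sub_add_cast (p q : ℕ) : ((p - q + (q - p) : ℕ) : ℝ) = |(p : ℝ) - q| := by
  rcases le_total p q with h | h
  · rw [Nat.sub_eq_zero_of_le h, zero_add, Nat.cast_sub h, abs_sub_comm, abs_of_nonneg]
    have : (p : ℝ) ≤ q := by exact_mod_cast h
    linarith
  · rw [Nat.sub_eq_zero_of_le h, add_zero, Nat.cast_sub h, abs_of_nonneg]
    have : (q : ℝ) ≤ p := by exact_mod_cast h
    linarith

theorem ctr_nrmz (p q r s e : ℕ) :
    (nrmz p q r s e).ctr = ⟨(p : ℝ) - q, (r : ℝ) - s⟩ := by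
  apply Complex.ext
  · exact sub_sub_cast p q
  · exact sub_sub_cast r s

theorem mem_add {x y : ℂ} {a b : CB} (hx : mem x a) (hy : mem y b) : mem (x + y) (add a b) := by
  rw [mem_iff] at *
  have : (x + y) * 18446744073709551616 - (add a b).ctr
      = (x * 18446744073709551616 - a.ctr) + (y * 18446744073709551616 - b.ctr) := by
    have : (add a b).ctr = a.ctr + b.ctr := by
      rw [add, ctr_nrmz]
      apply Complex.ext <;> simp [ctr] <;> ring
    rw [this]; ring
  rw [this]
  refine (norm_add_le _ _).trans ?_
  have : ((add a b).e : ℝ) = a.e + b.e := by simp [add, nrmz]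
  linarith

theorem mem_neg {x : ℂ} {a : CB} (hx : mem x a) : mem (-x) (neg a) := by
  rw [mem_iff] at *
  have : (-x) * 18446744073709551616 - (neg a).ctr
      = -(x * 18446744073709551616 - a.ctr) := by
    have : (neg a).ctr = - a.ctr := by
      apply Complex.ext <;> simp [ctr, neg]
    rw [this]; ring
  rw [this, norm_neg]
  exact hx

theorem mem_sub {x y : ℂ} {a b : CB} (hx : mem x a) (hy : mem y b) : mem (x - y) (sub a b) := by
  have h := mem_add hx (mem_neg hy)
  have e : add a (neg b) = sub a b := rfl
  rw [e, ← sub_eq_add_neg] at h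
  exact h

theorem norm_ctr_le (x : CB) : ‖x.ctr‖ ≤ (nc x : ℝ) := by
  refine (Complex.norm_le_abs_re_add_abs_im _).trans ?_
  have h1 : |x.ctr.re| ≤ (x.a : ℝ) + x.b := by
    have := abs_sub (x.a : ℝ) x.b
    simpa [ctr] using this
  have h2 : |x.ctr.im| ≤ (x.c : ℝ) + x.d := by
    have := abs_sub (x.c : ℝ) x.d
    simpa [ctr] using this
  have h3 : (nc x : ℝ) = ((x.a : ℝ) + x.b) + ((x.c : ℝ) + x.d) := by simp [nc]
  linarith

theorem norm_le_nrm {x : ℂ} {a : CB} (hx : mem x a) :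
    ‖x‖ * 18446744073709551616 ≤ (nrm a : ℝ) := by
  rw [mem_iff] at hx
  have h1 : ‖x‖ * 18446744073709551616 = ‖x * 18446744073709551616‖ := by
    rw [norm_mul]; simp
  rw [h1]
  have h2 : x * 18446744073709551616 = (x * 18446744073709551616 - a.ctr) + a.ctr := by ring
  rw [h2]
  refine (norm_add_le _ _).trans ?_
  have := norm_ctr_le a
  have h3 : (nrm a : ℝ) = (nc a : ℝ) + a.e := by
    simp [nrm]
  linarith

theorem re_le_up {x : ℂ} {a : CB} (hx : mem x a) :
    x.re * 18446744073709551616 ≤ (a.a : ℝ) - a.b + a.e := by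
  rw [mem_iff] at hx
  have h1 := (Complex.abs_re_le_norm _).trans hx
  have h2 := (abs_le.1 h1).2
  have h4 : (x * 18446744073709551616 - a.ctr).re = x.re * 18446744073709551616 - (a.a - a.b) := by
    simp [ctr]
  linarith

theorem nat_div_err (p k : ℕ) (hk : 0 < k) :
    0 ≤ (p : ℝ) / k - ((p / k : ℕ) : ℝ) ∧ (p : ℝ) / k - ((p / k : ℕ) : ℝ) ≤ 1 := by
  have hk' : (0 : ℝ) < k := by exact_mod_cast hk
  constructor
  · have := @Nat.cast_div_le ℝ _ _ _ p k
    linarith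
  · rw [sub_le_iff_le_add, div_le_iff₀ hk']
    have := Nat.lt_div_mul_add (a := p) hk
    have h2 : (p : ℝ) ≤ ((p / k * k + k : ℕ) : ℝ) := by exact_mod_cast this.le
    push_cast at h2
    nlinarith

/-- rounding all coordinates down moves by at most 2 -/
theorem floor_err (p q r s : ℕ) (k : ℕ) (hk : 0 < k) :
    ‖(⟨((p : ℝ) - q) / k, ((r : ℝ) - s) / k⟩ : ℂ)
      - ⟨((p / k : ℕ) : ℝ) - ((q / k : ℕ) : ℝ), ((r / k : ℕ) : ℝ) - ((s / k : ℕ) : ℝ)⟩‖ ≤ 2 := by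
  have key : ∀ p q : ℕ, |((p : ℝ) - q) / k - (((p / k : ℕ) : ℝ) - ((q / k : ℕ) : ℝ))| ≤ 1 := by
    intro p q
    have h1 := nat_div_err p k hk
    have h2 := nat_div_err q k hk
    rw [sub_div, abs_le]
    constructor <;> linarith [h1.1, h1.2, h2.1, h2.2]
  refine (Complex.norm_le_abs_re_add_abs_im _).trans ?_
  have a1 := key p q
  have a2 := key r s
  simp only [Complex.sub_re, Complex.sub_im]
  linarith

theorem nat_div_ge (a k : ℕ) (hk : 0 < k) : (a : ℝ) / k ≤ ((a / k : ℕ) : ℝ) + 1 := by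
  have := (nat_div_err a k hk).2
  linarith

theorem mem_sdiv {x : ℂ} {a : CB} {k : ℕ} (hk : 0 < k) (hx : mem x a) :
    mem (x / k) (sdiv a k) := by
  rw [mem_iff] at *
  have hk' : (0 : ℝ) < k := by exact_mod_cast hk
  have hkc : (k : ℂ) ≠ 0 := by exact_mod_cast hk.ne'
  have h1 := floor_err a.a a.b a.c a.d k hk
  have h2 : (⟨((a.a : ℝ) - a.b) / k, ((a.c : ℝ) - a.d) / k⟩ : ℂ) = a.ctr / k := by
    rw [eq_div_iff hkc]
    apply Complex.ext <;> simp [ctr] <;> field_simp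
  rw [h2] at h1
  have h3 : x / k * 18446744073709551616 - (sdiv a k).ctr
      = (x * 18446744073709551616 - a.ctr) / k + (a.ctr / k - (sdiv a k).ctr) := by
    field_simp; ring
  rw [h3]
  refine (norm_add_le _ _).trans ?_
  have h4 : ‖(x * 18446744073709551616 - a.ctr) / (k : ℂ)‖ ≤ (a.e : ℝ) / k := by
    rw [norm_div, Complex.norm_natCast]
    gcongr
  have h5 := nat_div_ge a.e k hk
  have h6 : ((sdiv a k).e : ℝ) = ((a.e / k : ℕ) : ℝ) + 3 := by
    simp only [sdiv]; push_cast [Nat.add_eq]; rfl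
  have h7 : ‖a.ctr / (k : ℂ) - (sdiv a k).ctr‖ ≤ 2 := h1
  rw [h6]; linarith

theorem ctr_mul0 (p q r s e : ℕ) :
    ‖(⟨((p : ℝ) - q) / 18446744073709551616, ((r : ℝ) - s) / 18446744073709551616⟩ : ℂ)
      - (mul0 p q r s e).ctr‖ ≤ 2 := by
  have := floor_err (p - q) (q - p) (r - s) (s - r) 18446744073709551616 (by norm_num)
  rw [sub_sub_cast, sub_sub_cast] at this
  rw [Nat.cast_ofNat] at this
  exact this

theorem mem_mul {x y : ℂ} {a b : CB} (hx : mem x a) (hy : mem y b) : mem (x * y) (mul a b) := by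
  have hN := norm_ctr_le a
  have hM := norm_ctr_le b
  rw [mem_iff] at *
  have h7 : ‖a.ctr * b.ctr / 18446744073709551616 - (mul a b).ctr‖ ≤ 2 := by
    have hh := ctr_mul0 (Nat.add (Nat.add (Nat.mul a.a b.a) (Nat.mul a.b b.b))
        (Nat.add (Nat.mul a.c b.d) (Nat.mul a.d b.c)))
      (Nat.add (Nat.add (Nat.mul a.a b.b) (Nat.mul a.b b.a))
        (Nat.add (Nat.mul a.c b.c) (Nat.mul a.d b.d)))
      (Nat.add (Nat.add (Nat.mul a.a b.c) (Nat.mul a.b b.d))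
        (Nat.add (Nat.mul a.c b.a) (Nat.mul a.d b.b)))
      (Nat.add (Nat.add (Nat.mul a.a b.d) (Nat.mul a.b b.c))
        (Nat.add (Nat.mul a.c b.b) (Nat.mul a.d b.a)))
      (Nat.add (Nat.add (Nat.mul (nc a) b.e) (Nat.mul (nc b) a.e)) (Nat.mul a.e b.e))
    refine le_of_eq_of_le ?_ hh
    change ‖_ - (mul a b).ctr‖ = ‖_ - (mul a b).ctr‖
    congr 2
    rw [div_eq_iff (by norm_num)]
    apply Complex.ext <;> simp [ctr] <;> ring
  have h3 : x * y * 18446744073709551616 - (mul a b).ctr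
      = (a.ctr * (y * 18446744073709551616 - b.ctr) + b.ctr * (x * 18446744073709551616 - a.ctr)
        + (x * 18446744073709551616 - a.ctr) * (y * 18446744073709551616 - b.ctr))
          / 18446744073709551616 +
        (a.ctr * b.ctr / 18446744073709551616 - (mul a b).ctr) := by
    field_simp; ring
  rw [h3]
  refine (norm_add_le _ _).trans ?_
  set N : ℕ := (nc a * b.e + nc b * a.e + a.e * b.e)
    with hNdef
  have h6 : ((mul a b).e : ℝ) = ((N / 18446744073709551616 : ℕ) : ℝ) + 3 := by
    simp only [mul, mul0, hNdef]; push_cast [Nat.add_eq]; rfl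
  have h5 := nat_div_ge N 18446744073709551616 (by norm_num)
  have h4 : ‖(a.ctr * (y * 18446744073709551616 - b.ctr)
        + b.ctr * (x * 18446744073709551616 - a.ctr)
        + (x * 18446744073709551616 - a.ctr) * (y * 18446744073709551616 - b.ctr))
          / 18446744073709551616‖ ≤ (N : ℝ) / (18446744073709551616 : ℕ) := by
    rw [norm_div]
    have : ‖(18446744073709551616 : ℂ)‖ = ((18446744073709551616 : ℕ) : ℝ) := by simp
    rw [this]
    gcongr
    refine (norm_add₃_le).trans ?_
    rw [norm_mul, norm_mul, norm_mul, hNdef]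
    push_cast
    gcongr
  rw [h6]; linarith

theorem mem_nmul {x : ℂ} {a : CB} (n : ℕ) (hx : mem x a) : mem ((n : ℂ) * x) (nmul n a) := by
  rw [mem_iff] at *
  have : (n : ℂ) * x * 18446744073709551616 - (nmul n a).ctr
      = (n : ℂ) * (x * 18446744073709551616 - a.ctr) := by
    have : (nmul n a).ctr = (n : ℂ) * a.ctr := by
      apply Complex.ext <;> simp [ctr, nmul] <;> ring
    rw [this]; ring
  rw [this, norm_mul]
  have h : ((nmul n a).e : ℝ) = ‖(n : ℂ)‖ * a.e := by
    simp [nmul]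
  rw [h]
  gcongr

theorem mem_mulI {x : ℂ} {a : CB} (hx : mem x a) : mem (x * Complex.I) (mulI a) := by
  rw [mem_iff] at *
  have : x * Complex.I * 18446744073709551616 - (mulI a).ctr
      = Complex.I * (x * 18446744073709551616 - a.ctr) := by
    have : (mulI a).ctr = Complex.I * a.ctr := by
      apply Complex.ext <;> simp [ctr, mulI]
    rw [this]; ring
  rw [this, norm_mul, Complex.norm_I, one_mul]
  exact hx

theorem mem_reP {x : ℂ} {a : CB} (hx : mem x a) : mem ((x.re : ℝ) : ℂ) (reP a) := by
  rw [mem_iff] at *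
  have : ((x.re : ℝ) : ℂ) * 18446744073709551616 - (reP a).ctr
      = (((x * 18446744073709551616 - a.ctr).re : ℝ) : ℂ) := by
    apply Complex.ext <;> simp [ctr, reP]
  rw [this, Complex.norm_real]
  exact (Complex.abs_re_le_norm _).trans hx

theorem mem_imP {x : ℂ} {a : CB} (hx : mem x a) : mem ((x.im : ℝ) : ℂ) (imP a) := by
  rw [mem_iff] at *
  have : ((x.im : ℝ) : ℂ) * 18446744073709551616 - (imP a).ctr
      = (((x * 18446744073709551616 - a.ctr).im : ℝ) : ℂ) := by
    apply Complex.ext <;> simp [ctr, imP]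
  rw [this, Complex.norm_real]
  exact (Complex.abs_im_le_norm _).trans hx

theorem mem_widen {x y : ℂ} {a : CB} {r : ℕ} (hx : mem x a)
    (hr : ‖y - x‖ * 18446744073709551616 ≤ r) : mem y (widen a r) := by
  rw [mem_iff] at *
  have : y * 18446744073709551616 - (widen a r).ctr
      = (x * 18446744073709551616 - a.ctr) + (y - x) * 18446744073709551616 := by
    have : (widen a r).ctr = a.ctr := rfl
    rw [this]; ring
  rw [this]
  refine (norm_add_le _ _).trans ?_
  rw [norm_mul]
  have h : ((widen a r).e : ℝ) = a.e + r := by simp [widen]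
  have h2 : ‖(18446744073709551616 : ℂ)‖ = 18446744073709551616 := by simp
  rw [h, h2]; linarith

theorem mem_ofN (n : ℕ) : mem (n : ℂ) (ofN n) := by
  rw [mem_iff]
  have : (n : ℂ) * 18446744073709551616 - (ofN n).ctr = 0 := by
    apply Complex.ext <;> simp [ctr, ofN]
  rw [this]; simp

theorem mem_rat (p : ℕ) (q : ℕ) (hq : 0 < q) : mem ((p : ℂ) / q) (rat p q) :=
  mem_sdiv hq (mem_ofN p)

theorem mem_exact (n : ℕ) : mem ((((n : ℝ) / 18446744073709551616 : ℝ)) : ℂ) ⟨n, 0, 0, 0, 0⟩ := by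
  rw [mem_iff]
  have : ((((n : ℝ) / 18446744073709551616 : ℝ)) : ℂ) * 18446744073709551616
      - (⟨n, 0, 0, 0, 0⟩ : CB).ctr = 0 := by
    apply Complex.ext <;> simp [ctr]
  rw [this]; simp

theorem ar_cast (x : CB) : (ar x : ℝ) = |x.ctr.re| := sub_add_cast x.a x.b
theorem ai_cast (x : CB) : (ai x : ℝ) = |x.ctr.im| := sub_add_cast x.c x.d
theorem nsq_cast (x : CB) : (nsq x : ℝ) = Complex.normSq x.ctr := by
  have : (nsq x : ℝ) = (ar x : ℝ) * ar x + (ai x : ℝ) * ai x := by simp [nsq]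
  rw [this, ar_cast, ai_cast, abs_mul_abs_self, abs_mul_abs_self, Complex.normSq_apply]

theorem mem_inv0 {x : ℂ} {a : CB} {L : ℕ} (hL : L ≤ max (ar a) (ai a)) (hLe : a.e < L)
    (hx : mem x a) :
    mem (x⁻¹) (inv0 a (nsq a) L)
    ∧ x ≠ 0 := by
  rw [mem_iff] at *
  have hLpos : 0 < L := by omega
  have hc : (L : ℝ) ≤ ‖a.ctr‖ := by
    rcases le_max_iff.1 hL with h | h
    · refine le_trans ?_ (Complex.abs_re_le_norm _)
      have : (L : ℝ) ≤ (ar a : ℝ) := by exact_mod_cast h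
      rwa [ar_cast] at this
    · refine le_trans ?_ (Complex.abs_im_le_norm _)
      have : (L : ℝ) ≤ (ai a : ℝ) := by exact_mod_cast h
      rwa [ai_cast] at this
  have hLr : (a.e : ℝ) < L := by exact_mod_cast hLe
  have hL0 : (0 : ℝ) < L := by exact_mod_cast hLpos
  have hc0 : a.ctr ≠ 0 := by
    intro h; rw [h, norm_zero] at hc; linarith
  set s : ℂ := 18446744073709551616 with hs
  have hs0 : s ≠ 0 := by rw [hs]; norm_num
  have hxs : (L : ℝ) - a.e ≤ ‖x * s‖ := by
    have h1 : a.ctr = x * s - (x * s - a.ctr) := by ring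
    have h2 : ‖a.ctr‖ ≤ ‖x * s‖ + ‖x * s - a.ctr‖ := by
      conv_lhs => rw [h1]
      exact norm_sub_le _ _
    linarith
  have hx0 : x ≠ 0 := by
    rintro rfl
    rw [zero_mul, norm_zero] at hxs; linarith
  refine ⟨?_, hx0⟩
  set n : ℕ := nsq a with hn
  have hnsq : ((n : ℕ) : ℝ) = Complex.normSq a.ctr := nsq_cast a
  have hnpos : 0 < n := by
    have : (0 : ℝ) < (n : ℝ) := by rw [hnsq]; exact Complex.normSq_pos.2 hc0
    exact_mod_cast this
  have hnR0 : (n : ℝ) ≠ 0 := by exact_mod_cast hnpos.ne'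
  have h1 := floor_err (340282366920938463463374607431768211456 * a.a)
    (340282366920938463463374607431768211456 * a.b)
    (340282366920938463463374607431768211456 * a.d)
    (340282366920938463463374607431768211456 * a.c) n hnpos
  have h2 : (⟨(((340282366920938463463374607431768211456 * a.a : ℕ) : ℝ) -
      ((340282366920938463463374607431768211456 * a.b : ℕ) : ℝ)) / n,
      (((340282366920938463463374607431768211456 * a.d : ℕ) : ℝ)
        - ((340282366920938463463374607431768211456 * a.c : ℕ) : ℝ)) / n⟩ : ℂ)
      = s * s / a.ctr := by
    have hss : s * s = ((340282366920938463463374607431768211456 : ℝ) : ℂ) := by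
      rw [hs]; norm_num
    rw [hss, show ((340282366920938463463374607431768211456 : ℝ) : ℂ) / a.ctr
      = ((340282366920938463463374607431768211456 : ℝ) : ℂ) * (a.ctr)⁻¹ from div_eq_mul_inv _ _,
      Complex.inv_def, ← hnsq]
    apply Complex.ext
    · simp [ctr]; field_simp
    · simp [ctr]; field_simp
  rw [h2] at h1
  have h3 : x⁻¹ * s - (inv0 a n L).ctr = (-(x * s - a.ctr)) * (s * s) / (x * s * a.ctr)
      + (s * s / a.ctr - (inv0 a n L).ctr) := by
    field_simp; ring
  have h7 : ‖s * s / a.ctr - (inv0 a n L).ctr‖ ≤ 2 := h1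
  have hgoal : ‖x⁻¹ * s - (inv0 a n L).ctr‖ ≤ ((inv0 a n L).e : ℝ) := by
    rw [h3]
    refine (norm_add_le _ _).trans ?_
    have hD : 0 < L * (L - a.e) := Nat.mul_pos hLpos (by omega)
    have h5 := nat_div_ge (340282366920938463463374607431768211456 * a.e) (L * (L - a.e)) hD
    have h6 : ((inv0 a n L).e : ℝ)
        = ((340282366920938463463374607431768211456 * a.e / (L * (L - a.e)) : ℕ) : ℝ) + 3 := by
      simp only [inv0]; push_cast [Nat.add_eq]; rfl
    have h4 : ‖(-(x * s - a.ctr)) * (s * s) / (x * s * a.ctr)‖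
        ≤ ((340282366920938463463374607431768211456 * a.e : ℕ) : ℝ) / ((L * (L - a.e) : ℕ) : ℝ) := by
      rw [norm_div, norm_mul, norm_neg, norm_mul (x * s)]
      have hss : ‖s * s‖ = 340282366920938463463374607431768211456 := by
        rw [hs, norm_mul]; simp; norm_num
      rw [hss]
      push_cast [Nat.cast_sub hLe.le]
      rw [mul_comm (‖x * s - a.ctr‖)]
      have : 0 < (L : ℝ) - a.e := by linarith
      rw [mul_comm ‖x * s‖]
      gcongr
    rw [h6]; linarith
  exact hgoal

end CB

/-! forcing combinators -/
noncomputable def fN {α : Type} (n : Nat) (k : Nat → α) : α :=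
  Nat.rec (k 0) (fun p _ => k (Nat.succ p)) n
noncomputable def fC {α : Type} (x : CB) (k : CB → α) : α :=
  fN x.a fun a => fN x.b fun b => fN x.c fun c => fN x.d fun d => fN x.e fun e => k ⟨a, b, c, d, e⟩
theorem fN_eq {α : Type} (n : Nat) (k : Nat → α) : fN n k = k n := by cases n <;> rfl
theorem fC_eq {α : Type} (a : CB) (k : CB → α) : fC a k = k a := by
  simp [fC, fN_eq]

open CB

/-- multiplication with forced evaluation of intermediate results -/
noncomputable def mulK {α : Type} (x y : CB) (k : CB → α) : α :=
  CB.rec (fun xa xb xc xd xe => CB.rec (fun ya yb yc yd ye =>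
  fN (Nat.add (Nat.add (Nat.mul xa ya) (Nat.mul xb yb)) (Nat.add (Nat.mul xc yd) (Nat.mul xd yc))) fun p =>
  fN (Nat.add (Nat.add (Nat.mul xa yb) (Nat.mul xb ya)) (Nat.add (Nat.mul xc yc) (Nat.mul xd yd))) fun q =>
  fN (Nat.add (Nat.add (Nat.mul xa yc) (Nat.mul xb yd)) (Nat.add (Nat.mul xc ya) (Nat.mul xd yb))) fun r =>
  fN (Nat.add (Nat.add (Nat.mul xa yd) (Nat.mul xb yc)) (Nat.add (Nat.mul xc yb) (Nat.mul xd ya))) fun s =>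
  fC (mul0 p q r s (Nat.add (Nat.add (Nat.mul (Nat.add (Nat.add xa xb) (Nat.add xc xd)) ye)
    (Nat.mul (Nat.add (Nat.add ya yb) (Nat.add yc yd)) xe)) (Nat.mul xe ye))) k) y) x

theorem mulK_eq {α : Type} (x y : CB) (k : CB → α) : mulK x y k = k (mul x y) := by
  cases x; cases y
  simp only [mulK, fN_eq, fC_eq]
  rfl

noncomputable def invK (a : CB) (k : CB → Bool) : Bool :=
  fN (Nat.add (cond (Nat.ble (ar a) (ai a)) (ai a) (ar a)) 0) fun L =>
  cond (Nat.ble (Nat.succ a.e) L)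
    (fN (nsq a) fun n => fC (inv0 a n L) k)
    false

theorem invK_sound {a : CB} {k : CB → Bool} (H : invK a k = true) {x : ℂ} (hx : mem x a) :
    ∃ b, mem x⁻¹ b ∧ x ≠ 0 ∧ k b = true := by
  unfold invK at H
  rw [fN_eq] at H
  set L := Nat.add (cond (Nat.ble (ar a) (ai a)) (ai a) (ar a)) 0 with hL
  have hLm : L ≤ max (ar a) (ai a) := by
    rw [hL]
    cases Nat.ble (ar a) (ai a) <;> simp
  cases hb : Nat.ble (Nat.succ a.e) L with
  | false => rw [hb] at H; simp at H
  | true =>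
    rw [hb, cond_true, fN_eq, fC_eq] at H
    obtain ⟨h2, h3⟩ := mem_inv0 hLm (Nat.le_of_ble_eq_true hb) hx
    exact ⟨_, h2, h3, H⟩

noncomputable def hor (t : CB) (n : Nat) (k : CB → Bool) : CB → Bool :=
  Nat.rec k (fun m ih acc => mulK t acc fun u =>
    fC (add ⟨18446744073709551616, 0, 0, 0, 0⟩ (sdiv u (Nat.succ m))) ih) n
noncomputable def horR (t : ℂ) (n : Nat) : ℂ → ℂ :=
  Nat.rec (fun a => a) (fun m ih acc => ih (1 + (t * acc) / ((m + 1 : ℕ) : ℂ))) n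

theorem horR_zero (t a : ℂ) : horR t 0 a = a := rfl
theorem horR_succ (t a : ℂ) (n : ℕ) :
    horR t (n + 1) a = horR t n (1 + (t * a) / ((n + 1 : ℕ) : ℂ)) := rfl

theorem mem_one : mem 1 ⟨18446744073709551616, 0, 0, 0, 0⟩ := by
  have := mem_ofN 1
  simpa [ofN] using this

theorem hor_sound {t : ℂ} {T : CB} (ht : mem t T) (n : ℕ) {k : CB → Bool} {a : ℂ} {A : CB}
    (ha : mem a A) (H : hor T n k A = true) : ∃ b, mem (horR t n a) b ∧ k b = true := by
  induction n generalizing a A with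
  | zero => exact ⟨A, ha, H⟩
  | succ m ih =>
    have H' : (mulK T A fun u => fC (add ⟨18446744073709551616, 0, 0, 0, 0⟩ (sdiv u (Nat.succ m)))
      (hor T m k)) = true := H
    rw [mulK_eq, fC_eq] at H'
    exact ih (mem_add mem_one (mem_sdiv (Nat.succ_pos m) (mem_mul ht ha))) H'

noncomputable def sqs (n : Nat) (k : CB → Bool) : CB → Bool :=
  Nat.rec k (fun _ ih acc => mulK acc acc ih) n

theorem sqs_sound (n : ℕ) {k : CB → Bool} {a : ℂ} {A : CB}
    (ha : mem a A) (H : sqs n k A = true) : ∃ b, mem (a ^ (2 ^ n)) b ∧ k b = true := by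
  induction n generalizing a A with
  | zero => exact ⟨A, by simpa using ha, H⟩
  | succ m ih =>
    have H' : mulK A A (sqs m k) = true := H
    rw [mulK_eq] at H'
    obtain ⟨b, h1, h2⟩ := ih (mem_mul ha ha) H'
    refine ⟨b, ?_, h2⟩
    rw [pow_succ', pow_mul, pow_two]; exact h1

noncomputable def cexpK (z : CB) (k : CB → Bool) : Bool :=
  fC (sdiv z 32) fun t =>
  cond (Nat.ble (nrm t) 18446744073709551616)
    (hor t 13 (fun s => fC (widen s 226800000) (fun s => sqs 5 k s)) ⟨18446744073709551616, 0, 0, 0, 0⟩)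
    false

theorem cexpK_sound {a : CB} {k : CB → Bool} (H : cexpK a k = true) {x : ℂ} (hx : mem x a) :
    ∃ b, mem (Complex.exp x) b ∧ k b = true := by
  unfold cexpK at H
  rw [fC_eq] at H
  cases hb : Nat.ble (nrm (sdiv a 32)) 18446744073709551616 with
  | false => rw [hb] at H; simp at H
  | true =>
    rw [hb, cond_true] at H
    have ht : mem (x / (32 : ℕ)) (sdiv a 32) := mem_sdiv (by norm_num) hx
    have hn := norm_le_nrm ht
    have hle : (nrm (sdiv a 32) : ℝ) ≤ 18446744073709551616 := by
      exact_mod_cast Nat.le_of_ble_eq_true hb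
    set t : ℂ := x / (32 : ℕ) with htdef
    have hnt : ‖t‖ ≤ 1 := by
      by_contra hcon
      push Not at hcon
      nlinarith
    obtain ⟨b, h1, h2⟩ := hor_sound ht 13 mem_one H
    rw [fC_eq] at h2
    have hb := Complex.exp_bound hnt (n := 14) (by norm_num)
    have hsum : horR t 13 1 = ∑ m ∈ Finset.range 14, t ^ m / (m.factorial : ℂ) := by
      simp only [horR_succ, horR_zero, Finset.sum_range_succ, Finset.sum_range_zero, Nat.factorial]
      push_cast
      ring
    have h3 : mem (Complex.exp t) (widen b 226800000) := by
      apply mem_widen h1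
      rw [hsum]
      have h5 : ‖t‖ ^ 14 ≤ 1 := pow_le_one₀ (norm_nonneg _) hnt
      have h6 : ‖t‖ ^ 14 * (((14 : ℕ).succ : ℝ) * (((14 : ℕ).factorial : ℝ) * ((14 : ℕ) : ℝ))⁻¹)
          ≤ 1 * (((14 : ℕ).succ : ℝ) * (((14 : ℕ).factorial : ℝ) * ((14 : ℕ) : ℝ))⁻¹) := by
        gcongr
      have h7 := hb.trans h6
      have h8 : 1 * (((14 : ℕ).succ : ℝ) * (((14 : ℕ).factorial : ℝ) * ((14 : ℕ) : ℝ))⁻¹)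
         * 18446744073709551616 ≤ ((226800000 : ℕ) : ℝ) := by
        norm_num [Nat.factorial]
      refine le_trans ?_ h8
      gcongr
    obtain ⟨c, h9, h10⟩ := sqs_sound 5 h3 h2
    refine ⟨c, ?_, h10⟩
    rw [← Complex.exp_nat_mul, htdef] at h9
    convert h9 using 2
    push_cast
    ring

open CB

/-! ### Node tables -/

theorem mem_neg1 {x y : ℂ} {a : CB} (h : y = x) (hx : mem x a) : mem y a := h ▸ hx

/-- ball for `1/π` -/
def ipi : CB := ⟨5871781006564002453, 0, 0, 0, 8⟩

theorem mem_ipi : mem ((1 / π : ℝ) : ℂ) ipi := by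
  rw [mem_iff]
  have : ((1 / π : ℝ) : ℂ) * 18446744073709551616 - ipi.ctr
      = ((1 / π * 18446744073709551616 - 5871781006564002453 : ℝ) : ℂ) := by
    apply Complex.ext
    · simp [ctr, ipi]
    · simp [ctr, ipi]
  rw [this, Complex.norm_real, Real.norm_eq_abs, abs_le]
  have h1 := Real.pi_gt_d20
  have h2 := Real.pi_lt_d20
  have e : (ipi.e : ℝ) = 8 := by simp [ipi]
  rw [e]
  constructor
  · rw [neg_le_sub_iff_le_add, ← sub_le_iff_le_add, div_mul_eq_mul_div, le_div_iff₀ Real.pi_pos]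
    nlinarith
  · rw [sub_le_iff_le_add, div_mul_eq_mul_div, div_le_iff₀ Real.pi_pos]
    nlinarith

structure Row where
  x : Nat
  y : Nat
  v : Nat

namespace Row
def X (r : Row) : CB := ⟨Nat.mul r.x 4294967296, 0, 0, 0, 274877906944⟩
def Y (r : Row) : CB := ⟨Nat.mul r.y 4294967296, 0, 0, 0, 274877906944⟩
def V (r : Row) : CB := ⟨Nat.mul r.v 4294967296, 18446744073709551616, 0, 0, 274877906944⟩
end Row

/-- row is correct at `β` -/
def rowOK (β : ℝ) (r : Row) : Prop :=
  mem (z₁ β : ℂ) r.X ∧ mem (x1 β : ℂ) r.Y ∧ mem (v0 β : ℂ) r.V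

theorem mem_of_close {z : ℂ} {B C : CB} (hz : mem z B)
    (h : Nat.ble (nrm (sub B C)) 274877906944 = true) (hc : C.e = 0) :
    mem z ⟨C.a, C.b, C.c, C.d, 274877906944⟩ := by
  rw [mem_iff]
  have h2 : (nrm (sub B C) : ℝ) ≤ 274877906944 := by exact_mod_cast Nat.le_of_ble_eq_true h
  have hC : mem (C.ctr / 18446744073709551616) C := by
    rw [mem_iff, hc]
    have : C.ctr / 18446744073709551616 * 18446744073709551616 - C.ctr = 0 := by
      field_simp; ring
    rw [this]; simp
  have h3 := norm_le_nrm (mem_sub hz hC)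
  have e : z * 18446744073709551616 - (⟨C.a, C.b, C.c, C.d, 274877906944⟩ : CB).ctr
      = (z - C.ctr / 18446744073709551616) * 18446744073709551616 := by
    have : (⟨C.a, C.b, C.c, C.d, 274877906944⟩ : CB).ctr = C.ctr := rfl
    rw [this]; field_simp
  rw [e, norm_mul]
  have : ‖(18446744073709551616 : ℂ)‖ = 18446744073709551616 := by simp
  rw [this]
  push_cast
  linarith

noncomputable def rowK (p q : Nat) (r : Row) : Bool :=
  fC (rat p q) fun m =>
  cexpK (mulI m) fun e1 =>
  mulK m m fun mm =>
  cexpK (neg (sdiv mm 10000)) fun E =>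
  fC (add m ⟨36893488147419103232, 0, 0, 0, 0⟩) fun m2 =>
  fC (sub m ⟨36893488147419103232, 0, 0, 0, 0⟩) fun m3 =>
  mulK m2 m2 fun m22 =>
  mulK m3 m3 fun m33 =>
  cexpK (neg m22) fun P =>
  cexpK (neg m33) fun Q =>
  mulK e1 e1 fun e2 =>
  mulK e2 e1 fun e3 =>
  fC (imP e1) fun s =>
  mulK s E fun sE =>
  mulK (sdiv m 5000) s fun ms =>
  mulK (sub (reP e1) ms) E fun cE =>
  mulK s (add P Q) fun sp =>
  mulK (nmul 3 ipi) (sub (sdiv (imP e3) 3) (sdiv (nmul 2 sp) 5)) fun V =>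
  Bool.and (Nat.ble (nrm (sub (sub m sE) ⟨Nat.mul r.x 4294967296, 0, 0, 0, 0⟩)) 274877906944)
   (Bool.and (Nat.ble (nrm (sub (sub ⟨18446744073709551616, 0, 0, 0, 0⟩ cE)
      ⟨Nat.mul r.y 4294967296, 0, 0, 0, 0⟩)) 274877906944)
    (Nat.ble (nrm (sub V ⟨Nat.mul r.v 4294967296, 18446744073709551616, 0, 0, 0⟩)) 274877906944))

theorem mem_two : mem 2 ⟨36893488147419103232, 0, 0, 0, 0⟩ := by
  have := mem_ofN 2
  simpa [ofN] using this

theorem rowK_sound {p q : ℕ} {r : Row} (hq : 0 < q) (H : rowK p q r = true) :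
    rowOK ((p : ℝ) / q) r := by
  unfold rowK at H
  rw [fC_eq] at H
  set β : ℝ := (p : ℝ) / q with hβ
  have hm : mem (β : ℂ) (rat p q) := by
    have := mem_rat p q hq
    refine mem_neg1 ?_ this
    rw [hβ]; push_cast; rfl
  set m := rat p q
  obtain ⟨e1, he1, H⟩ := cexpK_sound H (mem_mulI hm)
  rw [mulK_eq] at H
  have hmm := mem_mul hm hm
  obtain ⟨E, hE, H⟩ := cexpK_sound H (mem_neg (mem_sdiv (by norm_num) hmm))
  rw [fC_eq, fC_eq, mulK_eq, mulK_eq] at H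
  have hm2 := mem_add hm mem_two
  have hm3 := mem_sub hm mem_two
  obtain ⟨P, hP, H⟩ := cexpK_sound H (mem_neg (mem_mul hm2 hm2))
  obtain ⟨Q, hQ, H⟩ := cexpK_sound H (mem_neg (mem_mul hm3 hm3))
  rw [mulK_eq, mulK_eq, fC_eq, mulK_eq, mulK_eq, mulK_eq, mulK_eq, mulK_eq] at H
  simp only [Bool.and_eq_true] at H
  obtain ⟨H1, H2, H3⟩ := H
  have hs : mem (Real.sin β : ℂ) (imP e1) := by
    have := mem_imP he1
    rw [Complex.exp_ofReal_mul_I_im] at this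
    exact this
  have hc : mem (Real.cos β : ℂ) (reP e1) := by
    have := mem_reP he1
    rw [Complex.exp_ofReal_mul_I_re] at this
    exact this
  have hE' : mem (Ee β : ℂ) E := by
    refine mem_neg1 ?_ hE
    unfold Ee; push_cast; congr 1; ring
  have hP' : mem (pp β : ℂ) P := by
    refine mem_neg1 ?_ hP
    unfold pp; push_cast; congr 1; ring
  have hQ' : mem (qq β : ℂ) Q := by
    refine mem_neg1 ?_ hQ
    unfold qq; push_cast; congr 1; ring
  have hs3 : mem (Real.sin (3 * β) : ℂ) (imP (mul (mul e1 e1) e1)) := by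
    have := mem_imP (mem_mul (mem_mul he1 he1) he1)
    rw [← Complex.exp_add, ← Complex.exp_add] at this
    have e : (β : ℂ) * Complex.I + β * Complex.I + β * Complex.I = ((3 * β : ℝ) : ℂ) * Complex.I := by
      push_cast; ring
    rw [e, Complex.exp_ofReal_mul_I_im] at this
    exact this
  refine ⟨?_, ?_, ?_⟩
  · refine mem_of_close (C := ⟨Nat.mul r.x 4294967296, 0, 0, 0, 0⟩) (mem_neg1 ?_ (mem_sub hm (mem_mul hs hE'))) H1 rfl
    unfold z₁ Ee; push_cast; rfl
  · refine mem_of_close (C := ⟨Nat.mul r.y 4294967296, 0, 0, 0, 0⟩) (mem_neg1 ?_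
      (mem_sub mem_one (mem_mul (mem_sub hc (mem_mul (mem_sdiv (k := 5000) (by norm_num) hm) hs)) hE'))) H2 rfl
    unfold x1; push_cast; rfl
  · refine mem_of_close (C := ⟨Nat.mul r.v 4294967296, 18446744073709551616, 0, 0, 0⟩) (mem_neg1 ?_
      (mem_mul (mem_nmul 3 mem_ipi) (mem_sub (mem_sdiv (k := 3) (by norm_num) hs3)
        (mem_sdiv (k := 5) (by norm_num) (mem_nmul 2 (mem_mul hs (mem_add hP' hQ'))))))) H3 rfl
    unfold v0; push_cast; ring

/-- All rows of a table for the cells of width `1/N` starting with cell number `k`. -/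
def tabOK (N : ℕ) : ℕ → List Row → Prop
  | _, [] => True
  | k, r :: L => rowOK (((2 * k + 1 : ℕ) : ℝ) / ((2 * N : ℕ) : ℝ)) r ∧ tabOK N (k + 1) L

noncomputable def tabK (N : Nat) (L : List Row) : Nat → Bool :=
  List.rec (fun _ => true) (fun r _ ih k =>
    fN k fun k => Bool.and (rowK (Nat.add (Nat.mul 2 k) 1) (Nat.mul 2 N) r) (ih (Nat.succ k))) L

theorem tabK_sound {N : ℕ} (hN : 0 < N) (L : List Row) : ∀ k, tabK N L k = true → tabOK N k L := by
  induction L with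
  | nil => intro k _; trivial
  | cons r L ih =>
    intro k H
    have H' : (fN k fun k => Bool.and (rowK (Nat.add (Nat.mul 2 k) 1) (Nat.mul 2 N) r)
      (tabK N L (Nat.succ k))) = true := H
    rw [fN_eq] at H'
    simp only [Bool.and_eq_true] at H'
    exact ⟨rowK_sound (p := 2 * k + 1) (q := 2 * N) (by omega) H'.1, ih _ H'.2⟩

/-! ### Tables of node values (scaled by `2^32`) -/
def tabA : List Row := [
  ⟨11579262, 136942139, 5214202492⟩, ⟨12456339, 143749731, 5231730921⟩, ⟨13376471, 150719572, 5248895557⟩,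
  ⟨14340671, 157851390, 5265689341⟩, ⟨15349951, 165144905, 5282105332⟩, ⟨16405319, 172599832, 5298136707⟩,
  ⟨17507784, 180215881, 5313776765⟩, ⟨18658352, 187992752, 5329018931⟩, ⟨19858028, 195930141, 5343856752⟩,
  ⟨21107813, 204027739, 5358283907⟩, ⟨22408708, 212285228, 5372294201⟩, ⟨23761711, 220702286, 5385881574⟩,
  ⟨25167818, 229278582, 5399040097⟩, ⟨26628024, 238013783, 5411763981⟩, ⟨28143321, 246907545, 5424047571⟩,
  ⟨29714698, 255959521, 5435885352⟩, ⟨31343144, 265169357, 5447271951⟩, ⟨33029643, 274536693, 5458202139⟩,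
  ⟨34775180, 284061162, 5468670830⟩, ⟨36580734, 293742392, 5478673085⟩, ⟨38447285, 303580004, 5488204113⟩,
  ⟨40375809, 313573614, 5497259272⟩, ⟨42367280, 323722829, 5505834071⟩, ⟨44422668, 334027254, 5513924174⟩,
  ⟨46542943, 344486485, 5521525395⟩, ⟨48729071, 355100114, 5528633706⟩, ⟨50982015, 365867724, 5535245235⟩,
  ⟨53302737, 376788895, 5541356268⟩, ⟨55692195, 387863200, 5546963249⟩, ⟨58151345, 399090205, 5552062785⟩,
  ⟨60681140, 410469471, 5556651642⟩, ⟨63282530, 422000553, 5560726749⟩, ⟨65956462, 433683001, 5564285201⟩,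
  ⟨68703882, 445516356, 5567324255⟩, ⟨71525730, 457500157, 5569841333⟩, ⟨74422946, 469633934, 5571834028⟩,
  ⟨77396466, 481917213, 5573300095⟩, ⟨80447222, 494349514, 5574237460⟩, ⟨83576144, 506930350, 5574644219⟩,
  ⟨86784160, 519659228, 5574518634⟩, ⟨90072192, 532535652, 5573859140⟩, ⟨93441162, 545559117, 5572664343⟩,
  ⟨96891986, 558729114, 5570933019⟩, ⟨100425580, 572045128, 5568664115⟩, ⟨104042853, 585506638, 5565856754⟩,
  ⟨107744715, 599113117, 5562510229⟩, ⟨111532068, 612864033, 5558624006⟩, ⟨115405815, 626758849, 5554197725⟩,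
  ⟨119366853, 640797021, 5549231200⟩, ⟨123416075, 654977999, 5543724418⟩, ⟨127554374, 669301229, 5537677539⟩,
  ⟨131782636, 683766151, 5531090901⟩, ⟨136101745, 698372199, 5523965011⟩, ⟨140512581, 713118802, 5516300552⟩,
  ⟨145016021, 728005382, 5508098383⟩, ⟨149612939, 743031358, 5499359533⟩, ⟨154304203, 758196142, 5490085208⟩,
  ⟨159090679, 773499140, 5480276785⟩, ⟨163973229, 788939754, 5469935815⟩, ⟨168952711, 804517381, 5459064022⟩,
  ⟨174029980, 820231410, 5447663302⟩, ⟨179205886, 836081227, 5435735724⟩, ⟨184481277, 852066212, 5423283526⟩,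
  ⟨189856994, 868185741, 5410309119⟩, ⟨195333878, 884439181, 5396815085⟩, ⟨200912762, 900825898, 5382804172⟩,
  ⟨206594478, 917345251, 5368279302⟩, ⟨212379852, 933996594, 5353243560⟩, ⟨218269709, 950779274, 5337700203⟩,
  ⟨224264866, 967692637, 5321652652⟩, ⟨230366138, 984736019, 5305104494⟩, ⟨236574335, 1001908755, 5288059481⟩,
  ⟨242890265, 1019210173, 5270521529⟩, ⟨249314729, 1036639596, 5252494716⟩, ⟨255848525, 1054196342, 5233983283⟩,
  ⟨262492447, 1071879725, 5214991630⟩, ⟨269247284, 1089689053, 5195524316⟩, ⟨276113821, 1107623629, 5175586059⟩,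
  ⟨283092839, 1125682753, 5155181734⟩, ⟨290185114, 1143865716, 5134316370⟩]

set_option maxRecDepth 100000 in
theorem tabA_ok : tabOK 160 40 tabA :=
  tabK_sound (by norm_num) _ _ (by decide +kernel)

def tabB : List Row := [
  ⟨295579109, 1157583782, 5118367903⟩, ⟨299210900, 1166767488, 5107594241⟩, ⟨302871438, 1175981752, 5096708287⟩,
  ⟨306560818, 1185226485, 5085710726⟩, ⟨310279135, 1194501595, 5074602254⟩, ⟨314026484, 1203806993, 5063383575⟩,
  ⟨317802960, 1213142588, 5052055403⟩, ⟨321608657, 1222508287, 5040618462⟩, ⟨325443668, 1231903999, 5029073483⟩,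
  ⟨329308088, 1241329634, 5017421208⟩, ⟨333202009, 1250785097, 5005662388⟩, ⟨337125526, 1260270297, 4993797781⟩,
  ⟨341078730, 1269785142, 4981828158⟩, ⟨345061714, 1279329538, 4969754294⟩, ⟨349074570, 1288903391, 4957576976⟩,
  ⟨353117390, 1298506608, 4945296999⟩, ⟨357190267, 1308139096, 4932915167⟩, ⟨361293290, 1317800760, 4920432293⟩,
  ⟨365426552, 1327491505, 4907849196⟩, ⟨369590142, 1337211238, 4895166708⟩, ⟨373784152, 1346959862, 4882385666⟩,
  ⟨378008671, 1356737282, 4869506916⟩, ⟨382263790, 1366543403, 4856531314⟩, ⟨386549597, 1376378130, 4843459723⟩,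
  ⟨390866183, 1386241365, 4830293015⟩, ⟨395213636, 1396133012, 4817032068⟩, ⟨399592044, 1406052975, 4803677772⟩,
  ⟨404001496, 1416001157, 4790231023⟩, ⟨408442080, 1425977460, 4776692723⟩, ⟨412913884, 1435981787, 4763063786⟩,
  ⟨417416996, 1446014039, 4749345130⟩, ⟨421951501, 1456074120, 4735537684⟩, ⟨426517488, 1466161930, 4721642384⟩,
  ⟨431115042, 1476277371, 4707660171⟩, ⟨435744250, 1486420344, 4693591997⟩, ⟨440405198, 1496590750, 4679438819⟩,
  ⟨445097971, 1506788489, 4665201605⟩, ⟨449822654, 1517013461, 4650881326⟩, ⟨454579333, 1527265567, 4636478963⟩,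
  ⟨459368092, 1537544707, 4621995504⟩, ⟨464189015, 1547850779, 4607431944⟩, ⟨469042187, 1558183684, 4592789285⟩,
  ⟨473927691, 1568543319, 4578068535⟩, ⟨478845611, 1578929585, 4563270711⟩, ⟨483796029, 1589342378, 4548396836⟩,
  ⟨488779028, 1599781598, 4533447939⟩, ⟨493794691, 1610247142, 4518425057⟩, ⟨498843100, 1620738908, 4503329233⟩,
  ⟨503924337, 1631256794, 4488161517⟩, ⟨509038482, 1641800696, 4472922964⟩, ⟨514185618, 1652370511, 4457614639⟩,
  ⟨519365825, 1662966136, 4442237609⟩, ⟨524579183, 1673587468, 4426792950⟩, ⟨529825773, 1684234403, 4411281744⟩,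
  ⟨535105675, 1694906836, 4395705078⟩, ⟨540418967, 1705604663, 4380064045⟩, ⟨545765730, 1716327780, 4364359747⟩,
  ⟨551146042, 1727076081, 4348593287⟩, ⟨556559982, 1737849462, 4332765778⟩, ⟨562007627, 1748647817, 4316878337⟩,
  ⟨567489057, 1759471041, 4300932085⟩, ⟨573004347, 1770319028, 4284928152⟩, ⟨578553576, 1781191671, 4268867671⟩,
  ⟨584136821, 1792088865, 4252751781⟩, ⟨589754157, 1803010503, 4236581627⟩, ⟨595405662, 1813956478, 4220358358⟩,
  ⟨601091410, 1824926683, 4204083128⟩, ⟨606811479, 1835921010, 4187757098⟩, ⟨612565942, 1846939353, 4171381433⟩,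
  ⟨618354874, 1857981604, 4154957301⟩, ⟨624178351, 1869047654, 4138485877⟩, ⟨630036447, 1880137396, 4121968340⟩,
  ⟨635929235, 1891250720, 4105405874⟩, ⟨641856788, 1902387519, 4088799666⟩, ⟨647819181, 1913547683, 4072150910⟩,
  ⟨653816486, 1924731104, 4055460802⟩, ⟨659848775, 1935937671, 4038730544⟩, ⟨665916120, 1947167276, 4021961340⟩,
  ⟨672018594, 1958419808, 4005154400⟩, ⟨678156268, 1969695158, 3988310937⟩, ⟨684329212, 1980993215, 3971432168⟩,
  ⟨690537499, 1992313868, 3954519315⟩, ⟨696781197, 2003657008, 3937573601⟩, ⟨703060378, 2015022523, 3920596255⟩,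
  ⟨709375111, 2026410302, 3903588509⟩, ⟨715725466, 2037820234, 3886551598⟩, ⟨722111511, 2049252207, 3869486761⟩,
  ⟨728533315, 2060706110, 3852395238⟩, ⟨734990947, 2072181829, 3835278275⟩, ⟨741484474, 2083679254, 3818137119⟩,
  ⟨748013965, 2095198272, 3800973022⟩, ⟨754579486, 2106738769, 3783787237⟩, ⟨761181104, 2118300634, 3766581020⟩,
  ⟨767818887, 2129883754, 3749355629⟩, ⟨774492900, 2141488014, 3732112328⟩, ⟨781203209, 2153113301, 3714852379⟩,
  ⟨787949880, 2164759503, 3697577048⟩, ⟨794732977, 2176426504, 3680287605⟩, ⟨801552567, 2188114192, 3662985320⟩,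
  ⟨808408712, 2199822451, 3645671466⟩, ⟨815301478, 2211551167, 3628347318⟩, ⟨822230928, 2223300225, 3611014152⟩,
  ⟨829197126, 2235069511, 3593673246⟩, ⟨836200134, 2246858910, 3576325880⟩, ⟨843240015, 2258668305, 3558973337⟩,
  ⟨850316831, 2270497583, 3541616898⟩, ⟨857430645, 2282346626, 3524257849⟩, ⟨864581518, 2294215320, 3506897475⟩,
  ⟨871769511, 2306103548, 3489537063⟩, ⟨878994686, 2318011194, 3472177900⟩, ⟨886257101, 2329938142, 3454821276⟩,
  ⟨893556819, 2341884274, 3437468480⟩, ⟨900893898, 2353849474, 3420120803⟩, ⟨908268398, 2365833626, 3402779535⟩,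
  ⟨915680378, 2377836611, 3385445968⟩, ⟨923129896, 2389858313, 3368121394⟩, ⟨930617012, 2401898615, 3350807107⟩,
  ⟨938141782, 2413957397, 3333504397⟩, ⟨945704265, 2426034543, 3316214559⟩, ⟨953304517, 2438129934, 3298938884⟩,
  ⟨960942596, 2450243452, 3281678667⟩, ⟨968618557, 2462374979, 3264435198⟩, ⟨976332458, 2474524395, 3247209771⟩,
  ⟨984084353, 2486691583, 3230003678⟩, ⟨991874299, 2498876423, 3212818209⟩, ⟨999702349, 2511078797, 3195654657⟩,
  ⟨1007568559, 2523298584, 3178514311⟩, ⟨1015472983, 2535535665, 3161398460⟩, ⟨1023415675, 2547789921, 3144308393⟩,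
  ⟨1031396688, 2560061232, 3127245398⟩, ⟨1039416075, 2572349478, 3110210760⟩, ⟨1047473890, 2584654538, 3093205766⟩,
  ⟨1055570184, 2596976293, 3076231699⟩, ⟨1063705009, 2609314622, 3059289842⟩, ⟨1071878417, 2621669404, 3042381475⟩,
  ⟨1080090460, 2634040519, 3025507879⟩, ⟨1088341187, 2646427845, 3008670329⟩, ⟨1096630650, 2658831262, 2991870104⟩,
  ⟨1104958899, 2671250648, 2975108475⟩, ⟨1113325983, 2683685881, 2958386716⟩, ⟨1121731952, 2696136841, 2941706096⟩,
  ⟨1130176855, 2708603405, 2925067882⟩, ⟨1138660740, 2721085452, 2908473340⟩, ⟨1147183655, 2733582859, 2891923732⟩,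
  ⟨1155745649, 2746095504, 2875420318⟩, ⟨1164346768, 2758623266, 2858964356⟩, ⟨1172987060, 2771166021, 2842557100⟩,
  ⟨1181666571, 2783723647, 2826199803⟩, ⟨1190385348, 2796296020, 2809893712⟩, ⟨1199143436, 2808883019, 2793640075⟩,
  ⟨1207940882, 2821484520, 2777440133⟩, ⟨1216777729, 2834100400, 2761295127⟩, ⟨1225654024, 2846730536, 2745206291⟩,
  ⟨1234569810, 2859374803, 2729174858⟩, ⟨1243525131, 2872033079, 2713202058⟩, ⟨1252520031, 2884705240, 2697289115⟩,
  ⟨1261554553, 2897391161, 2681437250⟩, ⟨1270628740, 2910090719, 2665647682⟩, ⟨1279742634, 2922803790, 2649921624⟩,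
  ⟨1288896278, 2935530249, 2634260285⟩]

set_option maxRecDepth 100000 in
theorem tabB_ok : tabOK 320 240 tabB :=
  tabK_sound (by norm_num) _ _ (by decide +kernel)

def tabC : List Row := [
  ⟨1311954562, 2967404153, 2595397983⟩, ⟨1349366688, 3018569965, 2534121929⟩, ⟨1387419641, 3069935006, 2474024155⟩,
  ⟨1426115860, 3121491242, 2415179071⟩, ⟨1465457685, 3173230607, 2357659714⟩, ⟨1505447355, 3225145007, 2301537649⟩,
  ⟨1546087006, 3277226323, 2246882868⟩, ⟨1587378674, 3329466406, 2193763696⟩, ⟨1629324294, 3381857087, 2142246687⟩,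
  ⟨1671925695, 3434390169, 2092396539⟩, ⟨1715184607, 3487057435, 2044275994⟩, ⟨1759102656, 3539850647, 1997945748⟩,
  ⟨1803681363, 3592761547, 1953464367⟩, ⟨1848922150, 3645781859, 1910888195⟩, ⟨1894826331, 3698903289, 1870271276⟩,
  ⟨1941395119, 3752117529, 1831665268⟩, ⟨1988629621, 3805416254, 1795119367⟩, ⟨2036530843, 3858791128, 1760680230⟩,
  ⟨2085099682, 3912233803, 1728391906⟩, ⟨2134336935, 3965735918, 1698295763⟩, ⟨2184243293, 4019289107, 1670430421⟩,
  ⟨2234819341, 4072884992, 1644831696⟩, ⟨2286065561, 4126515191, 1621532534⟩, ⟨2337982329, 4180171316, 1600562956⟩,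
  ⟨2390569917, 4233844974, 1581950012⟩, ⟨2443828491, 4287527770, 1565717728⟩, ⟨2497758114, 4341211308, 1551887062⟩,
  ⟨2552358742, 4394887192, 1540475870⟩, ⟨2607630227, 4448547027, 1531498862⟩, ⟨2663572316, 4502182420, 1524967577⟩,
  ⟨2720184651, 4555784983, 1520890357⟩, ⟨2777466769, 4609346332, 1519272317⟩, ⟨2835418102, 4662858091, 1520115335⟩,
  ⟨2894037979, 4716311890, 1523418037⟩, ⟨2953325623, 4769699370, 1529175785⟩, ⟨3013280153, 4823012181, 1537380675⟩,
  ⟨3073900582, 4876241985, 1548021540⟩, ⟨3135185822, 4929380459, 1561083954⟩, ⟨3197134678, 4982419291, 1576550240⟩,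
  ⟨3259745854, 5035350187, 1594399490⟩]

set_option maxRecDepth 100000 in
theorem tabC_ok : tabOK 80 100 tabC :=
  tabK_sound (by norm_num) _ _ (by decide +kernel)

def tabD : List Row := [
  ⟨3354901374, 5114526048, 1625587785⟩, ⟨3484079577, 5219638987, 1675260774⟩, ⟨3615878489, 5324171815, 1733928797⟩,
  ⟨3750282789, 5428059150, 1801274320⟩, ⟨3887275526, 5531236012, 1876932448⟩, ⟨4026838131, 5633637869, 1960492814⟩,
  ⟨4168950427, 5735200673, 2051501757⟩, ⟨4313590643, 5835860906, 2149464782⟩, ⟨4460735426, 5935555611, 2253849297⟩,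
  ⟨4610359858, 6034222441, 2364087603⟩, ⟨4762437468, 6131799691, 2479580126⟩, ⟨4916940254, 6228226340, 2599698867⟩,
  ⟨5073838694, 6323442088, 2723791051⟩, ⟨5233101771, 6417387394, 2851182955⟩, ⟨5394696987, 6510003514, 2981183888⟩,
  ⟨5558590387, 6601232536, 3113090295⟩, ⟨5724746579, 6691017418, 3246189956⟩, ⟨5893128756, 6779302023, 3379766267⟩,
  ⟨6063698718, 6866031154, 3513102550⟩, ⟨6236416899, 6951150589, 3645486378⟩, ⟨6411242389, 7034607114, 3776213890⟩,
  ⟨6588132962, 7116348558, 3904594046⟩, ⟨6767045099, 7196323822, 4029952812⟩, ⟨6947934018, 7274482917, 4151637233⟩,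
  ⟨7130753702, 7350776989, 4269019379⟩, ⟨7315456928, 7425158354, 4381500116⟩, ⟨7501995293, 7497580526, 4488512700⟩,
  ⟨7690319250, 7567998244, 4589526148⟩, ⟨7880378135, 7636367506, 4684048378⟩, ⟨8072120198, 7702645591, 4771629087⟩,
  ⟨8265492642, 7766791087, 4851862356⟩, ⟨8460441647, 7828763921, 4924388953⟩, ⟨8656912410, 7888525377, 4988898337⟩,
  ⟨8854849176, 7946038125, 5045130332⟩, ⟨9054195277, 8001266246, 5092876477⟩, ⟨9254893162, 8054175248, 5131981028⟩,
  ⟨9456884438, 8104732093, 5162341626⟩, ⟨9660109902, 8152905216, 5183909615⟩, ⟨9864509583, 8198664544, 5196690014⟩,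
  ⟨10070022776, 8241981516, 5200741152⟩, ⟨10276588080, 8282829101, 5196173958⟩, ⟨10484143440, 8321181811, 5183150931⟩,
  ⟨10692626180, 8357015725, 5161884783⟩, ⟨10901973049, 8390308495, 5132636778⟩, ⟨11112120255, 8421039366, 5095714779⟩,
  ⟨11323003508, 8449189185, 5051471016⟩, ⟨11534558059, 8474740418, 5000299594⟩, ⟨11746718741, 8497677154, 4942633762⟩,
  ⟨11959420010, 8517985122, 4878942958⟩, ⟨12172595985, 8535651694, 4809729663⟩, ⟨12386180491, 8550665898, 4735526065⟩,
  ⟨12600107099, 8563018420, 4656890586⟩, ⟨12814309168, 8572701613, 4574404267⟩, ⟨13028719885, 8579709501, 4488667055⟩,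
  ⟨13243272312, 8584037782, 4400294005⟩, ⟨13457899422, 8585683831, 4309911429⟩]

set_option maxRecDepth 100000 in
theorem tabD_ok : tabOK 40 70 tabD :=
  tabK_sound (by norm_num) _ _ (by decide +kernel)

def tabF : List Row := [
  ⟨11191, 1342913, 4395897178⟩, ⟨302086, 12081171, 4595302114⟩, ⟨1397846, 33530809, 4787392004⟩,
  ⟨3832810, 65638141, 4967453991⟩, ⟨8137964, 108322801, 5131017592⟩, ⟨14839613, 161477953, 5273944990⟩,
  ⟨24458064, 224970550, 5392514807⟩, ⟨37506324, 298641675, 5483497796⟩, ⟨54488814, 382306933, 5544222981⟩,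
  ⟨75900110, 475756916, 5572633023⟩, ⟨102223700, 578757729, 5567327790⟩, ⟨133930779, 691051570, 5527595323⟩,
  ⟨171479069, 812357383, 5453429653⟩, ⟨215311669, 942371558, 5345535124⟩, ⟨265855952, 1080768689, 5205317139⟩,
  ⟨323522492, 1227202397, 5034859431⟩, ⟨388704037, 1381306190, 4836888204⟩, ⟨461774528, 1542694383, 4614723675⟩,
  ⟨543088160, 1710963067, 4372219735⟩, ⟨632978500, 1885691117, 4113692649⟩, ⟨731757648, 2066441249, 3843839859⟩,
  ⟨839715461, 2252761115, 3567650175⟩, ⟨957118824, 2444184434, 3290306763⟩, ⟨1084210985, 2640232163, 3017084518⟩,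
  ⟨1221210943, 2840413694, 2753243610⟩, ⟨1368312907, 3044228084, 2503921075⟩, ⟨1525685803, 3251165309, 2274022538⟩,
  ⟨1693472858, 3460707543, 2068116224⟩, ⟨1871791238, 3672330453, 1890331544⟩, ⟨2060731758, 3885504513, 1744264567⟩,
  ⟨2260358653, 4099696327, 1632892724⟩, ⟨2470709422, 4314369971, 1558501004⟩, ⟨2691794729, 4528988329, 1522621813⟩,
  ⟨2923598383, 4743014442, 1525990448⟩, ⟨3166077376, 4955912849, 1568517844⟩, ⟨3419161994, 5167150930, 1649281949⟩,
  ⟨3682755987, 5376200240, 1766538588⟩, ⟨3956736818, 5582537831, 1917752218⟩, ⟨4240955968, 5785647559, 2099646437⟩,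
  ⟨4535239304, 5985021383, 2308273492⟩, ⟨4839387524, 6180160627, 2539101481⟩, ⟨5153176650, 6370577237, 2787117356⟩,
  ⟨5476358593, 6555794998, 3046943268⟩, ⟨5808661774, 6735350727, 3312963372⟩, ⟨6149791807, 6908795433, 3579457763⟩,
  ⟨6499432230, 7075695440, 3840739962⟩, ⟨6857245308, 7235633471, 4091294193⟩, ⟨7222872870, 7388209694, 4325908645⟩,
  ⟨7595937213, 7533042722, 4539801018⟩, ⟨7976042045, 7669770565, 4728732862⟩, ⟨8362773477, 7798051539, 4889109559⟩,
  ⟨8755701063, 7917565118, 5018063262⟩, ⟨9154378877, 8028012736, 5113516606⟩, ⟨9558346627, 8129118534, 5174225638⟩,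
  ⟨9967130812, 8220630050, 5199801030⟩, ⟨10380245906, 8302318847, 5190707288⟩, ⟨10797195574, 8373981088, 5148240339⟩,
  ⟨11217473913, 8435438041, 5074484437⟩, ⟨11640566722, 8486536528, 4972249952⟩, ⟨12065952789, 8527149307, 4844994016⟩,
  ⟨12493105193, 8557175386, 4696726482⟩, ⟨12921492626, 8576540278, 4531903891⟩, ⟨13350580723, 8585196184, 4355314430⟩]

set_option maxRecDepth 100000 in
theorem tabF_ok : tabOK 20 0 tabF :=
  tabK_sound (by norm_num) _ _ (by decide +kernel)

/-! ### The kernel function of the homogeneous part -/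

noncomputable def gg (w : ℂ) : ℂ := Complex.cosh w * ((Complex.sinh w)⁻¹ * (Complex.sinh w)⁻¹)
noncomputable def gg1 (w : ℂ) : ℂ :=
  -((Complex.sinh w)⁻¹ + 2 * ((Complex.sinh w)⁻¹ * ((Complex.sinh w)⁻¹ * (Complex.sinh w)⁻¹)))
noncomputable def gg2 (w : ℂ) : ℂ :=
  Complex.cosh w * ((Complex.sinh w)⁻¹) ^ 2 * (1 + 6 * ((Complex.sinh w)⁻¹) ^ 2)

theorem hasDerivAt_ish {w : ℂ} (hw : Complex.sinh w ≠ 0) :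
    HasDerivAt (fun w => (Complex.sinh w)⁻¹) (-Complex.cosh w / Complex.sinh w ^ 2) w :=
  (Complex.hasDerivAt_sinh w).inv hw

theorem hasDerivAt_gg {w : ℂ} (hw : Complex.sinh w ≠ 0) : HasDerivAt gg (gg1 w) w := by
  have h := (Complex.hasDerivAt_cosh w).mul ((hasDerivAt_ish hw).mul (hasDerivAt_ish hw))
  refine h.congr_deriv ?_
  simp only [gg1, Pi.mul_apply]
  have := Complex.cosh_sq w
  field_simp
  linear_combination (-2) * this

theorem hasDerivAt_gg1 {w : ℂ} (hw : Complex.sinh w ≠ 0) : HasDerivAt gg1 (gg2 w) w := by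
  have h := ((hasDerivAt_ish hw).add (((hasDerivAt_ish hw).mul ((hasDerivAt_ish hw).mul
    (hasDerivAt_ish hw))).const_mul 2)).neg
  refine h.congr_deriv ?_
  simp only [gg2, Pi.mul_apply]
  field_simp
  ring

theorem norm_sinh_sq (w : ℂ) : ‖Complex.sinh w‖ ^ 2 = Real.sinh w.re ^ 2 + Real.sin w.im ^ 2 := by
  rw [← Complex.normSq_eq_norm_sq]
  have hw : w = (w.re : ℂ) + (w.im : ℂ) * Complex.I := (Complex.re_add_im w).symm
  conv_lhs => rw [hw, Complex.sinh_add, Complex.sinh_mul_I, Complex.cosh_mul_I]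
  rw [← Complex.ofReal_sinh, ← Complex.ofReal_cosh, ← Complex.ofReal_sin, ← Complex.ofReal_cos]
  have e : ((Real.sinh w.re : ℂ) * (Real.cos w.im : ℂ) + (Real.cosh w.re : ℂ) * ((Real.sin w.im : ℂ) * Complex.I))
    = ((Real.sinh w.re * Real.cos w.im : ℝ) : ℂ) + ((Real.cosh w.re * Real.sin w.im : ℝ) : ℂ) * Complex.I := by
    push_cast; ring
  rw [e, Complex.normSq_add_mul_I]
  have h1 := Real.cosh_sq w.re
  have h2 := Real.sin_sq_add_cos_sq w.im
  have h3 : Real.cos w.im ^ 2 = 1 - Real.sin w.im ^ 2 := by linarith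
  rw [mul_pow, mul_pow, h1, h3]; ring

theorem norm_cosh_sq (w : ℂ) : ‖Complex.cosh w‖ ^ 2 = 1 + Real.sinh w.re ^ 2 - Real.sin w.im ^ 2 := by
  rw [← Complex.normSq_eq_norm_sq]
  have hw : w = (w.re : ℂ) + (w.im : ℂ) * Complex.I := (Complex.re_add_im w).symm
  conv_lhs => rw [hw, Complex.cosh_add, Complex.sinh_mul_I, Complex.cosh_mul_I]
  rw [← Complex.ofReal_sinh, ← Complex.ofReal_cosh, ← Complex.ofReal_sin, ← Complex.ofReal_cos]
  have e : ((Real.cosh w.re : ℂ) * (Real.cos w.im : ℂ) + (Real.sinh w.re : ℂ) * ((Real.sin w.im : ℂ) * Complex.I))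
    = ((Real.cosh w.re * Real.cos w.im : ℝ) : ℂ) + ((Real.sinh w.re * Real.sin w.im : ℝ) : ℂ) * Complex.I := by
    push_cast; ring
  rw [e, Complex.normSq_add_mul_I]
  have h1 := Real.cosh_sq w.re
  have h2 := Real.sin_sq_add_cos_sq w.im
  have h3 : Real.cos w.im ^ 2 = 1 - Real.sin w.im ^ 2 := by linarith
  rw [mul_pow, mul_pow, h1, h3]; ring

theorem sinh_ne {w : ℂ} (hw : 0 < w.re) : Complex.sinh w ≠ 0 := by
  intro h
  have := norm_sinh_sq w
  rw [h, norm_zero] at this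
  have h2 : 0 < Real.sinh w.re := Real.sinh_pos_iff.2 hw
  nlinarith [sq_nonneg (Real.sin w.im), pow_pos h2 2]

theorem sin_sq_mono {a b : ℝ} (ha : 0 ≤ a) (hab : a ≤ |b|) (hb : |b| ≤ π / 2) :
    Real.sin a ^ 2 ≤ Real.sin b ^ 2 := by
  have h1 : Real.sin b ^ 2 = Real.sin |b| ^ 2 := by
    rcases abs_choice b with h | h <;> rw [h]
    rw [Real.sin_neg, neg_sq]
  rw [h1]
  have h2 : Real.sin a ≤ Real.sin |b| :=
    Real.sin_le_sin_of_le_of_le_pi_div_two (by linarith [Real.pi_pos]) hb hab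
  have h3 : 0 ≤ Real.sin a := Real.sin_nonneg_of_nonneg_of_le_pi ha (by linarith [Real.pi_pos])
  gcongr

theorem gg_bounds {w : ℂ} {xl xu sl R Ch : ℝ} (hw : 0 < w.re) (hxl : 0 ≤ xl) (h1 : xl ≤ w.re)
    (h2 : w.re ≤ xu) (h3 : 0 ≤ sl) (h4 : sl ≤ |w.im|) (h5 : |w.im| ≤ π / 2) (hR0 : 0 ≤ R)
    (hR : 1 ≤ R * ‖Complex.sinh ((xl : ℂ) + (sl : ℂ) * Complex.I)‖ ^ 2)
    (hC : ‖Complex.cosh ((xu : ℂ) + (sl : ℂ) * Complex.I)‖ ≤ Ch) :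
    ‖gg w‖ ≤ Ch * R ∧ ‖gg1 w‖ ≤ R + R * R + (1 + R) / 2 ∧ ‖gg2 w‖ ≤ Ch * (6 * R * R + R) := by
  have hs := sin_sq_mono h3 h4 h5
  have a1 : ‖Complex.sinh ((xl : ℂ) + (sl : ℂ) * Complex.I)‖ ^ 2 ≤ ‖Complex.sinh w‖ ^ 2 := by
    rw [norm_sinh_sq, norm_sinh_sq]
    have : Real.sinh xl ≤ Real.sinh w.re := Real.sinh_le_sinh.2 h1
    have h0 : 0 ≤ Real.sinh xl := Real.sinh_nonneg_iff.2 hxl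
    simp
    gcongr
  have a2 : ‖Complex.cosh w‖ ≤ Ch := by
    refine le_trans ?_ hC
    refine (sq_le_sq₀ (norm_nonneg _) (norm_nonneg _)).1 ?_
    rw [norm_cosh_sq, norm_cosh_sq]
    have : Real.sinh w.re ≤ Real.sinh xu := Real.sinh_le_sinh.2 h2
    have h0 : 0 ≤ Real.sinh w.re := Real.sinh_nonneg_iff.2 hw.le
    simp
    have : Real.sinh w.re ^ 2 ≤ Real.sinh xu ^ 2 := by gcongr
    linarith
  have hne := sinh_ne hw
  have hpos : 0 < ‖Complex.sinh w‖ := norm_pos_iff.2 hne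
  set s := ‖(Complex.sinh w)⁻¹‖ with hsdef
  have hs0 : 0 ≤ s := norm_nonneg _
  have hsR : s ^ 2 ≤ R := by
    rw [hsdef, norm_inv, inv_pow, inv_le_iff_one_le_mul₀ (by positivity)]
    nlinarith
  have hCh0 : 0 ≤ Ch := (norm_nonneg _).trans a2
  have hs1 : s ≤ (1 + R) / 2 := by nlinarith [sq_nonneg (s - 1)]
  refine ⟨?_, ?_, ?_⟩
  · unfold gg
    rw [norm_mul, norm_mul, ← hsdef, ← pow_two]
    gcongr
  · unfold gg1
    rw [norm_neg]
    refine (norm_add_le _ _).trans ?_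
    rw [norm_mul, norm_mul, norm_mul, ← hsdef]
    have : ‖(2:ℂ)‖ = 2 := by simp
    rw [this]
    have h6 : s * (s * s) ≤ (1 + R) / 2 * R := by
      have : s * s ≤ R := by nlinarith
      gcongr
    nlinarith
  · unfold gg2
    rw [norm_mul, norm_mul, norm_pow, ← hsdef]
    have h6 : ‖1 + 6 * (Complex.sinh w)⁻¹ ^ 2‖ ≤ 1 + 6 * R := by
      refine (norm_add_le _ _).trans ?_
      rw [norm_mul, norm_pow, ← hsdef]
      have : ‖(6:ℂ)‖ = 6 := by simp
      rw [this, norm_one]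
      linarith
    calc ‖Complex.cosh w‖ * s ^ 2 * ‖1 + 6 * (Complex.sinh w)⁻¹ ^ 2‖ ≤ Ch * R * (1 + 6 * R) := by gcongr
      _ = _ := by ring

/-- The integrand of the homogeneous part. -/
noncomputable def f1 (h β : ℝ) : ℝ := -2 * (x1 β * (gg (wf h β)).im)

theorem f1_eq {h β : ℝ} (hβ : 0 < β) :
    x1 β * Real.sinh (z₁ β) * Real.sin (h * v0 β) /
          (Real.cosh (z₁ β) - Real.cos (h * v0 β)) ^ 2 +
        x1 β * Real.sinh (z₁ β) * Real.sin (h * v0 β) /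
          (Real.cosh (z₁ β) + Real.cos (h * v0 β)) ^ 2 = f1 h β := by
  have hx := z1_pos hβ
  unfold f1
  set x := z₁ β
  set y := h * v0 β with hy
  have hw : wf h β = (x : ℂ) + (y : ℂ) * Complex.I := rfl
  have hne : Complex.sinh (wf h β) ≠ 0 := sinh_ne (by rw [wf_re]; exact hx)
  have hC : 1 < Real.cosh x := Real.one_lt_cosh.2 hx.ne'
  have h1 := Real.cosh_sq x
  have h2 := Real.sin_sq_add_cos_sq y
  have d1 : 0 < Real.cosh x - Real.cos y := by linarith [Real.cos_le_one y]
  have d2 : 0 < Real.cosh x + Real.cos y := by linarith [Real.neg_one_le_cos y]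
  set S := Real.sinh x
  set C := Real.cosh x
  set s := Real.sin y
  set c := Real.cos y
  have es : Complex.sinh (wf h β) = ⟨S * c, C * s⟩ := by
    rw [hw, Complex.sinh_add, Complex.sinh_mul_I, Complex.cosh_mul_I]
    rw [← Complex.ofReal_sinh, ← Complex.ofReal_cosh, ← Complex.ofReal_sin, ← Complex.ofReal_cos]
    change (S : ℂ) * (c : ℂ) + (C : ℂ) * ((s : ℂ) * Complex.I) = _
    generalize S = S at *
    generalize C = C at *
    generalize s = s at *
    generalize c = c at *
    apply Complex.ext <;> simp
  have ec : Complex.cosh (wf h β) = ⟨C * c, S * s⟩ := by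
    rw [hw, Complex.cosh_add, Complex.sinh_mul_I, Complex.cosh_mul_I]
    rw [← Complex.ofReal_sinh, ← Complex.ofReal_cosh, ← Complex.ofReal_sin, ← Complex.ofReal_cos]
    change (C : ℂ) * (c : ℂ) + (S : ℂ) * ((s : ℂ) * Complex.I) = _
    generalize S = S at *
    generalize C = C at *
    generalize s = s at *
    generalize c = c at *
    apply Complex.ext <;> simp
  have hn : Complex.normSq (Complex.sinh (wf h β)) = (C - c) * (C + c) := by
    rw [es, Complex.normSq_mk]
    have : s ^ 2 = 1 - c ^ 2 := by linarith
    have : S ^ 2 = C ^ 2 - 1 := by linarith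
    nlinarith
  have him : (gg (wf h β)).im = - (S * s * (C ^ 2 + c ^ 2)) / ((C - c) * (C + c)) ^ 2 := by
    unfold gg
    rw [Complex.inv_def, hn, es, ec]
    have h0 : (C - c) * (C + c) ≠ 0 := (mul_pos d1 d2).ne'
    generalize (C - c) * (C + c) = n at *
    have e1 : s ^ 2 = 1 - c ^ 2 := by linarith
    have e2 : S ^ 2 = C ^ 2 - 1 := by linarith
    have key : (C * c) * (-(2 * (S * c) * (C * s))) + (S * s) * ((S * c) ^ 2 - (C * s) ^ 2)
        = - (S * s * (C ^ 2 + c ^ 2)) := by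
      linear_combination S * s * c ^ 2 * e2 - S * s * C ^ 2 * e1
    rw [div_eq_mul_inv, ← key]
    simp only [Complex.mul_im, Complex.mul_re, Complex.ofReal_re, Complex.ofReal_im,
      Complex.conj_re, Complex.conj_im, inv_pow]
    ring
  rw [him]
  field_simp
  ring

theorem j1_cell {h h0 h1 m r X xl xu sl R Ch : ℝ} (hr : 0 < r) (hm0 : 0 < m - r)
    (hm1 : m + r ≤ 3.15) (hh0 : 0 < h0) (hh : h0 ≤ h) (hh1 : h ≤ h1) (hh2 : h1 ≤ 1.25)
    (hX : |x1 m| + 1.01 * r ≤ X)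
    (hxl : 0 ≤ xl) (hxl1 : xl = 0 ∨ xl ≤ z₁ m - X * r) (hxu : z₁ m + X * r ≤ xu)
    (hsl : 0 ≤ sl) (hsl1 : sl = 0 ∨ sl ≤ h0 * (|v0 m| - 1.71 * r)) (hR0 : 0 ≤ R)
    (hR : 1 ≤ R * ‖Complex.sinh ((xl : ℂ) + (sl : ℂ) * Complex.I)‖ ^ 2)
    (hC : ‖Complex.cosh ((xu : ℂ) + (sl : ℂ) * Complex.I)‖ ≤ Ch) :
    ∫ t in (m - r)..(m + r), f1 h t ≤
      (2 * r) * (-2 * (x1 m * gg (wf h0 m)).im)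
        + 2 * (Mc h1 X (Ch * R) (R + R * R + (1 + R) / 2) (Ch * (6 * R * R + R)) * (2 * r) ^ 3 / 24)
      + (h - h0) * ((2 * r) * (-2 * (x1 m * v0 m * gg1 (wf h0 m)).re)
        + (2 * r) * (|x1 m| * (v0 m ^ 2 * (Ch * (6 * R * R + R))) * (h1 - h0))) := by
  have hm : m ∈ Set.Icc (m - r) (m + r) := ⟨by linarith, by linarith⟩
  have hXc : ∀ β ∈ Set.Icc (m - r) (m + r), |x1 β| ≤ X := by
    intro β hβ
    have h1 := x1_cell hm0.le hm1 hβ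
    have h2 : |x1 β| ≤ |x1 m| + |x1 β - x1 m| := by
      have := abs_add_le (x1 m) (x1 β - x1 m)
      simpa using this
    linarith
  have hB : ∀ k ∈ Set.Icc h0 h1, ∀ β ∈ Set.Icc (m - r) (m + r), Complex.sinh (wf k β) ≠ 0 ∧
      ‖gg (wf k β)‖ ≤ Ch * R ∧ ‖gg1 (wf k β)‖ ≤ R + R * R + (1 + R) / 2
        ∧ ‖gg2 (wf k β)‖ ≤ Ch * (6 * R * R + R) := by
    intro k hk β hβ
    have hβ0 : 0 < β := by linarith [hβ.1]
    have hzp := z1_pos hβ0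
    have hz := abs_le.1 (z1_cell hXc hβ)
    have hv := v0_cell hm0.le hβ
    have hva := v0_abs hβ0.le
    have hk0 : 0 < k := hh0.trans_le hk.1
    refine ⟨sinh_ne (by rw [wf_re]; exact hzp), gg_bounds (by rw [wf_re]; exact hzp) hxl ?_ ?_ hsl ?_ ?_ hR0 hR hC⟩
    · rw [wf_re]
      rcases hxl1 with h | h <;> linarith [hz.1]
    · rw [wf_re]; linarith [hz.2]
    · rw [wf_im, abs_mul, abs_of_pos hk0]
      rcases hsl1 with h | h
      · rw [h]; positivity
      · have e : |v0 m| - 1.71 * r ≤ |v0 β| := by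
          have := abs_sub_abs_le_abs_sub (v0 m) (v0 β)
          rw [abs_sub_comm] at this
          linarith
        calc sl ≤ _ := h
          _ ≤ h0 * |v0 β| := by gcongr
          _ ≤ k * |v0 β| := by gcongr; exact hk.1
    · rw [wf_im, abs_mul, abs_of_pos hk0]
      have := Real.pi_gt_three
      have : k * |v0 β| ≤ 1.25 * 0.71 := by gcongr; exact hk.2.trans hh2
      linarith
  have hk : h ∈ Set.Icc h0 h1 := ⟨hh, hh1⟩
  have hcell := cell_rule (G := gg) (G1 := gg1) (G2 := gg2) (h := h) (h1 := h1) hr.le hm0.le hm1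
    (by linarith) hh1 hXc (fun β hβ => hasDerivAt_gg (hB h hk β hβ).1)
    (fun β hβ => hasDerivAt_gg1 (hB h hk β hβ).1) (fun β hβ => (hB h hk β hβ).2.1)
    (fun β hβ => (hB h hk β hβ).2.2.1) (fun β hβ => (hB h hk β hβ).2.2.2)
  set M := Mc h1 X (Ch * R) (R + R * R + (1 + R) / 2) (Ch * (6 * R * R + R)) * (2 * r) ^ 3 / 24
  set G2 := Ch * (6 * R * R + R) with hG2
  -- real part of the cell
  have hci : IntervalIntegrable (fun t => (x1 t : ℂ) * gg (wf h t)) volume (m - r) (m + r) := by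
    apply ContinuousOn.intervalIntegrable
    rw [Set.uIcc_of_le (by linarith)]
    intro t ht
    have e1 := (hasDerivAt_x1 t).ofReal_comp.mul
      ((hasDerivAt_gg (hB h hk t ht).1).scomp t (hasDerivAt_wf h t))
    exact e1.continuousAt.continuousWithinAt
  have hre : ∫ t in (m - r)..(m + r), f1 h t = -2 * (∫ t in (m - r)..(m + r), (x1 t : ℂ) * gg (wf h t)).im := by
    have e := (Complex.imCLM.intervalIntegral_comp_comm hci)
    have e' : (∫ t in (m - r)..(m + r), (x1 t : ℂ) * gg (wf h t)).im
      = ∫ t in (m - r)..(m + r), x1 t * (gg (wf h t)).im := by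
      rw [Complex.imCLM_apply] at e
      rw [← e]
      congr 1
      ext t
      simp
    rw [e', ← intervalIntegral.integral_const_mul]
    rfl
  have him := (Complex.abs_im_le_norm _).trans hcell
  rw [Complex.sub_im, Complex.im_ofReal_mul] at him
  have him2 := (abs_le.1 him).1
  -- Taylor in h
  have hT := taylor_one (f := fun k => gg (wf k m)) (f1 := fun k => (v0 m : ℂ) * Complex.I * gg1 (wf k m))
    (f2 := fun k => ((v0 m : ℂ) * Complex.I) ^ 2 * gg2 (wf k m)) (a := h0) (b := h1) (m := h0)
    (M := v0 m ^ 2 * G2) (t := h) ⟨le_refl _, by linarith⟩ ?_ ?_ ?_ hk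
  rotate_left
  · intro k hk
    have e1 : HasDerivAt (fun k : ℝ => wf k m) ((v0 m : ℂ) * Complex.I) k := by
      have : HasDerivAt (fun k : ℝ => k * v0 m) (v0 m) k := by
        simpa using (hasDerivAt_id k).mul_const (v0 m)
      exact (this.ofReal_comp.mul_const Complex.I).const_add _
    exact (hasDerivAt_gg (hB k hk m hm).1).scomp k e1
  · intro k hk
    have e1 : HasDerivAt (fun k : ℝ => wf k m) ((v0 m : ℂ) * Complex.I) k := by
      have : HasDerivAt (fun k : ℝ => k * v0 m) (v0 m) k := by
        simpa using (hasDerivAt_id k).mul_const (v0 m)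
      exact (this.ofReal_comp.mul_const Complex.I).const_add _
    have := ((hasDerivAt_gg1 (hB k hk m hm).1).scomp k e1).const_mul ((v0 m : ℂ) * Complex.I)
    refine this.congr_deriv ?_
    simp only [smul_eq_mul]; ring
  · intro k hk
    rw [norm_mul, norm_pow, norm_mul, Complex.norm_I, mul_one, Complex.norm_real, Real.norm_eq_abs, sq_abs]
    have := (hB k hk m hm).2.2.2
    gcongr
  have hT2 := (abs_le.1 ((Complex.abs_im_le_norm _).trans hT))
  have e3 : (gg (wf h m) - gg (wf h0 m) - ((h : ℂ) - (h0 : ℂ)) * ((v0 m : ℂ) * Complex.I * gg1 (wf h0 m))).im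
    = (gg (wf h m)).im - (gg (wf h0 m)).im - (h - h0) * (v0 m * (gg1 (wf h0 m)).re) := by
    simp
  rw [e3] at hT2
  have hx := abs_nonneg (x1 m)
  have hG20 : 0 ≤ v0 m ^ 2 * G2 := by
    have := (norm_nonneg _).trans (hB h hk m hm).2.2.2
    positivity
  have hT3 : -(x1 m * ((gg (wf h m)).im - (gg (wf h0 m)).im - (h - h0) * (v0 m * (gg1 (wf h0 m)).re)))
      ≤ |x1 m| * (v0 m ^ 2 * G2 * (h - h0) ^ 2 / 2) := by
    refine (neg_le_abs _).trans ?_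
    rw [abs_mul]
    gcongr
    exact abs_le.2 hT2
  have hT4 : |x1 m| * (v0 m ^ 2 * G2 * (h - h0) ^ 2 / 2)
      ≤ |x1 m| * (v0 m ^ 2 * G2 * ((h - h0) * (h1 - h0)) / 2) := by
    gcongr
    nlinarith
  rw [hre]
  have e4 : ((x1 m : ℂ) * gg (wf h0 m)).im = x1 m * (gg (wf h0 m)).im := by simp
  have e5 : ((x1 m : ℂ) * (v0 m : ℂ) * gg1 (wf h0 m)).re = x1 m * (v0 m * (gg1 (wf h0 m)).re) := by
    rw [mul_assoc]; simp
  have e6 : ((x1 m : ℂ) * gg (wf h m)).im = x1 m * (gg (wf h m)).im := by simp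
  rw [e6] at him2
  rw [e4, e5]
  have hT5 := mul_le_mul_of_nonneg_left (hT3.trans hT4) (show 0 ≤ 2 * (2 * r) by positivity)
  linarith

/-! ### Certified upper bound for the homogeneous part -/

noncomputable def shchK (W : CB) (k : CB → CB → Bool) : Bool :=
  cexpK W fun p => invK p fun q => fC (sdiv (sub p q) 2) fun s => fC (sdiv (add p q) 2) fun c => k s c

theorem shchK_sound {W : CB} {k : CB → CB → Bool} (H : shchK W k = true) {x : ℂ} (hx : mem x W) :
    ∃ s c, mem (Complex.sinh x) s ∧ mem (Complex.cosh x) c ∧ k s c = true := by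
  unfold shchK at H
  obtain ⟨p, hp, H⟩ := cexpK_sound H hx
  obtain ⟨q, hq, _, H⟩ := invK_sound H hp
  rw [fC_eq, fC_eq] at H
  refine ⟨_, _, ?_, ?_, H⟩
  · refine mem_neg1 ?_ (mem_sdiv (k := 2) (by norm_num) (mem_sub hp hq))
    rw [Complex.sinh, Complex.exp_neg]; norm_num
  · refine mem_neg1 ?_ (mem_sdiv (k := 2) (by norm_num) (mem_add hp hq))
    rw [Complex.cosh, Complex.exp_neg]; norm_num

theorem mem_exact2 (n k : ℕ) : mem (((((n : ℝ) / 18446744073709551616 : ℝ)) : ℂ)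
    + ((((k : ℝ) / 18446744073709551616 : ℝ)) : ℂ) * Complex.I) ⟨n, 0, k, 0, 0⟩ := by
  have h := mem_add (mem_exact n) (mem_mulI (mem_exact k))
  simpa [add, mulI, nrmz] using h

/-- Nat lower bound for squared norm of a ball -/
def lowsq (s : CB) : Nat := Nat.sub (nsq s) (Nat.mul (Nat.mul 2 s.e) (Nat.add (ar s) (ai s)))

theorem lowsq_le {x : ℂ} {s : CB} (hx : mem x s) :
    (lowsq s : ℝ) ≤ (‖x‖ * 18446744073709551616) ^ 2 := by
  unfold lowsq
  rcases le_total (Nat.mul (Nat.mul 2 s.e) (Nat.add (ar s) (ai s))) (nsq s) with h | h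
  · have e : ((Nat.sub (nsq s) (Nat.mul (Nat.mul 2 s.e) (Nat.add (ar s) (ai s))) : ℕ) : ℝ)
      = (nsq s : ℝ) - 2 * s.e * (ar s + ai s) := by
      have := Nat.cast_sub (R := ℝ) h
      rw [show Nat.sub (nsq s) (Nat.mul (Nat.mul 2 s.e) (Nat.add (ar s) (ai s)))
        = nsq s - (Nat.mul (Nat.mul 2 s.e) (Nat.add (ar s) (ai s))) from rfl, this]
      simp
    rw [e, nsq_cast, Complex.normSq_eq_norm_sq]
    rw [mem_iff] at hx
    have h1 : ‖s.ctr‖ ≤ ‖x‖ * 18446744073709551616 + s.e := by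
      have : s.ctr = x * 18446744073709551616 - (x * 18446744073709551616 - s.ctr) := by ring
      rw [this]
      refine (norm_sub_le _ _).trans ?_
      rw [norm_mul]
      have : ‖(18446744073709551616 : ℂ)‖ = 18446744073709551616 := by simp
      rw [this]
      linarith
    have h2 : ‖s.ctr‖ ≤ ar s + ai s := by
      rw [ar_cast, ai_cast]; exact Complex.norm_le_abs_re_add_abs_im _
    have h0 : (0:ℝ) ≤ s.e := Nat.cast_nonneg _
    have h3 := norm_nonneg s.ctr
    have h4 : 0 ≤ ‖x‖ * 18446744073709551616 := by positivity
    set n := ‖s.ctr‖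
    set a := ‖x‖ * 18446744073709551616
    rcases le_total n s.e with h5 | h5
    · nlinarith [sq_nonneg a]
    · nlinarith
  · have : Nat.sub (nsq s) (Nat.mul (Nat.mul 2 s.e) (Nat.add (ar s) (ai s))) = 0 := Nat.sub_eq_zero_of_le h
    rw [this]
    simp

theorem cast_aux1 (a n k : ℕ) :
    ((Nat.add a (Nat.add (Nat.div n k) 1) : ℕ) : ℝ) = a + (((n / k : ℕ) : ℝ) + 1) := by
  push_cast [Nat.add_eq]; rfl

theorem cast_aux2 (a n k : ℕ) :
    ((Nat.add (Nat.add a (Nat.div n k)) 1 : ℕ) : ℝ) = a + ((n / k : ℕ) : ℝ) + 1 := by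
  push_cast [Nat.add_eq]; rfl

theorem cast_aux3 (n k : ℕ) :
    ((Nat.add (Nat.div n k) 1 : ℕ) : ℝ) = ((n / k : ℕ) : ℝ) + 1 := by
  push_cast [Nat.add_eq]; rfl

/-- bounds on a cell -/
noncomputable def bndK (N H0 : Nat) (r : Row) (k : Nat → Nat → Nat → Bool) : Bool :=
  fN (Nat.add (Nat.add (nrm r.Y) (Nat.div 1863121151444664713216 (Nat.mul 200 N))) 1) fun Xn =>
  fN (Nat.add (Nat.div Xn (Nat.mul 2 N)) 1) fun D =>
  fN (Nat.sub r.X.a (Nat.add r.X.e D)) fun xl =>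
  fN (Nat.add r.X.a (Nat.add r.X.e D)) fun xu =>
  fN (Nat.div (Nat.mul (Nat.sub (ar r.V) (Nat.add r.V.e
    (Nat.add (Nat.div 3154393236604333326336 (Nat.mul 200 N)) 1))) H0) 100) fun sl =>
  shchK ⟨xl, 0, sl, 0, 0⟩ fun s _ =>
  shchK ⟨xu, 0, sl, 0, 0⟩ fun _ c =>
  fN (lowsq s) fun l =>
  cond (Nat.ble 1 l)
  (fN (Nat.add (Nat.div 6277101735386680763835789423207666416102355444464034512896 l) 1) fun R =>
   fN (nrm c) fun C => k Xn R C) false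

theorem bndK_sound {N H0 : ℕ} (hN : 0 < N) {r : Row} {m : ℝ} (hr : rowOK m r)
    {k : Nat → Nat → Nat → Bool} (H : bndK N H0 r k = true) :
    ∃ Xn Rn Cn : ℕ, ∃ xl xu sl : ℝ,
      |x1 m| + 1.01 * (1 / (2 * N)) ≤ (Xn : ℝ) / 18446744073709551616 ∧
      0 ≤ xl ∧ (xl = 0 ∨ xl ≤ z₁ m - (Xn : ℝ) / 18446744073709551616 * (1 / (2 * N))) ∧
      z₁ m + (Xn : ℝ) / 18446744073709551616 * (1 / (2 * N)) ≤ xu ∧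
      0 ≤ sl ∧ (sl = 0 ∨ sl ≤ (H0 : ℝ) / 100 * (|v0 m| - 1.71 * (1 / (2 * N)))) ∧
      1 ≤ (Rn : ℝ) / 18446744073709551616 * ‖Complex.sinh ((xl : ℂ) + (sl : ℂ) * Complex.I)‖ ^ 2 ∧
      ‖Complex.cosh ((xu : ℂ) + (sl : ℂ) * Complex.I)‖ ≤ (Cn : ℝ) / 18446744073709551616 ∧
      k Xn Rn Cn = true := by
  obtain ⟨hx, hy, hv⟩ := hr
  have hN' : (0:ℝ) < N := Nat.cast_pos.2 hN
  unfold bndK at H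
  rw [fN_eq, fN_eq, fN_eq, fN_eq, fN_eq] at H
  set Xn := Nat.add (Nat.add (nrm r.Y) (Nat.div 1863121151444664713216 (Nat.mul 200 N))) 1 with hXn
  set D := Nat.add (Nat.div Xn (Nat.mul 2 N)) 1 with hD
  set xl := Nat.sub r.X.a (Nat.add r.X.e D) with hxl
  set xu := Nat.add r.X.a (Nat.add r.X.e D) with hxu
  set q := Nat.sub (ar r.V) (Nat.add r.V.e
    (Nat.add (Nat.div 3154393236604333326336 (Nat.mul 200 N)) 1)) with hq
  set sl := Nat.div (Nat.mul q H0) 100 with hsl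
  obtain ⟨s, _, hs, _, H⟩ := shchK_sound H (mem_exact2 xl sl)
  obtain ⟨_, c, _, hc, H⟩ := shchK_sound H (mem_exact2 xu sl)
  rw [fN_eq] at H
  have hl := lowsq_le hs
  generalize lowsq s = l at *
  cases hb : Nat.ble 1 l with
  | false => rw [hb] at H; simp at H
  | true =>
  have hl1 : (1 : ℝ) ≤ l := by exact_mod_cast Nat.le_of_ble_eq_true hb
  have hl0 : 0 < l := Nat.le_of_ble_eq_true hb
  rw [hb, cond_true, fN_eq, fN_eq] at H
  have hzX : |z₁ m * 18446744073709551616 - r.X.a| ≤ r.X.e := by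
    rw [mem_iff] at hx
    have := (Complex.abs_re_le_norm _).trans hx
    simpa [ctr, Row.X] using this
  have hvV : |v0 m| * 18446744073709551616 ≥ ar r.V - r.V.e := by
    rw [mem_iff] at hv
    have := (Complex.abs_re_le_norm _).trans hv
    have e : ((v0 m : ℂ) * 18446744073709551616 - r.V.ctr).re = v0 m * 18446744073709551616 - r.V.ctr.re := by
      simp
    rw [e] at this
    rw [ar_cast]
    have h2 := abs_sub_abs_le_abs_sub (r.V.ctr.re) (v0 m * 18446744073709551616)
    rw [abs_sub_comm, abs_mul] at h2
    have : |(18446744073709551616 : ℝ)| = 18446744073709551616 := by norm_num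
    rw [this] at h2
    linarith
  have hDr : (Xn : ℝ) * (1 / (2 * N)) ≤ D := by
    have := nat_div_ge Xn (2 * N) (by omega)
    have e : (D : ℝ) = ((Xn / (2 * N) : ℕ) : ℝ) + 1 := by
      rw [hD]; push_cast [Nat.add_eq]; rfl
    rw [e]
    rw [mul_one_div]
    push_cast at this ⊢
    exact this
  have hxlr : xl = 0 ∨ (xl : ℝ) = r.X.a - (r.X.e + D) := by
    rcases le_total (Nat.add r.X.e D) r.X.a with h | h
    · right
      rw [hxl, Nat.sub_eq, Nat.cast_sub h]; simp
    · left; exact Nat.sub_eq_zero_of_le h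
  have hqr : q = 0 ∨ (q : ℝ) ≤ ar r.V - r.V.e - 1.71 * (1 / (2 * N)) * 18446744073709551616 := by
    rcases le_total (Nat.add r.V.e (Nat.add (Nat.div 3154393236604333326336 (Nat.mul 200 N)) 1)) (ar r.V) with h | h
    · right
      have := nat_div_ge 3154393236604333326336 (200 * N) (Nat.mul_pos (by norm_num) hN)
      rw [hq, Nat.sub_eq, Nat.cast_sub h]
      have e : ((Nat.add r.V.e (Nat.add (Nat.div 3154393236604333326336 (Nat.mul 200 N)) 1) : ℕ) : ℝ)
        = r.V.e + (((3154393236604333326336 / (200 * N) : ℕ) : ℝ) + 1) := cast_aux1 _ _ _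
      rw [e]
      have e2 : 1.71 * (1 / (2 * N)) * 18446744073709551616 = ((3154393236604333326336 : ℕ) : ℝ) / ((200 * N : ℕ) : ℝ) := by
        push_cast; field_simp; norm_num
      rw [e2]
      linarith
    · left; exact Nat.sub_eq_zero_of_le h
  refine ⟨Xn, _, _, (xl : ℝ) / 18446744073709551616, (xu : ℝ) / 18446744073709551616,
    (sl : ℝ) / 18446744073709551616, ?_, div_nonneg (Nat.cast_nonneg _) (by norm_num), ?_, ?_, div_nonneg (Nat.cast_nonneg _) (by norm_num), ?_, ?_, ?_, H⟩
  · have h1 := norm_le_nrm hy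
    rw [Complex.norm_real, Real.norm_eq_abs] at h1
    have := nat_div_ge 1863121151444664713216 (200 * N) (Nat.mul_pos (by norm_num) hN)
    have e : (Xn : ℝ) = nrm r.Y + ((1863121151444664713216 / (200 * N) : ℕ) : ℝ) + 1 := cast_aux2 _ _ _
    rw [le_div_iff₀ (by norm_num), e]
    have e2 : 1.01 * (1 / (2 * N)) * 18446744073709551616 = ((1863121151444664713216 : ℕ) : ℝ) / ((200 * N : ℕ) : ℝ) := by
        push_cast; field_simp; norm_num
    rw [add_mul, e2]
    linarith
  · rcases hxlr with h | h
    · left; rw [h]; simp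
    · right
      rw [div_le_iff₀ (by norm_num), h, sub_mul]
      have := (abs_le.1 hzX).1
      have e : (Xn : ℝ) / 18446744073709551616 * (1 / (2 * N)) * 18446744073709551616 = Xn * (1 / (2 * N)) := by
        ring
      rw [e]; linarith
  · rw [le_div_iff₀ (by norm_num), add_mul]
    have := (abs_le.1 hzX).2
    have e : (Xn : ℝ) / 18446744073709551616 * (1 / (2 * N)) * 18446744073709551616 = Xn * (1 / (2 * N)) := by
      ring
    have e3 : (xu : ℝ) = r.X.a + (r.X.e + D) := by rw [hxu]; simp
    rw [e, e3]; linarith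
  · have h1 := (nat_div_err (q * H0) 100 (by norm_num)).1
    have e : (sl : ℝ) = ((q * H0 / 100 : ℕ) : ℝ) := rfl
    rcases hqr with h | h
    · left
      rw [hsl, h]; simp
    · right
      rw [div_le_iff₀ (by norm_num), e]
      push_cast at h1
      have hH : (0:ℝ) ≤ H0 / 100 := by positivity
      have : (q : ℝ) * H0 / 100 ≤ H0 / 100 * (|v0 m| * 18446744073709551616 - 1.71 * (1 / (2 * N)) * 18446744073709551616) := by
        calc (q : ℝ) * H0 / 100 = H0 / 100 * q := by ring
          _ ≤ _ := by gcongr; linarith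
      have h2 : (((q * H0 / 100 : ℕ)) : ℝ) ≤ (q : ℝ) * H0 / 100 := by linarith
      refine (h2.trans this).trans (le_of_eq ?_)
      ring
  · have := nat_div_ge 6277101735386680763835789423207666416102355444464034512896 l hl0
    rw [div_le_iff₀ (by linarith)] at this
    have e : ((Nat.add (Nat.div 6277101735386680763835789423207666416102355444464034512896 l) 1 : ℕ) : ℝ)
      = ((6277101735386680763835789423207666416102355444464034512896 / l : ℕ) : ℝ) + 1 := cast_aux3 _ _
    rw [e]
    set Q := ((6277101735386680763835789423207666416102355444464034512896 / l : ℕ) : ℝ) + 1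
    have hQ : 0 ≤ Q := by positivity
    have h3 := mul_le_mul_of_nonneg_left hl hQ
    have h4 := this.trans h3
    push_cast at h4
    rw [mul_pow] at h4
    norm_num at h4 ⊢
    linarith
  · rw [le_div_iff₀ (by norm_num)]
    exact norm_le_nrm hc

/-- evaluates the curvature constant -/
noncomputable def mcK (H1 Xn Rn Cn : Nat) (k : CB → CB → Bool) : Bool :=
  fC (rat (Nat.mul 171 H1) 10000) fun a =>
  mulK a a fun aa =>
  mulK ⟨Rn, 0, 0, 0, 0⟩ ⟨Rn, 0, 0, 0, 0⟩ fun RR =>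
  mulK ⟨Cn, 0, 0, 0, 0⟩ ⟨Rn, 0, 0, 0, 0⟩ fun g0 =>
  fC (add (add ⟨Rn, 0, 0, 0, 0⟩ RR) (sdiv (add ⟨18446744073709551616, 0, 0, 0, 0⟩ ⟨Rn, 0, 0, 0, 0⟩) 2)) fun g1 =>
  mulK ⟨Cn, 0, 0, 0, 0⟩ (add (nmul 6 RR) ⟨Rn, 0, 0, 0, 0⟩) fun g2 =>
  mulK ⟨Xn, 0, 0, 0, 0⟩ ⟨Xn, 0, 0, 0, 0⟩ fun XX =>
  mulK ⟨Xn, 0, 0, 0, 0⟩ (add XX aa) fun t3 =>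
  mulK t3 g2 fun u3 =>
  mulK ⟨Xn, 0, 0, 0, 0⟩ (rat (Nat.add 10100 (Nat.mul 485 H1)) 10000) fun t2 =>
  mulK (add (sdiv (nmul 202 (add ⟨Xn, 0, 0, 0, 0⟩ a)) 100) t2) g1 fun u2 =>
  fC (add (add (sdiv (nmul 101 g0) 100) u2) u3) fun M => k M g2

theorem mcK_sound {H1 Xn Rn Cn : ℕ} {k : CB → CB → Bool} (H : mcK H1 Xn Rn Cn k = true)
    {X R C h1 : ℝ} (hX : X = (Xn : ℝ) / 18446744073709551616) (hR : R = (Rn : ℝ) / 18446744073709551616)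
    (hC : C = (Cn : ℝ) / 18446744073709551616) (hh : h1 = (H1 : ℝ) / 100) :
    ∃ M g2, mem (Mc h1 X (C * R) (R + R * R + (1 + R) / 2) (C * (6 * R * R + R)) : ℂ) M ∧
      mem ((C * (6 * R * R + R) : ℝ) : ℂ) g2 ∧ k M g2 = true := by
  unfold mcK at H
  have mX : mem (X : ℂ) ⟨Xn, 0, 0, 0, 0⟩ := hX ▸ mem_exact Xn
  have mR : mem (R : ℂ) ⟨Rn, 0, 0, 0, 0⟩ := hR ▸ mem_exact Rn
  have mC : mem (C : ℂ) ⟨Cn, 0, 0, 0, 0⟩ := hC ▸ mem_exact Cn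
  have ma := mem_rat (171 * H1) 10000 (by norm_num)
  have mb := mem_rat (10100 + 485 * H1) 10000 (by norm_num)
  simp only [fC_eq, mulK_eq] at H
  have mg2 := mem_mul mC (mem_add (mem_nmul 6 (mem_mul mR mR)) mR)
  refine ⟨_, _, ?_, mem_neg1 ?_ mg2, H⟩
  · refine mem_neg1 ?_ (mem_add (mem_add (mem_sdiv (k := 100) (by norm_num) (mem_nmul 101 (mem_mul mC mR)))
      (mem_mul (mem_add (mem_sdiv (k := 100) (by norm_num) (mem_nmul 202 (mem_add mX ma))) (mem_mul mX mb))
        (mem_add (mem_add mR (mem_mul mR mR)) (mem_sdiv (k := 2) (by norm_num) (mem_add mem_one mR)))))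
      (mem_mul (mem_mul mX (mem_add (mem_mul mX mX) (mem_mul ma ma))) mg2))
    unfold Mc
    rw [hh]
    push_cast
    ring
  · push_cast; ring

/-- one cell of the homogeneous part -/
noncomputable def j1K (N H0 H1 : Nat) (r : Row) (P Q : CB) (k : CB → CB → Bool) : Bool :=
  bndK N H0 r fun Xn Rn Cn =>
  mcK H1 Xn Rn Cn fun M g2 =>
  fC r.Y fun Y => fC r.V fun V =>
  fC (add r.X (mulI (sdiv (nmul H0 V) 100))) fun W =>
  shchK W fun s c =>
  invK s fun iv =>
  mulK iv iv fun iv2 =>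
  mulK c iv2 fun g =>
  mulK iv iv2 fun iv3 =>
  mulK Y g fun yg =>
  mulK Y V fun yv =>
  mulK yv (add iv (nmul 2 iv3)) fun q =>
  mulK V V fun vv =>
  mulK vv g2 fun vg =>
  mulK ⟨nrm Y, 0, 0, 0, 0⟩ vg fun yvg =>
  fC (add P (add (sdiv (nmul 2 (neg (imP yg))) N) (sdiv M (Nat.mul 12 (Nat.mul N (Nat.mul N N)))))) fun P =>
  fC (add Q (add (sdiv (nmul 2 (reP q)) N) (sdiv (nmul (Nat.sub H1 H0) yvg) (Nat.mul 100 N)))) fun Q =>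
  k P Q

theorem j1K_sound {N H0 H1 : ℕ} (hN : 0 < N) (hH0 : 0 < H0) (hH : H0 ≤ H1) (hH1 : H1 ≤ 125)
    {r : Row} {P Q : CB} {k : CB → CB → Bool} {m : ℝ} (hr : rowOK m r)
    (hm0 : 0 < m - 1 / (2 * N)) (hm1 : m + 1 / (2 * N) ≤ 3.15)
    (H : j1K N H0 H1 r P Q k = true) {p q : ℝ} (hp : mem (p : ℂ) P) (hq : mem (q : ℂ) Q) :
    ∃ p' q' : ℝ, ∃ P' Q' : CB, mem (p' : ℂ) P' ∧ mem (q' : ℂ) Q' ∧ k P' Q' = true ∧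
      ∀ h ∈ Set.Icc ((H0 : ℝ) / 100) ((H1 : ℝ) / 100),
        ∫ t in (m - 1 / (2 * N))..(m + 1 / (2 * N)), f1 h t ≤ (p' - p) + (h - (H0 : ℝ) / 100) * (q' - q) := by
  have hN' : (0:ℝ) < N := Nat.cast_pos.2 hN
  unfold j1K at H
  obtain ⟨Xn, Rn, Cn, xl, xu, sl, b1, b2, b3, b4, b5, b6, b7, b8, H⟩ := bndK_sound hN hr H
  obtain ⟨hx, hy, hv⟩ := hr
  set X := (Xn : ℝ) / 18446744073709551616 with hX
  set R := (Rn : ℝ) / 18446744073709551616 with hR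
  set C := (Cn : ℝ) / 18446744073709551616 with hC
  have hR0 : 0 ≤ R := div_nonneg (Nat.cast_nonneg _) (by norm_num)
  have hC0 : 0 ≤ C := div_nonneg (Nat.cast_nonneg _) (by norm_num)
  obtain ⟨M, g2, hM, hg2, H⟩ := mcK_sound H hX hR hC (h1 := (H1 : ℝ) / 100) rfl
  rw [fC_eq, fC_eq, fC_eq] at H
  have hW : mem (wf ((H0 : ℝ) / 100) m) (add r.X (mulI (sdiv (nmul H0 r.V) 100))) := by
    refine mem_neg1 ?_ (mem_add hx (mem_mulI (mem_sdiv (k := 100) (by norm_num) (mem_nmul H0 hv))))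
    unfold wf; push_cast; ring
  obtain ⟨s, c, hs, hc, H⟩ := shchK_sound H hW
  obtain ⟨iv, hiv, _, H⟩ := invK_sound H hs
  simp only [fC_eq, mulK_eq] at H
  set w0 := wf ((H0 : ℝ) / 100) m
  have hiv2 := mem_mul hiv hiv
  have hg : mem (gg w0) (mul c (mul iv iv)) := mem_mul hc hiv2
  have hyg := mem_mul hy hg
  have hq1 : mem ((x1 m : ℂ) * v0 m * gg1 w0) (neg (mul (mul r.Y r.V) (add iv (nmul 2 (mul iv (mul iv iv)))))) := by
    refine mem_neg1 ?_ (mem_neg (mem_mul (mem_mul hy hv) (mem_add hiv (mem_nmul 2 (mem_mul hiv hiv2)))))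
    unfold gg1; push_cast; ring
  have hq2 := mem_reP (mem_mul (mem_mul hy hv) (mem_add hiv (mem_nmul 2 (mem_mul hiv hiv2))))
  have hyu := norm_le_nrm hy
  rw [Complex.norm_real, Real.norm_eq_abs] at hyu
  set Yu : ℝ := (nrm r.Y : ℝ) / 18446744073709551616 with hYu
  have hYu1 : |x1 m| ≤ Yu := by rw [hYu, le_div_iff₀ (by norm_num)]; exact hyu
  have hyvg := mem_mul (mem_exact (nrm r.Y)) (mem_mul (mem_mul hv hv) hg2)
  set g2r := C * (6 * R * R + R) with hg2r
  set Mr := Mc ((H1 : ℝ) / 100) X (C * R) (R + R * R + (1 + R) / 2) g2r with hMr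
  have e12 : 0 < Nat.mul 12 (Nat.mul N (Nat.mul N N)) := by
    have : 0 < 12 * (N * (N * N)) := by positivity
    exact this
  have e100 : 0 < Nat.mul 100 N := Nat.mul_pos (by norm_num) hN
  refine ⟨p + ((1 / N : ℝ) * (-2 * (x1 m * gg w0 : ℂ).im) + Mr / (12 * N ^ 3)),
    q + ((1 / N : ℝ) * (-2 * (x1 m * v0 m * gg1 w0 : ℂ).re)
        + ((H1 : ℝ) - H0) * (Yu * (v0 m * v0 m * g2r)) / (100 * N)), _, _, ?_, ?_, H, ?_⟩
  · refine mem_neg1 ?_ (mem_add hp (mem_add (mem_sdiv hN (mem_nmul 2 (mem_neg (mem_imP hyg)))) (mem_sdiv e12 hM)))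
    have e : ((Nat.mul 12 (Nat.mul N (Nat.mul N N)) : ℕ) : ℂ) = 12 * N ^ 3 := by
      push_cast [Nat.mul_eq]; ring
    rw [e]
    push_cast
    ring
  · have e : ((Nat.mul 100 N : ℕ) : ℂ) = 100 * N := by push_cast [Nat.mul_eq]; ring
    have e2 : ((Nat.sub H1 H0 : ℕ) : ℂ) = H1 - H0 := by
      rw [Nat.sub_eq, Nat.cast_sub hH]
    have e3 : ((x1 m : ℂ) * v0 m * gg1 w0).re
      = - ((x1 m : ℂ) * v0 m * ((Complex.sinh w0)⁻¹ + (2 : ℕ) * ((Complex.sinh w0)⁻¹ * ((Complex.sinh w0)⁻¹ * (Complex.sinh w0)⁻¹)))).re := by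
      rw [← Complex.neg_re]
      congr 1
      unfold gg1; push_cast; ring
    refine mem_neg1 ?_ (mem_add hq (mem_add (mem_sdiv hN (mem_nmul 2 hq2)) (mem_sdiv e100 (mem_nmul (Nat.sub H1 H0) hyvg))))
    rw [e, e2, e3]
    simp only [hYu]
    push_cast
    ring
  · intro h hh
    have hj := j1_cell (h := h) (h0 := (H0 : ℝ) / 100) (h1 := (H1 : ℝ) / 100) (m := m) (r := 1 / (2 * N))
      (X := X) (xl := xl) (xu := xu) (sl := sl) (R := R) (Ch := C) (by positivity) hm0 hm1
      (by have : (0:ℝ) < H0 := Nat.cast_pos.2 hH0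
          positivity) hh.1 hh.2
      (by have : (H1 : ℝ) ≤ 125 := by exact_mod_cast hH1
          linarith) b1 b2 b3 b4 b5 b6 hR0 b7 b8
    rw [← hg2r, ← hMr] at hj
    refine hj.trans ?_
    have er : 2 * (1 / (2 * (N : ℝ))) = 1 / N := by field_simp
    rw [er]
    have hg20 : 0 ≤ g2r := by positivity
    have hHH : (0:ℝ) ≤ (H1 : ℝ) / 100 - H0 / 100 := by
      have : (H0 : ℝ) ≤ H1 := by exact_mod_cast hH
      linarith
    have h5 : |x1 m| * (v0 m ^ 2 * g2r) * ((H1 : ℝ) / 100 - H0 / 100)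
        ≤ Yu * (v0 m ^ 2 * g2r) * ((H1 : ℝ) / 100 - H0 / 100) := by gcongr
    have h6 : (0:ℝ) ≤ (h - H0 / 100) * (1 / N) := mul_nonneg (by linarith [hh.1]) (by positivity)
    have h7 := mul_le_mul_of_nonneg_left h5 h6
    have e1 : 2 * (Mr * (1 / (N : ℝ)) ^ 3 / 24) = Mr / (12 * N ^ 3) := by field_simp; ring
    have e2 : ((H1 : ℝ) - H0) * (Yu * (v0 m * v0 m * g2r)) / (100 * N)
      = 1 / N * (Yu * (v0 m ^ 2 * g2r) * ((H1 : ℝ) / 100 - H0 / 100)) := by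
      field_simp
    rw [e1, e2]
    linarith

theorem f1_cont {h β : ℝ} (hβ : 0 < β) : ContinuousAt (f1 h) β := by
  have h1 : ContinuousAt (fun t => (gg (wf h t)).im) β := by
    have := ((hasDerivAt_gg (sinh_ne (by rw [wf_re]; exact z1_pos hβ))).scomp β (hasDerivAt_wf h β)).continuousAt
    exact Complex.continuous_im.continuousAt.comp this
  exact (((hasDerivAt_x1 β).continuousAt).mul h1).const_mul (-2)

theorem f1_ii {h a b : ℝ} (ha : 0 < a) (hb : 0 < b) : IntervalIntegrable (f1 h) volume a b := by
  apply ContinuousOn.intervalIntegrable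
  intro t ht
  have : 0 < t := lt_of_lt_of_le (lt_min ha hb) ht.1
  exact (f1_cont this).continuousWithinAt

/-- loop over a table -/
noncomputable def j1L (N H0 H1 : Nat) (L : List Row) (k : CB → CB → Bool) : CB → CB → Bool :=
  List.rec (fun P Q => k P Q) (fun r _ ih P Q => j1K N H0 H1 r P Q ih) L

theorem j1L_sound {N H0 H1 : ℕ} (hN : 0 < N) (hH0 : 0 < H0) (hH : H0 ≤ H1) (hH1 : H1 ≤ 125)
    {k : CB → CB → Bool} (L : List Row) : ∀ (s : ℕ) (P Q : CB) (p q : ℝ), 0 < s → 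
    ((s + L.length : ℕ) : ℝ) / N ≤ 3.15 → tabOK N s L →
    j1L N H0 H1 L k P Q = true → mem (p : ℂ) P → mem (q : ℂ) Q →
    ∃ p' q' : ℝ, ∃ P' Q' : CB, mem (p' : ℂ) P' ∧ mem (q' : ℂ) Q' ∧ k P' Q' = true ∧
      ∀ h ∈ Set.Icc ((H0 : ℝ) / 100) ((H1 : ℝ) / 100),
        ∫ t in ((s : ℝ) / N)..(((s + L.length : ℕ) : ℝ) / N), f1 h t
          ≤ (p' - p) + (h - (H0 : ℝ) / 100) * (q' - q) := by
  have hN' : (0:ℝ) < N := Nat.cast_pos.2 hN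
  induction L with
  | nil =>
    intro s P Q p q _ _ _ H hp hq
    refine ⟨p, q, P, Q, hp, hq, H, ?_⟩
    intro h _
    simp
  | cons r L ih =>
    intro s P Q p q hs hle hT H hp hq
    have hs' : (0:ℝ) < s := Nat.cast_pos.2 hs
    obtain ⟨hr, hT⟩ := hT
    have H' : j1K N H0 H1 r P Q (j1L N H0 H1 L k) = true := H
    have e1 : (((2 * s + 1 : ℕ) : ℝ) / ((2 * N : ℕ) : ℝ)) - 1 / (2 * N) = s / N := by
      push_cast; field_simp; ring
    have e2 : (((2 * s + 1 : ℕ) : ℝ) / ((2 * N : ℕ) : ℝ)) + 1 / (2 * N) = ((s + 1 : ℕ) : ℝ) / N := by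
      push_cast; field_simp; ring
    have e3 : ((s + (r :: L).length : ℕ) : ℝ) = ((s + 1 + L.length : ℕ) : ℝ) := by
      push_cast [List.length_cons]; ring
    rw [e3] at hle
    have hle1 : ((s + 1 : ℕ) : ℝ) / N ≤ ((s + 1 + L.length : ℕ) : ℝ) / N := by
      exact div_le_div_of_nonneg_right (Nat.cast_le.2 (by omega)) hN'.le
    obtain ⟨p', q', P', Q', hp', hq', H2, hb⟩ := j1K_sound hN hH0 hH hH1 hr (by rw [e1]; positivity)
      (by rw [e2]; exact hle1.trans hle) H' hp hq
    obtain ⟨p2, q2, P2, Q2, hp2, hq2, H3, hb2⟩ := ih (s + 1) P' Q' p' q' (by omega) hle hT H2 hp' hq'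
    refine ⟨p2, q2, P2, Q2, hp2, hq2, H3, ?_⟩
    intro h hh
    have a1 := hb h hh
    have a2 := hb2 h hh
    rw [e1, e2] at a1
    rw [e3]
    have hpos : (0:ℝ) < ((s + 1 : ℕ) : ℝ) / N := by positivity
    rw [← intervalIntegral.integral_add_adjacent_intervals (f1_ii (h := h) (div_pos hs' hN') hpos)
      (f1_ii (h := h) hpos (hpos.trans_le hle1))]
    linarith

def finK (H0 H1 c : Nat) (P Q : CB) : Bool :=
  Bool.and (Nat.ble (Nat.add (Nat.add P.a P.e) c) P.b)
    ((fun R : CB => Nat.ble (Nat.add (Nat.add R.a R.e) c) R.b) (add P (sdiv (nmul (Nat.sub H1 H0) Q) 100)))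

theorem re_low {x : ℝ} {P : CB} {c : ℕ} (hx : mem (x : ℂ) P)
    (h : Nat.ble (Nat.add (Nat.add P.a P.e) c) P.b = true) : x ≤ - ((c : ℝ) / 18446744073709551616) := by
  have h1 := re_le_up hx
  rw [Complex.ofReal_re] at h1
  have h2 : ((P.a + P.e + c : ℕ) : ℝ) ≤ P.b := by exact_mod_cast Nat.le_of_ble_eq_true h
  push_cast at h2
  rw [← neg_div, le_div_iff₀ (by norm_num)]
  linarith

noncomputable def j1All (H0 H1 c : Nat) : Bool :=
  j1L 160 H0 H1 tabA (j1L 320 H0 H1 tabB (j1L 80 H0 H1 tabC (j1L 40 H0 H1 tabD (finK H0 H1 c))))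
    ⟨0, 0, 0, 0, 0⟩ ⟨0, 0, 0, 0, 0⟩

theorem mem_zero : mem ((0 : ℝ) : ℂ) ⟨0, 0, 0, 0, 0⟩ := by
  have := mem_ofN 0
  simpa [ofN] using this

theorem tabA_len : tabA.length = 80 := by decide +kernel
theorem tabB_len : tabB.length = 160 := by decide +kernel
theorem tabC_len : tabC.length = 40 := by decide +kernel
theorem tabD_len : tabD.length = 56 := by decide +kernel

theorem j1All_sound {H0 H1 c : ℕ} (hH0 : 0 < H0) (hH : H0 ≤ H1) (hH1 : H1 ≤ 125)
    (H : j1All H0 H1 c = true) {h : ℝ} (hh : h ∈ Set.Icc ((H0 : ℝ) / 100) ((H1 : ℝ) / 100)) :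
    ∫ t in (0.25:ℝ)..3.15, f1 h t ≤ - ((c : ℝ) / 18446744073709551616) := by
  unfold j1All at H
  obtain ⟨p1, q1, P1, Q1, hp1, hq1, H, b1⟩ := j1L_sound (by norm_num) hH0 hH hH1 tabA 40 _ _ 0 0 (by norm_num)
    (by rw [tabA_len]; norm_num) tabA_ok H mem_zero mem_zero
  obtain ⟨p2, q2, P2, Q2, hp2, hq2, H, b2⟩ := j1L_sound (by norm_num) hH0 hH hH1 tabB 240 _ _ _ _ (by norm_num)
    (by rw [tabB_len]; norm_num) tabB_ok H hp1 hq1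
  obtain ⟨p3, q3, P3, Q3, hp3, hq3, H, b3⟩ := j1L_sound (by norm_num) hH0 hH hH1 tabC 100 _ _ _ _ (by norm_num)
    (by rw [tabC_len]; norm_num) tabC_ok H hp2 hq2
  obtain ⟨p4, q4, P4, Q4, hp4, hq4, H, b4⟩ := j1L_sound (by norm_num) hH0 hH hH1 tabD 70 _ _ _ _ (by norm_num)
    (by rw [tabD_len]; norm_num) tabD_ok H hp3 hq3
  unfold finK at H
  rw [Bool.and_eq_true] at H
  have c1 := re_low hp4 H.1
  have c2 := re_low (x := p4 + ((H1 : ℝ) - H0) * q4 / 100) (mem_neg1 (by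
    have e2 : ((Nat.sub H1 H0 : ℕ) : ℂ) = H1 - H0 := by
      rw [Nat.sub_eq, Nat.cast_sub hH]
    rw [e2]; push_cast; ring) (mem_add hp4 (mem_sdiv (k := 100) (by norm_num)
      (mem_nmul (Nat.sub H1 H0) hq4)))) H.2
  have a1 := b1 h hh
  have a2 := b2 h hh
  have a3 := b3 h hh
  have a4 := b4 h hh
  rw [tabA_len] at a1
  rw [tabB_len] at a2
  rw [tabC_len] at a3
  rw [tabD_len] at a4
  norm_num at a1 a2 a3 a4
  have i1 := intervalIntegral.integral_add_adjacent_intervals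
    (f1_ii (h := h) (a := 1/4) (b := 3/4) (by norm_num) (by norm_num)) (f1_ii (b := 5/4) (by norm_num) (by norm_num))
  have i2 := intervalIntegral.integral_add_adjacent_intervals
    (f1_ii (h := h) (a := 1/4) (b := 5/4) (by norm_num) (by norm_num)) (f1_ii (b := 7/4) (by norm_num) (by norm_num))
  have i3 := intervalIntegral.integral_add_adjacent_intervals
    (f1_ii (h := h) (a := 1/4) (b := 7/4) (by norm_num) (by norm_num)) (f1_ii (b := 63/20) (by norm_num) (by norm_num))
  have e : ∫ t in (0.25:ℝ)..3.15, f1 h t = ∫ t in (1/4:ℝ)..(63/20), f1 h t := by norm_num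
  rw [e, ← i3, ← i2, ← i1]
  have tot : (∫ t in (1/4:ℝ)..(3/4), f1 h t) + (∫ t in (3/4:ℝ)..(5/4), f1 h t)
    + (∫ t in (5/4:ℝ)..(7/4), f1 h t) + (∫ t in (7/4:ℝ)..(63/20), f1 h t) ≤ p4 + (h - H0 / 100) * q4 := by
    linarith
  refine tot.trans ?_
  set d := (c : ℝ) / 18446744073709551616
  rcases le_total 0 q4 with hq | hq
  · have : (h - H0 / 100) * q4 ≤ ((H1 : ℝ) / 100 - H0 / 100) * q4 := by
      gcongr; exact hh.2
    linarith
  · have : (h - H0 / 100) * q4 ≤ 0 := mul_nonpos_of_nonneg_of_nonpos (by linarith [hh.1]) hq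
    linarith

set_option maxRecDepth 100000 in
theorem j1c1 : j1All 77 80 9278712269075904462 = true := by decide +kernel
set_option maxRecDepth 100000 in
theorem j1c2 : j1All 80 90 12377765273459109134 = true := by decide +kernel
set_option maxRecDepth 100000 in
theorem j1c3 : j1All 90 105 15034096420073284567 = true := by decide +kernel
set_option maxRecDepth 100000 in
theorem j1c4 : j1All 105 115 22947749627694682210 = true := by decide +kernel
set_option maxRecDepth 100000 in
theorem j1c5 : j1All 115 125 22947749627694682210 = true := by decide +kernel

noncomputable def fF (h β : ℝ) : ℝ :=
  deriv z₁ β * Real.sinh (z₁ β) * Real.sin (z₂ h β) /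
          (Real.cosh (z₁ β) - Real.cos (z₂ h β)) ^ 2 +
        deriv z₁ β * Real.sinh (z₁ β) * Real.sin (z₂ h β) /
          (Real.cosh (z₁ β) + Real.cos (z₂ h β)) ^ 2

theorem fF_eq {h β : ℝ} (h0 : 0 < β) (h1 : β ≤ π) : fF h β = f1 h β := by
  unfold fF
  rw [z2_eq (by rw [abs_of_pos h0]; exact h1), deriv_z1, f1_eq h0]

theorem fF_zero {h β : ℝ} (h1 : π < β) : fF h β = 0 := by
  unfold fF
  rw [z2_eq_zero (by rw [abs_of_pos (Real.pi_pos.trans h1)]; exact h1)]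
  simp

theorem v0_low {β : ℝ} (h0 : 0 ≤ β) (h1 : β ≤ 0.25) : 0.835 * β ≤ v0 β := by
  have hs3 : 3 * β - (3 * β) ^ 3 / 6 ≤ Real.sin (3 * β) := Real.sin_ge_sub_cube (by linarith)
  have hs : Real.sin β ≤ β := Real.sin_le h0
  have hs0 : 0 ≤ Real.sin β := Real.sin_nonneg_of_nonneg_of_le_pi h0 (by linarith [Real.pi_gt_three])
  have hp : pp β ≤ 0.0184 := by
    refine le_trans ?_ exp_neg_four
    unfold pp
    apply Real.exp_le_exp.2; nlinarith
  have e3 : Real.exp (-3) ≤ 0.05 := by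
    rw [Real.exp_neg]
    have h1 := Real.exp_one_gt_d9
    have : Real.exp 3 = Real.exp 1 ^ 3 := by rw [← Real.exp_nat_mul]; norm_num
    rw [this, inv_le_comm₀ (by positivity) (by norm_num)]
    have : (2.718 : ℝ) ^ 3 ≤ Real.exp 1 ^ 3 := by gcongr; linarith
    norm_num at this ⊢; linarith
  have hq : qq β ≤ 0.05 := by
    refine le_trans ?_ e3
    unfold qq
    apply Real.exp_le_exp.2; nlinarith
  have hp0 : 0 < pp β := Real.exp_pos _
  have hq0 : 0 < qq β := Real.exp_pos _
  have hpi : 0.9549 ≤ 3 / π := by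
    rw [le_div_iff₀ Real.pi_pos]; nlinarith [Real.pi_lt_d6]
  have e : v0 β = 3 / π * (Real.sin (3 * β) / 3 - Real.sin β / 2.5 * (pp β + qq β)) := by
    unfold v0; ring
  rw [e]
  have a1 : Real.sin β * (pp β + qq β) ≤ β * 0.0684 := by gcongr; linarith
  have a2 : β ^ 3 ≤ β * 0.0625 := by nlinarith [mul_nonneg h0 h0]
  have a3 : 0.878 * β ≤ Real.sin (3 * β) / 3 - Real.sin β / 2.5 * (pp β + qq β) := by
    have : (3 * β) ^ 3 = 27 * β ^ 3 := by ring
    rw [this] at hs3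
    norm_num at *
    linarith
  calc 0.835 * β ≤ 0.9549 * (0.878 * β) := by linarith
    _ ≤ _ := by gcongr

theorem f1_form {h β : ℝ} (hβ : 0 < β) : f1 h β = 2 * (x1 β * Real.sinh (z₁ β) * Real.sin (h * v0 β)
    * (Real.cosh (z₁ β) ^ 2 + Real.cos (h * v0 β) ^ 2)) /
      (Real.sinh (z₁ β) ^ 2 + Real.sin (h * v0 β) ^ 2) ^ 2 := by
  rw [← f1_eq hβ]
  have hx := z1_pos hβ
  have hC : 1 < Real.cosh (z₁ β) := Real.one_lt_cosh.2 hx.ne'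
  have h1 := Real.cosh_sq (z₁ β)
  have h2 := Real.sin_sq_add_cos_sq (h * v0 β)
  have d1 : 0 < Real.cosh (z₁ β) - Real.cos (h * v0 β) := by linarith [Real.cos_le_one (h * v0 β)]
  have d2 : 0 < Real.cosh (z₁ β) + Real.cos (h * v0 β) := by linarith [Real.neg_one_le_cos (h * v0 β)]
  have e : Real.sinh (z₁ β) ^ 2 + Real.sin (h * v0 β) ^ 2
    = (Real.cosh (z₁ β) - Real.cos (h * v0 β)) * (Real.cosh (z₁ β) + Real.cos (h * v0 β)) := by
    linear_combination h2 - h1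
  rw [e]
  field_simp
  ring

theorem sinh_le_mul_cosh {x : ℝ} (hx : 0 ≤ x) : Real.sinh x ≤ x * Real.cosh x := by
  have hd : ∀ t : ℝ, HasDerivAt (fun t => t * Real.cosh t - Real.sinh t) (t * Real.sinh t) t := by
    intro t
    have := ((hasDerivAt_id t).mul (Real.hasDerivAt_cosh t)).sub (Real.hasDerivAt_sinh t)
    refine HasDerivAt.congr_deriv (f := fun t => t * Real.cosh t - Real.sinh t) this ?_
    simp only [id]; ring
  have hm : MonotoneOn (fun t => t * Real.cosh t - Real.sinh t) (Set.Ici 0) := by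
    apply monotoneOn_of_deriv_nonneg (convex_Ici 0)
    · exact fun t _ => (hd t).continuousAt.continuousWithinAt
    · exact fun t _ => (hd t).differentiableAt.differentiableWithinAt
    · intro t ht
      rw [interior_Ici] at ht
      rw [(hd t).deriv]
      exact mul_nonneg (le_of_lt ht) (Real.sinh_nonneg_iff.2 (le_of_lt ht))
  have := hm (Set.mem_Ici.2 le_rfl) (Set.mem_Ici.2 hx) hx
  simp at this
  linarith

theorem f1_head {h β : ℝ} (hh : 0.77 ≤ h) (hh1 : h ≤ 1.25) (h0 : 0 < β) (h1 : β ≤ 0.25) :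
    0 ≤ f1 h β ∧ f1 h β ≤ 1.32 * β ^ 2 := by
  have hx := z1_pos h0
  have hv := v0_low h0.le h1
  have hva := (abs_le.1 (v0_abs h0.le)).2
  have hpi := Real.pi_gt_three
  have hsl : Real.sin β ≤ β := Real.sin_le h0.le
  have hsg : β - β ^ 3 / 6 ≤ Real.sin β := Real.sin_ge_sub_cube h0.le
  have hs0 : 0 < Real.sin β := Real.sin_pos_of_pos_of_lt_pi h0 (by linarith)
  have hE : 1 - β ^ 2 / 10000 ≤ Ee β := by
    have := Real.add_one_le_exp (-(1 / 10000) * β ^ 2)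
    unfold Ee; linarith
  have hE1 := Ee_le β
  have b2 : β ^ 2 ≤ 0.0625 := by nlinarith
  have hz : z₁ β ≤ 0.1668 * β ^ 3 := by
    have e : z₁ β = β - Real.sin β * Ee β := rfl
    have : (β - β ^ 3 / 6) * (1 - β ^ 2 / 10000) ≤ Real.sin β * Ee β := by
      gcongr
      nlinarith
    rw [e]
    nlinarith [pow_pos h0 3, pow_pos h0 5]
  have hx1 : x1 β ≤ 0.501 * β ^ 2 := by
    have e : x1 β = 1 - (Real.cos β - β / 5000 * Real.sin β) * Ee β := rfl
    have hc := Real.one_sub_sq_div_two_le_cos (x := β)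
    have : (1 - β ^ 2 / 2 - β ^ 2 / 5000) * (1 - β ^ 2 / 10000) ≤ (Real.cos β - β / 5000 * Real.sin β) * Ee β := by
      have h3 : 1 - β ^ 2 / 2 - β ^ 2 / 5000 ≤ Real.cos β - β / 5000 * Real.sin β := by nlinarith
      have h4 : 0 ≤ 1 - β ^ 2 / 2 - β ^ 2 / 5000 := by linarith
      have h5 : 0 ≤ 1 - β ^ 2 / 10000 := by linarith
      calc _ ≤ (1 - β ^ 2 / 2 - β ^ 2 / 5000) * Ee β := by gcongr
        _ ≤ _ := by
          have := (Ee_pos β).le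
          gcongr
    rw [e]; nlinarith
  have hx0 := x1_nonneg h0.le (by linarith)
  have z_small : z₁ β ≤ 0.01 := by nlinarith
  have hS0 : 0 < Real.sinh (z₁ β) := Real.sinh_pos_iff.2 hx
  have hCu : Real.cosh (z₁ β) ≤ 1.0001 := by
    refine (Real.cosh_le_exp_half_sq _).trans ?_
    have h3 : z₁ β ^ 2 / 2 ≤ 0.00005 := by nlinarith
    have h4 := Real.exp_bound_div_one_sub_of_interval (x := 0.00005) (by norm_num) (by norm_num)
    refine (Real.exp_le_exp.2 h3).trans (h4.trans ?_)
    norm_num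
  have hC1 : 1 ≤ Real.cosh (z₁ β) := Real.one_le_cosh _
  have hS : Real.sinh (z₁ β) ≤ 0.169 * β ^ 3 := by
    have : Real.sinh (z₁ β) ≤ z₁ β * Real.cosh (z₁ β) := by
      exact sinh_le_mul_cosh hx.le
    nlinarith [pow_pos h0 3]
  have hsv : 0.64 * β ≤ Real.sin (h * v0 β) := by
    have h2 : 0.6429 * β ≤ h * v0 β := by
      calc 0.6429 * β ≤ 0.77 * (0.835 * β) := by linarith
        _ ≤ _ := by gcongr
    have h3 : h * v0 β ≤ π / 2 := by
      have hv0 : 0 ≤ v0 β := le_trans (by linarith) hv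
      have : h * v0 β ≤ 1.25 * 0.71 := by
        gcongr
      linarith
    have h4 := Real.sin_le_sin_of_le_of_le_pi_div_two (by linarith) h3 h2
    have h5 : 0.6429 * β - (0.6429 * β) ^ 3 / 6 ≤ Real.sin (0.6429 * β) := Real.sin_ge_sub_cube (by linarith)
    have h6 : (0.6429 * β) ^ 3 ≤ 0.017 * β := by
      have : (0.6429 * β) ^ 3 = 0.6429 ^ 3 * (β * β ^ 2) := by ring
      rw [this]
      have : β * β ^ 2 ≤ β * 0.0625 := by gcongr
      norm_num at *
      linarith
    linarith
  have hsv0 : 0 < Real.sin (h * v0 β) := by nlinarith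
  rw [f1_form h0]
  set S := Real.sinh (z₁ β)
  set C := Real.cosh (z₁ β)
  set s := Real.sin (h * v0 β)
  set c := Real.cos (h * v0 β) with hc
  have hcc : c ^ 2 ≤ 1 := by rw [hc]; exact Real.cos_sq_le_one _
  refine ⟨by positivity, ?_⟩
  rw [div_le_iff₀ (by positivity)]
  have hCC : C ^ 2 + c ^ 2 ≤ 2.001 := by nlinarith
  have d1 : 2 * (x1 β * S * s * (C ^ 2 + c ^ 2)) ≤ 2 * ((0.501 * β ^ 2) * (0.169 * β ^ 3) * s * 2.001) := by
    gcongr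
  have d2 : s ^ 4 ≤ (S ^ 2 + s ^ 2) ^ 2 := by nlinarith [sq_nonneg S, sq_nonneg s, sq_nonneg (S * s)]
  have d3 : (0.64 * β) ^ 3 ≤ s ^ 3 := by gcongr
  have d4 : β ^ 2 * ((0.64 * β) ^ 3 * s) ≤ β ^ 2 * (s ^ 3 * s) := by gcongr
  have d5 : β ^ 2 * s ^ 4 ≤ β ^ 2 * (S ^ 2 + s ^ 2) ^ 2 := by gcongr
  have d6 : 0 ≤ β ^ 5 * s := by positivity
  have e1 : 2 * ((0.501 * β ^ 2) * (0.169 * β ^ 3) * s * 2.001) = (2 * 0.501 * 0.169 * 2.001) * (β ^ 5 * s) := by ring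
  have e2 : β ^ 2 * ((0.64 * β) ^ 3 * s) = 0.64 ^ 3 * (β ^ 5 * s) := by ring
  have e3 : s ^ 3 * s = s ^ 4 := by ring
  rw [e1] at d1
  rw [e2, e3] at d4
  norm_num at *
  linarith

theorem f1_over {h β : ℝ} (hh : 0.77 ≤ h) (hh1 : h ≤ 1.25) (h0 : π ≤ β) (h1 : β ≤ 3.15) :
    ‖f1 h β‖ ≤ 0.4824 := by
  have p1 := Real.pi_gt_d6
  have hβ : 0 < β := by linarith
  have hsin : Real.sin β ≤ 0 ∧ -0.01 ≤ Real.sin β := by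
    have e : Real.sin β = - Real.sin (β - π) := by rw [Real.sin_sub_pi, neg_neg]
    have : Real.sin (β - π) ≤ β - π := Real.sin_le (by linarith)
    have : 0 ≤ Real.sin (β - π) := Real.sin_nonneg_of_nonneg_of_le_pi (by linarith) (by linarith)
    norm_num at *
    constructor <;> linarith
  have hE := Ee_le β
  have hE0 := Ee_pos β
  have e : z₁ β = β - Real.sin β * Ee β := rfl
  have z1 : 3 ≤ z₁ β := by rw [e]; nlinarith
  have z2 : z₁ β ≤ 3.16 := by rw [e]; nlinarith
  have ex : Real.exp 3 = Real.exp 1 ^ 3 := by rw [← Real.exp_nat_mul]; norm_num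
  have he1 := Real.exp_one_gt_d9
  have he2 := Real.exp_one_lt_d9
  have l3 : (2.7182 : ℝ) ^ 3 ≤ Real.exp 1 ^ 3 := by gcongr; linarith
  have u3 : Real.exp 1 ^ 3 ≤ (2.7183 : ℝ) ^ 3 := by gcongr; linarith
  have hS : 10 ≤ Real.sinh 3 := by
    rw [Real.sinh_eq, Real.exp_neg]
    have : (Real.exp 3)⁻¹ ≤ 0.05 := by
      rw [inv_le_comm₀ (Real.exp_pos _) (by norm_num), ex]
      norm_num at *; linarith
    rw [ex] at *
    norm_num at *; linarith
  have hC : Real.cosh 3.16 ≤ 12 := by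
    rw [Real.cosh_eq]
    have : Real.exp (-3.16) ≤ 0.05 := by
      refine (Real.exp_le_exp.2 (show (-3.16 : ℝ) ≤ -3 by norm_num)).trans ?_
      rw [Real.exp_neg, inv_le_comm₀ (Real.exp_pos _) (by norm_num), ex]
      norm_num at *; linarith
    have h2 : Real.exp 3.16 ≤ 23.92 := by
      have : Real.exp 3.16 = Real.exp 3 * Real.exp 0.16 := by rw [← Real.exp_add]; norm_num
      rw [this, ex]
      have h4 := Real.exp_bound_div_one_sub_of_interval (x := 0.16) (by norm_num) (by norm_num)
      have h5 : Real.exp 0.16 ≤ 1.1906 := h4.trans (by norm_num)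
      calc Real.exp 1 ^ 3 * Real.exp 0.16 ≤ (2.7183 : ℝ) ^ 3 * 1.1906 := by gcongr
        _ ≤ _ := by norm_num
    linarith
  have hv := v0_abs hβ.le
  obtain ⟨hg, -, -⟩ := gg_bounds (w := wf h β) (xl := 3) (xu := 3.16) (sl := 0) (R := 0.01) (Ch := 12)
    (by rw [wf_re]; linarith) (by norm_num) (by rw [wf_re]; exact z1) (by rw [wf_re]; exact z2) le_rfl (abs_nonneg _)
    (by
      rw [wf_im, abs_mul, abs_of_pos (by linarith : 0 < h)]
      have : h * |v0 β| ≤ 1.25 * 0.71 := by gcongr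
      linarith) (by norm_num)
    (by
      rw [norm_sinh_sq]
      simp
      norm_num
      nlinarith)
    (by
      have : Complex.cosh (((3.16 : ℝ) : ℂ) + ((0 : ℝ) : ℂ) * Complex.I) = ((Real.cosh 3.16 : ℝ) : ℂ) := by
        simp
      rw [this, Complex.norm_real, Real.norm_eq_abs, abs_of_pos (Real.cosh_pos _)]
      exact hC)
  unfold f1
  rw [Real.norm_eq_abs, abs_mul, abs_mul]
  have h3 := x1_abs hβ.le h1
  have h4 := (Complex.abs_im_le_norm _).trans hg
  have : |(-2 : ℝ)| = 2 := by norm_num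
  rw [this]
  calc 2 * (|x1 β| * |(gg (wf h β)).im|) ≤ 2 * (2.01 * (12 * 0.01)) := by gcongr
    _ ≤ _ := by norm_num

theorem J1_bound {h c : ℝ} (hh : 0.77 ≤ h) (hh1 : h ≤ 1.25) (hf : ∀ β, 0 < β → ContinuousAt (f1 h) β)
    (H : ∫ t in (0.25 : ℝ)..3.15, f1 h t ≤ -c) :
    ∫ β in Set.Ioi (0 : ℝ), fF h β ≤ -c + 0.0112 := by
  have p1 := Real.pi_gt_d6
  have p2 := Real.pi_lt_d6
  have ii : ∀ a b : ℝ, 0 < a → 0 < b → IntervalIntegrable (f1 h) volume a b := by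
    intro a b ha hb
    apply ContinuousOn.intervalIntegrable
    intro x hx
    have : min a b ≤ x := hx.1
    exact (hf x (lt_of_lt_of_le (lt_min ha hb) this)).continuousWithinAt
  have e0 : ∫ β in Set.Ioi (0 : ℝ), fF h β = ∫ β in Set.Ioc (0 : ℝ) π, f1 h β := by
    rw [← integral_indicator measurableSet_Ioi, ← integral_indicator measurableSet_Ioc]
    congr 1
    ext β
    by_cases b0 : 0 < β
    · by_cases b1 : β ≤ π
      · rw [Set.indicator_of_mem (Set.mem_Ioi.2 b0), Set.indicator_of_mem (Set.mem_Ioc.2 ⟨b0, b1⟩), fF_eq b0 b1]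
      · rw [Set.indicator_of_mem (Set.mem_Ioi.2 b0), Set.indicator_of_notMem (fun hc => b1 hc.2), fF_zero (not_le.1 b1)]
    · rw [Set.indicator_of_notMem (show β ∉ Set.Ioi (0:ℝ) from b0), Set.indicator_of_notMem (fun hc => b0 hc.1)]
  have ih : IntegrableOn (f1 h) (Set.Ioc 0 0.25) := by
    refine IntegrableOn.of_bound (C := 1) measure_Ioc_lt_top ?_ ?_
    · apply ContinuousOn.aestronglyMeasurable _ measurableSet_Ioc
      intro x hx
      exact (hf x hx.1).continuousWithinAt
    · apply (ae_restrict_iff' measurableSet_Ioc).2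
      refine Filter.Eventually.of_forall fun x hx => ?_
      obtain ⟨k1, k2⟩ := f1_head hh hh1 hx.1 hx.2
      rw [Real.norm_eq_abs, abs_of_nonneg k1]
      have := hx.1
      have := hx.2
      nlinarith
  have ih' : IntervalIntegrable (f1 h) volume 0 0.25 := by
    rw [intervalIntegrable_iff_integrableOn_Ioc_of_le (by norm_num)]
    exact ih
  have hhead : ∫ t in (0 : ℝ)..0.25, f1 h t ≤ 0.006875 := by
    have k : ∫ t in (0 : ℝ)..0.25, f1 h t ≤ ∫ t in (0 : ℝ)..0.25, 1.32 * t ^ 2 := by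
      apply intervalIntegral.integral_mono_on_of_le_Ioo (by norm_num) ih'
      · exact Continuous.intervalIntegrable (by fun_prop) _ _
      · intro x hx
        exact (f1_head hh hh1 hx.1 hx.2.le).2
    refine k.trans ?_
    rw [intervalIntegral.integral_const_mul, integral_pow]
    norm_num
  have hover : ‖∫ t in π..3.15, f1 h t‖ ≤ 0.4824 * |3.15 - π| := by
    apply intervalIntegral.norm_integral_le_of_norm_le_const
    intro x hx
    rw [Set.uIoc_of_le (by linarith)] at hx
    exact f1_over hh hh1 hx.1.le hx.2
  rw [abs_of_nonneg (by linarith), Real.norm_eq_abs] at hover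
  have hover' := (abs_le.1 hover).1
  have s1 := intervalIntegral.integral_add_adjacent_intervals ih' (ii 0.25 π (by norm_num) (by linarith))
  have s2 := intervalIntegral.integral_add_adjacent_intervals (ii 0.25 π (by norm_num) (by linarith)) (ii π 3.15 (by linarith) (by norm_num))
  rw [e0, ← intervalIntegral.integral_of_le Real.pi_pos.le, ← s1]
  norm_num at *
  linarith

/-! ### Tables of the Fourier type integrals -/

noncomputable def FI (h y s : ℝ) : ℂ := ∫ t in (0:ℝ)..s, (x1 t : ℂ) * Complex.cos ((y : ℂ) * wf h t)

theorem FI_cont (h y : ℝ) : Continuous fun t => (x1 t : ℂ) * Complex.cos ((y : ℂ) * wf h t) := by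
  have h1 : Continuous x1 := continuous_iff_continuousAt.2 fun t => (hasDerivAt_x1 t).continuousAt
  have h2 : Continuous (wf h) := continuous_iff_continuousAt.2 fun t => (hasDerivAt_wf h t).continuousAt
  exact (Complex.continuous_ofReal.comp h1).mul (Complex.continuous_cos.comp (continuous_const.mul h2))

theorem norm_cos_le (z : ℂ) : ‖Complex.cos z‖ ≤ Real.cosh z.im := by
  rw [Complex.cos, norm_div, Real.cosh_eq]
  have : ‖(2:ℂ)‖ = 2 := by simp
  rw [this]
  refine div_le_div_of_nonneg_right ((norm_add_le _ _).trans ?_) (by norm_num)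
  rw [Complex.norm_exp, Complex.norm_exp]
  simp
  linarith

theorem norm_sin_le (z : ℂ) : ‖Complex.sin z‖ ≤ Real.cosh z.im := by
  rw [Complex.sin, norm_div, norm_mul, Real.cosh_eq]
  have : ‖(2:ℂ)‖ = 2 := by simp
  rw [this, Complex.norm_I, mul_one]
  refine div_le_div_of_nonneg_right ((norm_sub_le _ _).trans ?_) (by norm_num)
  rw [Complex.norm_exp, Complex.norm_exp]
  simp

/-- quadrature error of one cell -/
theorem FI_cell {h y m r X E : ℝ} (hr : 0 ≤ r) (hm0 : 0 ≤ m - r) (hm1 : m + r ≤ 3.15) (hh : 0 ≤ h)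
    (hy : 0 ≤ y) (hX : |x1 m| + 1.01 * r ≤ X) (hE : Real.exp (y * (h * (|v0 m| + 1.71 * r))) ≤ E) :
    ‖FI h y (m + r) - FI h y (m - r)
      - (2 * r : ℝ) * ((x1 m : ℂ) * Complex.cos ((y : ℂ) * wf h m))‖
      ≤ Mc h X 1 y (y ^ 2) * ((E + 1) / 2) * (2 * r) ^ 3 / 24 := by
  have e1 : FI h y (m + r) - FI h y (m - r) = ∫ t in (m - r)..(m + r), (x1 t : ℂ) * Complex.cos ((y : ℂ) * wf h t) := by
    unfold FI
    rw [intervalIntegral.integral_interval_sub_left]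
    · exact (FI_cont h y).intervalIntegrable _ _
    · exact (FI_cont h y).intervalIntegrable _ _
  rw [e1]
  have hb : ∀ β ∈ Set.Icc (m - r) (m + r), Real.cosh (((y : ℂ) * wf h β).im) ≤ (E + 1) / 2 := by
    intro β hβ
    have e : ((y : ℂ) * wf h β).im = y * (h * v0 β) := by simp [wf_im]
    rw [e, ← Real.cosh_abs, abs_mul, abs_mul, abs_of_nonneg hy, abs_of_nonneg hh]
    have h1 := v0_cell hm0 hβ
    have h2 : |v0 β| ≤ |v0 m| + 1.71 * r := by
      have := abs_sub_abs_le_abs_sub (v0 β) (v0 m)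
      linarith
    have h3 : y * (h * |v0 β|) ≤ y * (h * (|v0 m| + 1.71 * r)) := by gcongr
    have h4 : (0:ℝ) ≤ y * (h * |v0 β|) := by positivity
    rw [Real.cosh_eq]
    have h5 : Real.exp (-(y * (h * |v0 β|))) ≤ 1 := Real.exp_le_one_iff.2 (by linarith)
    have h6 := Real.exp_le_exp.2 h3
    linarith
  have hd : ∀ z : ℂ, HasDerivAt (fun z => (y : ℂ) * z) (y : ℂ) z := fun z => by
    simpa using (hasDerivAt_id z).const_mul (y : ℂ)
  have := cell_rule (G := fun z => Complex.cos ((y : ℂ) * z)) (G1 := fun z => -(y * Complex.sin ((y : ℂ) * z)))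
    (G2 := fun z => -(y ^ 2 * Complex.cos ((y : ℂ) * z))) (h := h) (h1 := h) (m := m) (r := r) (X := X)
    (g0 := (E + 1) / 2) (g1 := y * ((E + 1) / 2)) (g2 := y ^ 2 * ((E + 1) / 2)) hr hm0 hm1 hh le_rfl
    (fun β hβ => by
      have h1 := x1_cell hm0 hm1 hβ
      have := abs_sub_abs_le_abs_sub (x1 β) (x1 m)
      linarith)
    (fun β _ => by
      refine ((Complex.hasDerivAt_cos _).comp _ (hd _)).congr_deriv ?_
      ring)
    (fun β _ => by
      refine ((((Complex.hasDerivAt_sin _).comp _ (hd _)).const_mul (y : ℂ)).neg).congr_deriv ?_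
      ring)
    (fun β hβ => (norm_cos_le _).trans (hb β hβ))
    (fun β hβ => by
      rw [norm_neg, norm_mul, Complex.norm_real, Real.norm_eq_abs, abs_of_nonneg hy]
      exact mul_le_mul_of_nonneg_left ((norm_sin_le _).trans (hb β hβ)) hy)
    (fun β hβ => by
      rw [norm_neg, norm_mul, norm_pow, Complex.norm_real, Real.norm_eq_abs, abs_of_nonneg hy]
      exact mul_le_mul_of_nonneg_left ((norm_cos_le _).trans (hb β hβ)) (by positivity))
  refine this.trans (le_of_eq ?_)
  unfold Mc
  ring

def accOK (h s : ℝ) : ℕ → List CB → Prop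
  | _, [] => True
  | j, a :: L => mem (FI h ((j : ℝ) / 16) s) a ∧ accOK h s (j + 1) L

def errN (n0 n1 n2 j D : Nat) : Nat :=
  Nat.add (Nat.div (Nat.mul (Nat.add (Nat.mul 256 n0) (Nat.mul j (Nat.add (Nat.mul 16 n1) (Nat.mul n2 j))))
    (Nat.add D 18446744073709551616)) 1813388729421943762059264000) 1

/-- multiplication of balls, where the norm of the second factor is at most `n/2^64` -/
def mulP (x y : CB) (n : Nat) : CB :=
  mul0 (Nat.add (Nat.add (Nat.mul x.a y.a) (Nat.mul x.b y.b)) (Nat.add (Nat.mul x.c y.d) (Nat.mul x.d y.c)))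
    (Nat.add (Nat.add (Nat.mul x.a y.b) (Nat.mul x.b y.a)) (Nat.add (Nat.mul x.c y.c) (Nat.mul x.d y.d)))
    (Nat.add (Nat.add (Nat.mul x.a y.c) (Nat.mul x.b y.d)) (Nat.add (Nat.mul x.c y.a) (Nat.mul x.d y.b)))
    (Nat.add (Nat.add (Nat.mul x.a y.d) (Nat.mul x.b y.c)) (Nat.add (Nat.mul x.c y.b) (Nat.mul x.d y.a)))
    (Nat.add (Nat.mul (nc x) y.e) (Nat.mul n x.e))

noncomputable def mulPK {α : Type} (x y : CB) (n : Nat) (k : CB → α) : α :=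
  CB.rec (fun xa xb xc xd xe => CB.rec (fun ya yb yc yd ye =>
  fN (Nat.add (Nat.add (Nat.mul xa ya) (Nat.mul xb yb)) (Nat.add (Nat.mul xc yd) (Nat.mul xd yc))) fun p =>
  fN (Nat.add (Nat.add (Nat.mul xa yb) (Nat.mul xb ya)) (Nat.add (Nat.mul xc yc) (Nat.mul xd yd))) fun q =>
  fN (Nat.add (Nat.add (Nat.mul xa yc) (Nat.mul xb yd)) (Nat.add (Nat.mul xc ya) (Nat.mul xd yb))) fun r =>
  fN (Nat.add (Nat.add (Nat.mul xa yd) (Nat.mul xb yc)) (Nat.add (Nat.mul xc yb) (Nat.mul xd ya))) fun s =>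
  fC (mul0 p q r s (Nat.add (Nat.mul (Nat.add (Nat.add xa xb) (Nat.add xc xd)) ye) (Nat.mul n xe))) k) y) x

theorem mulPK_eq {α : Type} (x y : CB) (n : Nat) (k : CB → α) : mulPK x y n k = k (mulP x y n) := by
  cases x; cases y
  simp only [mulPK, fN_eq, fC_eq]
  rfl

theorem mem_mulP {x y : ℂ} {a b : CB} {n : ℕ} (hx : mem x a) (hy : mem y b) (hn : ‖y‖ * 18446744073709551616 ≤ n) :
    mem (x * y) (mulP a b n) := by
  have hN := norm_ctr_le a
  rw [mem_iff] at *
  have h7 : ‖a.ctr * b.ctr / 18446744073709551616 - (mulP a b n).ctr‖ ≤ 2 := by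
    have hh := ctr_mul0 (Nat.add (Nat.add (Nat.mul a.a b.a) (Nat.mul a.b b.b))
        (Nat.add (Nat.mul a.c b.d) (Nat.mul a.d b.c)))
      (Nat.add (Nat.add (Nat.mul a.a b.b) (Nat.mul a.b b.a))
        (Nat.add (Nat.mul a.c b.c) (Nat.mul a.d b.d)))
      (Nat.add (Nat.add (Nat.mul a.a b.c) (Nat.mul a.b b.d))
        (Nat.add (Nat.mul a.c b.a) (Nat.mul a.d b.b)))
      (Nat.add (Nat.add (Nat.mul a.a b.d) (Nat.mul a.b b.c))
        (Nat.add (Nat.mul a.c b.b) (Nat.mul a.d b.a)))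
      (Nat.add (Nat.mul (nc a) b.e) (Nat.mul n a.e))
    refine le_of_eq_of_le ?_ hh
    change ‖_ - (mulP a b n).ctr‖ = ‖_ - (mulP a b n).ctr‖
    congr 2
    rw [div_eq_iff (by norm_num)]
    apply Complex.ext <;> simp [ctr] <;> ring
  have h3 : x * y * 18446744073709551616 - (mulP a b n).ctr
      = (a.ctr * (y * 18446744073709551616 - b.ctr)
        + (x * 18446744073709551616 - a.ctr) * (y * 18446744073709551616))
          / 18446744073709551616 +
        (a.ctr * b.ctr / 18446744073709551616 - (mulP a b n).ctr) := by
    field_simp; ring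
  rw [h3]
  refine (norm_add_le _ _).trans ?_
  set N : ℕ := (nc a * b.e + n * a.e)
    with hNdef
  have h6 : ((mulP a b n).e : ℝ) = ((N / 18446744073709551616 : ℕ) : ℝ) + 3 := by
    simp only [mulP, mul0, hNdef]; push_cast [Nat.add_eq]; rfl
  have h5 := nat_div_ge N 18446744073709551616 (by norm_num)
  have h4 : ‖(a.ctr * (y * 18446744073709551616 - b.ctr)
        + (x * 18446744073709551616 - a.ctr) * (y * 18446744073709551616))
          / 18446744073709551616‖ ≤ (N : ℝ) / (18446744073709551616 : ℕ) := by
    rw [norm_div]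
    have e : ‖(18446744073709551616 : ℂ)‖ = ((18446744073709551616 : ℕ) : ℝ) := by simp
    rw [e]
    gcongr
    refine (norm_add_le _ _).trans ?_
    rw [norm_mul, norm_mul, norm_mul y, e, hNdef]
    have hn' : ‖y‖ * ((18446744073709551616 : ℕ) : ℝ) ≤ n := by exact_mod_cast hn
    push_cast at hn' ⊢
    rw [mul_comm (n : ℝ)]
    gcongr
  rw [h6]; linarith

noncomputable def goK (u u' : CB) (d n0 n1 n2 : Nat) (L : List CB) :
    Nat → CB → CB → Nat → (List CB → Bool) → Bool :=
  List.rec (fun _ _ _ _ k => k []) (fun a _ ih j P Q D k =>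
    fC (widen (add a (add P Q)) (errN n0 n1 n2 j D)) fun a' =>
    mulPK P u d fun P' => mulPK Q u' d fun Q' =>
    fN (Nat.add (Nat.div (Nat.mul D d) 18446744073709551616) 1) fun D' =>
    fN (Nat.succ j) fun j' =>
    ih j' P' Q' D' fun L' => k (a' :: L')) L

theorem goK_sound {h s s' δ : ℝ} {U U' pc : ℂ} {u u' : CB} {d n0 n1 n2 : ℕ} (hu : mem U u) (hu' : mem U' u')
    (hUn : ‖U‖ * 18446744073709551616 ≤ d) (hUn' : ‖U'‖ * 18446744073709551616 ≤ d)
    (hδ : 0 ≤ δ) (hd : δ * 18446744073709551616 ≤ d)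
    (hc : ∀ j : ℕ, ‖FI h ((j : ℝ) / 16) s' - FI h ((j : ℝ) / 16) s - (pc * U ^ j + pc * U' ^ j)‖
      ≤ (256 * n0 + j * (16 * n1 + n2 * j)) * (δ ^ j + 1) / 1813388729421943762059264000)
    (L : List CB) : ∀ (j : ℕ) (P Q : CB) (D : ℕ) (k : List CB → Bool), mem (pc * U ^ j) P → mem (pc * U' ^ j) Q →
      δ ^ j * 18446744073709551616 ≤ D → accOK h s j L → goK u u' d n0 n1 n2 L j P Q D k = true →
      ∃ L', accOK h s' j L' ∧ L'.length = L.length ∧ k L' = true := by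
  induction L with
  | nil => intro j P Q D k _ _ _ _ H; exact ⟨[], trivial, rfl, H⟩
  | cons a L ih =>
    intro j P Q D k hP hQ hD hA H
    have H' : (fC (widen (add a (add P Q)) (errN n0 n1 n2 j D)) fun a' =>
      mulPK P u d fun P' => mulPK Q u' d fun Q' =>
      fN (Nat.add (Nat.div (Nat.mul D d) 18446744073709551616) 1) fun D' =>
      fN (Nat.succ j) fun j' =>
      goK u u' d n0 n1 n2 L j' P' Q' D' fun L' => k (a' :: L')) = true := H
    rw [fC_eq, mulPK_eq, mulPK_eq, fN_eq, fN_eq] at H'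
    obtain ⟨hA1, hA2⟩ := hA
    obtain ⟨L', h1, h2, h3⟩ := ih (j + 1) _ _ _ _ (mem_neg1 (by ring) (mem_mulP hP hu hUn))
      (mem_neg1 (by ring) (mem_mulP hQ hu' hUn')) (by
        rw [cast_aux3]
        have := nat_div_ge (Nat.mul D d) 18446744073709551616 (by norm_num)
        refine le_trans ?_ this
        rw [Nat.mul_eq, Nat.cast_mul, pow_succ]
        have e : (((18446744073709551616 : ℕ) : ℝ)) = 18446744073709551616 := by norm_num
        rw [e, le_div_iff₀ (by norm_num)]
        calc δ ^ j * δ * 18446744073709551616 * 18446744073709551616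
          = (δ ^ j * 18446744073709551616) * (δ * 18446744073709551616) := by ring
          _ ≤ _ := by gcongr) hA2 H'
    refine ⟨_ :: L', ⟨?_, h1⟩, by simp [h2], h3⟩
    refine mem_widen (mem_add hA1 (mem_add hP hQ)) ?_
    have hb := hc j
    have e : FI h ((j : ℝ) / 16) s' - (FI h ((j : ℝ) / 16) s + (pc * U ^ j + pc * U' ^ j))
      = FI h ((j : ℝ) / 16) s' - FI h ((j : ℝ) / 16) s - (pc * U ^ j + pc * U' ^ j) := by ring
    rw [e]
    unfold errN
    rw [cast_aux3]
    refine le_trans ?_ (nat_div_ge _ _ (by norm_num))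
    have e2 : ((Nat.mul (Nat.add (Nat.mul 256 n0) (Nat.mul j (Nat.add (Nat.mul 16 n1) (Nat.mul n2 j))))
      (Nat.add D 18446744073709551616) : ℕ) : ℝ)
      = (256 * n0 + j * (16 * n1 + n2 * j)) * (D + 18446744073709551616) := by
      simp only [Nat.mul_eq, Nat.add_eq]
      push_cast
      ring
    have e3 : (((1813388729421943762059264000 : ℕ) : ℝ)) = 1813388729421943762059264000 := by norm_num
    rw [e2, e3, le_div_iff₀ (by norm_num)]
    rw [le_div_iff₀ (by norm_num)] at hb
    calc _ = ‖FI h ((j : ℝ) / 16) s' - FI h ((j : ℝ) / 16) s - (pc * U ^ j + pc * U' ^ j)‖ * 1813388729421943762059264000 * 18446744073709551616 := by ring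
      _ ≤ ((256 * n0 + j * (16 * n1 + n2 * j)) * (δ ^ j + 1)) * 18446744073709551616 := by
        exact mul_le_mul_of_nonneg_right hb (by norm_num)
      _ = (256 * n0 + j * (16 * n1 + n2 * j)) * (δ ^ j * 18446744073709551616 + 18446744073709551616) := by ring
      _ ≤ _ := by gcongr

theorem mem_zero' : mem 0 ⟨0, 0, 0, 0, 0⟩ := by
  rw [mem_iff]
  simp [ctr]; rfl

noncomputable def nodeK (H : Nat) (r : Row) (acc : List CB) (k : List CB → Bool) : Bool :=
  fC (sdiv (mulI (add r.X (mulI (sdiv (nmul H r.V) 100)))) 16) fun W =>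
  cexpK W fun u => cexpK (neg W) fun u' =>
  fN (Nat.add (Nat.add (nrm r.Y) 465780287861166178) 1) fun Xn =>
  fN (Nat.add (nrm (add r.V ⟨0, 0, 0, 0, 0⟩)) 788598309151083332) fun vN =>
  cexpK (sdiv (nmul H ⟨vN, 0, 0, 0, 0⟩) 1600) fun dB =>
  fN (nrm dB) fun d =>
  fC (rat H 100) fun HB =>
  mulK ⟨Xn, 0, 0, 0, 0⟩ (add (rat 303 100) (mul (rat 485 100) HB)) fun t1 =>
  fN (nrm (add t1 (mul (rat 34542 10000) HB))) fun n1 =>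
  mulK (rat 171 100) HB fun q =>
  mulK q q fun qq' =>
  mulK ⟨Xn, 0, 0, 0, 0⟩ ⟨Xn, 0, 0, 0, 0⟩ fun xx =>
  mulK ⟨Xn, 0, 0, 0, 0⟩ (add xx qq') fun t2 =>
  fN (nrm t2) fun n2 =>
  fC (sdiv r.Y 40) fun P =>
  goK u u' d 18631211514446647133 n1 n2 acc 0 P P 18446744073709551616 k

theorem nodeK_sound {H : ℕ} {r : Row} {m : ℝ} (hr : rowOK m r) (hm0 : 0 ≤ m - 1 / 40) (hm1 : m + 1 / 40 ≤ 3.15)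
    {acc : List CB} {k : List CB → Bool} (hA : accOK ((H : ℝ) / 100) (m - 1 / 40) 0 acc)
    (HH : nodeK H r acc k = true) :
    ∃ L', accOK ((H : ℝ) / 100) (m + 1 / 40) 0 L' ∧ L'.length = acc.length ∧ k L' = true := by
  obtain ⟨hx, hy, hv⟩ := hr
  set h : ℝ := (H : ℝ) / 100 with hh
  have hh0 : 0 ≤ h := by positivity
  unfold nodeK at HH
  rw [fC_eq] at HH
  have hW : mem (Complex.I * wf h m / 16) (sdiv (mulI (add r.X (mulI (sdiv (nmul H r.V) 100)))) 16) := by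
    refine mem_neg1 ?_ (mem_sdiv (k := 16) (by norm_num) (mem_mulI (mem_add hx (mem_mulI (mem_sdiv (k := 100) (by norm_num) (mem_nmul H hv))))))
    rw [wf, hh]; push_cast; ring
  obtain ⟨u, hu, HH⟩ := cexpK_sound HH hW
  obtain ⟨u', hu', HH⟩ := cexpK_sound HH (mem_neg hW)
  rw [fN_eq, fN_eq] at HH
  generalize hXn : (Nat.add (Nat.add (nrm r.Y) 465780287861166178) 1) = Xn at HH
  generalize hvN : (Nat.add (nrm (add r.V ⟨0, 0, 0, 0, 0⟩)) 788598309151083332) = vN at HH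
  have hX : |x1 m| + 1.01 * (1 / 40) ≤ (Xn : ℝ) / 18446744073709551616 := by
    have := norm_le_nrm hy
    rw [Complex.norm_real, Real.norm_eq_abs] at this
    have e : (Xn : ℝ) = nrm r.Y + 465780287861166178 + 1 := by
      rw [← hXn]; simp only [Nat.add_eq]; push_cast; ring
    rw [le_div_iff₀ (by norm_num), e]
    norm_num at *
    linarith
  have hV : |v0 m| + 1.71 * (1 / 40) ≤ (vN : ℝ) / 18446744073709551616 := by
    have := norm_le_nrm (mem_add hv mem_zero')
    rw [add_zero, Complex.norm_real, Real.norm_eq_abs] at this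
    have e : (vN : ℝ) = nrm (add r.V ⟨0, 0, 0, 0, 0⟩) + 788598309151083332 := by
      rw [← hvN]; simp only [Nat.add_eq]; push_cast; ring
    rw [le_div_iff₀ (by norm_num), e]
    norm_num at *
    linarith
  obtain ⟨dB, hdB, HH⟩ := cexpK_sound HH (mem_sdiv (k := 1600) (by norm_num) (mem_nmul H (mem_exact vN)))
  rw [fN_eq, fC_eq, mulK_eq, fN_eq, mulK_eq, mulK_eq, mulK_eq, mulK_eq, fN_eq, fC_eq] at HH
  set δ : ℝ := Real.exp (h * ((vN : ℝ) / 18446744073709551616) / 16) with hδ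
  have hd : δ * 18446744073709551616 ≤ (nrm dB : ℝ) := by
    have := norm_le_nrm hdB
    have e : Complex.exp ((H : ℂ) * (((vN : ℝ) / 18446744073709551616 : ℝ) : ℂ) / (1600 : ℕ)) = (δ : ℂ) := by
      rw [hδ, hh]; push_cast; congr 1; ring
    rw [e, Complex.norm_real, Real.norm_eq_abs, abs_of_pos (Real.exp_pos _)] at this
    exact this
  set Xr : ℝ := (Xn : ℝ) / 18446744073709551616 with hXr
  have hX0 : 0 ≤ Xr := by positivity
  have hHB : mem (h : ℂ) (rat H 100) := mem_neg1 (by rw [hh]; push_cast; ring) (mem_rat H 100 (by norm_num))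
  have m1 := norm_le_nrm (mem_add (mem_mul (mem_exact Xn) (mem_add (mem_rat 303 100 (by norm_num)) (mem_mul (mem_rat 485 100 (by norm_num)) hHB))) (mem_mul (mem_rat 34542 10000 (by norm_num)) hHB))
  have hq := mem_mul (mem_rat 171 100 (by norm_num)) hHB
  have m2 := norm_le_nrm (mem_mul (mem_exact Xn) (mem_add (mem_mul (mem_exact Xn) (mem_exact Xn)) (mem_mul hq hq)))
  rw [← hXr] at m1 m2
  generalize hn1 : nrm (add (mul ⟨Xn, 0, 0, 0, 0⟩ (add (rat 303 100) (mul (rat 485 100) (rat H 100)))) (mul (rat 34542 10000) (rat H 100))) = n1 at HH m1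
  generalize hn2 : nrm (mul ⟨Xn, 0, 0, 0, 0⟩ (add (mul ⟨Xn, 0, 0, 0, 0⟩ ⟨Xn, 0, 0, 0, 0⟩) (mul (mul (rat 171 100) (rat H 100)) (mul (rat 171 100) (rat H 100))))) = n2 at HH m2
  have k1 : (Xr * (3.03 + 4.85 * h) + 3.4542 * h) * 18446744073709551616 ≤ n1 := by
    have e : (Xr : ℂ) * (((303 : ℕ) : ℂ) / (100 : ℕ) + ((485 : ℕ) : ℂ) / (100 : ℕ) * h) + ((34542 : ℕ) : ℂ) / (10000 : ℕ) * h
      = ((Xr * (3.03 + 4.85 * h) + 3.4542 * h : ℝ) : ℂ) := by push_cast; ring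
    rw [e, Complex.norm_real, Real.norm_eq_abs, abs_of_nonneg (by positivity)] at m1
    exact m1
  have k2 : (Xr * (Xr * Xr + 1.71 * h * (1.71 * h))) * 18446744073709551616 ≤ n2 := by
    have e : (Xr : ℂ) * (Xr * Xr + ((171 : ℕ) : ℂ) / (100 : ℕ) * h * (((171 : ℕ) : ℂ) / (100 : ℕ) * h))
      = ((Xr * (Xr * Xr + 1.71 * h * (1.71 * h)) : ℝ) : ℂ) := by push_cast; ring
    rw [e, Complex.norm_real, Real.norm_eq_abs, abs_of_nonneg (by positivity)] at m2
    exact m2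
  have wfre : (Complex.I * wf h m / 16).re = -(h * v0 m) / 16 := by
    have : Complex.I * wf h m / 16 = ((1/16 : ℝ) : ℂ) * (Complex.I * wf h m) := by push_cast; ring
    rw [this, Complex.re_ofReal_mul, Complex.I_mul_re, wf_im]; ring
  have hUU : ∀ (U : ℂ) (c : ℝ), ‖U‖ = Real.exp (h * (-(c * v0 m)) / 16) → -(c * v0 m) ≤ |v0 m| →
      ‖U‖ * 18446744073709551616 ≤ (nrm dB : ℝ) := by
    intro U c h1 h2
    refine le_trans ?_ hd
    rw [h1, hδ]
    gcongr
    linarith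
  refine goK_sound (h := h) (s := m - 1 / 40) (s' := m + 1 / 40) (δ := δ) (pc := (x1 m : ℂ) / 40) hu hu' (hUU _ 1 (by rw [Complex.norm_exp, wfre]; congr 1; ring) (by linarith [neg_abs_le (v0 m)])) (hUU _ (-1) (by rw [Complex.norm_exp, Complex.neg_re, wfre]; congr 1; ring) (by linarith [le_abs_self (v0 m)])) (Real.exp_pos _).le hd ?_ acc 0 _ _ _ k
    (mem_neg1 (by push_cast; ring) (mem_sdiv (k := 40) (by norm_num) hy))
    (mem_neg1 (by push_cast; ring) (mem_sdiv (k := 40) (by norm_num) hy)) (by simp) hA HH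
  intro j
  have hc := FI_cell (h := h) (y := (j : ℝ) / 16) (m := m) (r := 1 / 40) (X := Xr) (E := δ ^ j) (by norm_num) hm0 hm1 hh0
    (by positivity) hX (by
      rw [hδ, ← Real.exp_nat_mul]
      apply Real.exp_le_exp.2
      calc (j : ℝ) / 16 * (h * (|v0 m| + 1.71 * (1 / 40))) ≤ (j : ℝ) / 16 * (h * ((vN : ℝ) / 18446744073709551616)) := by gcongr
        _ = _ := by ring)
  have e1 : ((2 * (1 / 40) : ℝ) : ℂ) * ((x1 m : ℂ) * Complex.cos ((((j : ℝ) / 16 : ℝ) : ℂ) * wf h m))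
    = ((x1 m : ℂ) / 40) * Complex.exp (Complex.I * wf h m / 16) ^ j + ((x1 m : ℂ) / 40) * Complex.exp (-(Complex.I * wf h m / 16)) ^ j := by
    rw [← Complex.exp_nat_mul, ← Complex.exp_nat_mul, Complex.cos]
    have e2 : (((j : ℝ) / 16 : ℝ) : ℂ) * wf h m * Complex.I = (j : ℂ) * (Complex.I * wf h m / 16) := by push_cast; ring
    have e3 : -((((j : ℝ) / 16 : ℝ) : ℂ) * wf h m) * Complex.I = (j : ℂ) * (-(Complex.I * wf h m / 16)) := by push_cast; ring
    rw [e2, e3]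
    push_cast
    ring
  rw [e1] at hc
  refine hc.trans ?_
  rw [le_div_iff₀ (by norm_num)]
  have hMc : Mc h Xr 1 ((j : ℝ) / 16) (((j : ℝ) / 16) ^ 2) = 1.01 + (Xr * (3.03 + 4.85 * h) + 3.4542 * h) * (j / 16)
    + (Xr * (Xr * Xr + 1.71 * h * (1.71 * h))) * (j / 16) ^ 2 := by
    unfold Mc; ring
  rw [hMc]
  have hδj : 0 ≤ δ ^ j := by positivity
  have hj : (0:ℝ) ≤ j := Nat.cast_nonneg _
  set A1 := Xr * (3.03 + 4.85 * h) + 3.4542 * h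
  set A2 := Xr * (Xr * Xr + 1.71 * h * (1.71 * h))
  have e4 : (1.01 + A1 * ((j : ℝ) / 16) + A2 * ((j : ℝ) / 16) ^ 2) * ((δ ^ j + 1) / 2) * (2 * (1 / 40)) ^ 3 / 24 * 1813388729421943762059264000
    = (256 * (1.01 * 18446744073709551616) + j * (16 * (A1 * 18446744073709551616) + (A2 * 18446744073709551616) * j)) * (δ ^ j + 1) := by
    ring
  rw [e4]
  have e5 : (1.01 : ℝ) * 18446744073709551616 ≤ ((18631211514446647133 : ℕ) : ℝ) := by norm_num
  gcongr

noncomputable def loopK (H : Nat) (L : List Row) (k : List CB → Bool) : List CB → Bool :=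
  List.rec (fun a => k a) (fun r _ ih a => nodeK H r a ih) L

theorem loopK_sound {H : ℕ} {k : List CB → Bool} (L : List Row) : ∀ (s : ℕ) (acc : List CB),
    ((s + L.length : ℕ) : ℝ) / 20 ≤ 3.15 → tabOK 20 s L → accOK ((H : ℝ) / 100) ((s : ℝ) / 20) 0 acc →
    loopK H L k acc = true →
    ∃ L', accOK ((H : ℝ) / 100) (((s + L.length : ℕ) : ℝ) / 20) 0 L' ∧ L'.length = acc.length ∧ k L' = true := by
  induction L with
  | nil => intro s acc _ _ hA HH; exact ⟨acc, by simpa using hA, rfl, HH⟩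
  | cons r L ih =>
    intro s acc hle hT hA HH
    obtain ⟨hr, hT⟩ := hT
    have HH' : nodeK H r acc (loopK H L k) = true := HH
    have e1 : (((2 * s + 1 : ℕ) : ℝ) / ((2 * 20 : ℕ) : ℝ)) - 1 / 40 = s / 20 := by
      push_cast; ring
    have e2 : (((2 * s + 1 : ℕ) : ℝ) / ((2 * 20 : ℕ) : ℝ)) + 1 / 40 = ((s + 1 : ℕ) : ℝ) / 20 := by
      push_cast; ring
    have e3 : ((s + (r :: L).length : ℕ) : ℝ) = ((s + 1 + L.length : ℕ) : ℝ) := by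
      push_cast [List.length_cons]; ring
    rw [e3] at hle ⊢
    have hle1 : ((s + 1 : ℕ) : ℝ) / 20 ≤ ((s + 1 + L.length : ℕ) : ℝ) / 20 := by
      exact div_le_div_of_nonneg_right (Nat.cast_le.2 (by omega)) (by norm_num)
    obtain ⟨L1, h1, h2, h3⟩ := nodeK_sound hr (by rw [e1]; positivity) (by rw [e2]; exact hle1.trans hle)
      (by rw [e1]; exact hA) HH'
    rw [e2] at h1
    obtain ⟨L2, g1, g2, g3⟩ := ih (s + 1) L1 hle hT h1 h3
    exact ⟨L2, g1, g2.trans h2, g3⟩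

noncomputable def finF (T : List Nat) : List CB → Nat → Bool :=
  List.rec (fun _ _ => true) (fun t _ ih a j =>
    List.rec false (fun b bs _ => Bool.and (Nat.ble (Nat.add (Nat.add (ai b) b.e) (Nat.mul 368934881474192 j)) (Nat.mul t 4294967296))
      (ih bs (Nat.succ j))) a) T

def FT (h : ℝ) : ℕ → List ℕ → Prop
  | _, [] => True
  | j, t :: T => |(FI h ((j : ℝ) / 16) 3.15).im| + 0.00002 * j ≤ (t : ℝ) / 4294967296 ∧ FT h (j + 1) T

theorem im_up {z : ℂ} {b : CB} (h : mem z b) : |z.im| * 18446744073709551616 ≤ ai b + b.e := by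
  rw [mem_iff] at h
  rw [ai_cast]
  have h1 := (Complex.abs_im_le_norm _).trans h
  have e : (z * 18446744073709551616 - b.ctr).im = z.im * 18446744073709551616 - b.ctr.im := by
    simp [Complex.mul_im]
  rw [e] at h1
  have h2 := abs_sub_abs_le_abs_sub (z.im * 18446744073709551616) b.ctr.im
  rw [abs_mul, abs_of_pos (by norm_num : (0:ℝ) < 18446744073709551616)] at h2
  linarith

theorem finF_sound {h : ℝ} (T : List ℕ) : ∀ (L : List CB) (j : ℕ), accOK h 3.15 j L → finF T L j = true → FT h j T := by
  induction T with
  | nil => intros; trivial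
  | cons t T ih =>
    intro L j hA HH
    cases L with
    | nil => exact absurd HH (by simp [finF])
    | cons b bs =>
      have HH' : (Bool.and (Nat.ble (Nat.add (Nat.add (ai b) b.e) (Nat.mul 368934881474192 j)) (Nat.mul t 4294967296))
        (finF T bs (Nat.succ j))) = true := HH
      simp only [Bool.and_eq_true] at HH'
      refine ⟨?_, ih bs (j + 1) hA.2 HH'.2⟩
      have h1 := im_up hA.1
      have h2 : ((Nat.add (Nat.add (ai b) b.e) (Nat.mul 368934881474192 j) : ℕ) : ℝ) ≤ ((Nat.mul t 4294967296 : ℕ) : ℝ) :=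
        Nat.cast_le.2 (Nat.le_of_ble_eq_true HH'.1)
      simp only [Nat.mul_eq, Nat.add_eq] at h2
      push_cast at h2
      have hj : (0:ℝ) ≤ j := Nat.cast_nonneg _
      rw [le_div_iff₀ (by norm_num)]
      norm_num at *
      linarith

noncomputable def zerosK (n : Nat) : List CB := Nat.rec [] (fun _ ih => ⟨0, 0, 0, 0, 0⟩ :: ih) n

theorem zeros_ok (h : ℝ) (n : ℕ) : ∀ j, accOK h 0 j (zerosK n) := by
  induction n with
  | zero => intro j; trivial
  | succ n ih =>
    intro j
    refine ⟨?_, ih (j + 1)⟩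
    unfold FI
    rw [intervalIntegral.integral_same, mem_iff]
    simp [ctr]
    rfl

theorem tabF_len : tabF.length = 63 := by decide +kernel

noncomputable def FK (H : Nat) (T : List Nat) : Bool := loopK H tabF (fun L => finF T L 0) (zerosK 129)

theorem FK_sound {H : ℕ} {T : List ℕ} (HH : FK H T = true) : FT ((H : ℝ) / 100) 0 T := by
  obtain ⟨L', h1, -, h3⟩ := loopK_sound (H := H) tabF 0 (zerosK 129) (by rw [tabF_len]; norm_num) tabF_ok
    (by simpa using zeros_ok _ _ 0) HH
  rw [tabF_len] at h1
  have e : ((0 + 63 : ℕ) : ℝ) / 20 = 3.15 := by norm_num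
  rw [e] at h1
  exact finF_sound T L' 0 h1 h3

def T77 : List Nat := [
  1470626, 2501858, 3502190, 5549882, 9722806, 17618327, 31171609, 52572790, 84172012,
  128375674, 187537676, 263849547, 359233468, 475242087, 612968835, 772972088, 955216090, 1159030973,
  1383093575, 1625430061, 1883440613, 2153945697, 2433252694, 2717240981, 3001462899, 3281257527, 3551873698,
  3808598395, 4046886435, 4262487312, 4451565120, 4610807694, 4737521440, 4829708778, 4886125683, 4906317418,
  4890631288, 4840205953, 4756937588, 4643423941, 4502887999, 4339083665, 4156186364, 3958671999, 3751188017,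
  3538420559, 3324961797, 3115181500, 2913106714, 2722313162, 2545831556, 2386071494, 2244765083, 2122931710,
  2020864764, 1938140356, 1873647430, 1825637947, 1791795245, 1769318114, 1755017662, 1745423706, 1736897160,
  1725744794, 1708332699, 1681194933, 1641134046, 1585310511, 1511318515, 1417246064, 1301717918, 1163920456,
  1003608201, 821092333, 617212101, 547924202, 826498592, 1122570631, 1433805411, 1757675112, 2091545688,
  2432763385, 2778738144, 3127021185, 3475374309, 3821828828, 4164732444, 4502782860, 4835047424, 5160968575,
  5480355410, 5793362126, 6100454576, 6402366512, 6700047456, 6994604352, 7287239323, 7579185927, 7871646292,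
  8165731412, 8462406700, 8762444653, 9066386165, 9374511664, 9686822865, 10003035508, 10322583045, 10644630815,
  10968099911, 11291699545, 11613966488, 11933309890, 12248059663, 12556516485, 12857001500, 13147903841, 13427724207,
  13695112956, 13948901392, 14188125214, 14412039444, 14620124453, 14812083096, 14987829266, 15147468547, 15291271898,
  15419643577, 15533084701, 15632154002]
set_option maxRecDepth 100000 in
theorem T77_ok : FT ((77 : ℕ) / 100 : ℝ) 0 T77 := FK_sound (by decide +kernel)

def T80 : List Nat := [
  1470626, 2527979, 3554084, 5670571, 10000044, 18205802, 32303149, 54573343, 87464916,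
  133485871, 195090649, 274565924, 373919387, 494775553, 638282460, 805032722, 995001969, 1207507104,
  1441186140, 1694000680, 1963261298, 2245675343, 2537415891, 2834209872, 3131442720, 3424276349, 3707776759,
  3977047266, 4227363119, 4454303207, 4653874624, 4822626087, 4957746543, 5057145752, 5119514241, 5144360640,
  5132025183, 5083668865, 5001238573, 4887409243, 4745504832, 4579400574, 4393409553, 4192157126, 3980447100,
  3763123790, 3544934201, 3330394546, 3123665131, 2928437350, 2747836114, 2584340514, 2439724925, 2315022069,
  2210508856, 2125715105, 2059454482, 2009876357, 1974536580, 1950484657, 1934364300, 1922523965, 1911133729,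
  1896304735, 1874207414, 1841184808, 1793857569, 1729217534, 1644707219, 1538283097, 1408461082, 1254343302,
  1075625811, 872587592, 646061760, 622002482, 931675190, 1261063968, 1607761311, 1969150987, 2342497863,
  2725037691, 3114063844, 3507008149, 3901513283, 4295494533, 4687189172, 5075192165, 5458477446, 5836404530,
  6208710721, 6575489721, 6937157849, 7294409509, 7648163888, 7999505079, 8349618045, 8699722871, 9051009772,
  9404577212, 9761375311, 10122156459, 10487434744, 10857455416, 11232175244, 11611254138, 11994058051, 12379672698,
  12766927271, 13154426991, 13540592993, 13923707854, 14301964889, 14673519228, 15036538709, 15389252635, 15729996621,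
  16057251908, 16369677785, 16666136081, 16945706971, 17207695732, 17451630430, 17677250855, 17884489386, 18073444729,
  18244349776, 18397534999, 18533388971]
set_option maxRecDepth 100000 in
theorem T80_ok : FT ((80 : ℕ) / 100 : ℝ) 0 T80 := FK_sound (by decide +kernel)

def T90 : List Nat := [
  1470626, 2615330, 3728965, 6078877, 10939127, 20195956, 36135876, 61348874, 98617366,
  150794858, 220678652, 310881169, 423704533, 561022974, 724177360, 913885773, 1130173540, 1372325434,
  1638862083, 1927541745, 2235387805, 2558741458, 2893338166, 3234405723, 3576780951, 3915041472, 4243648437,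
  4557095713, 4850060808, 5117552697, 5355051826, 5558637770, 5725100435, 5852031191, 5937890961, 5982053047,
  5984819242, 5947408672, 5871919647, 5761265679, 5619087631, 5449644723, 5257687774, 5048318607, 4826839968,
  4598600592, 4368840148, 4142538806, 3924275953, 3718102284, 3527429023, 3354937461, 3202511335, 3071193795,
  2961169969, 2871775258, 2801528732, 2748190194, 2708838757, 2679970153, 2657609434, 2637435292, 2614911961,
  2585424457, 2544412920, 2487501939, 2410620955, 2310112259, 2182823539, 2026182507, 1838251786, 1617762902,
  1364128950, 1077436189, 758415517, 935971145, 1374718404, 1842865109, 2337839683, 2856802569, 3396746011,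
  3954594425, 4527301970, 5111944145, 5705800507, 6306426023, 6911709021, 7519914227, 8129709942, 8740178986,
  9350813619, 9961495192, 10572459796, 11184251626, 11797666163, 12413685564, 13033408841, 13657979543, 14288513624,
  14926030104, 15571386958, 16225224369, 16887917187, 17559537994, 18239831799, 18928202867, 19623713773, 20325096297,
  21030773327, 21738890595, 22447356713, 23153889696, 23856068019, 24551384079, 25237297966, 25911289448, 26570906240,
  27213806807, 27837796221, 28440853904, 29021152439, 29577067006, 30107175382, 30610248830, 31085234541, 31531230655,
  31947455124, 32333209941, 32687842416]
set_option maxRecDepth 100000 in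
theorem T90_ok : FT ((90 : ℕ) / 100 : ℝ) 0 T90 := FK_sound (by decide +kernel)

def T105 : List Nat := [
  1556820, 2833614, 4083683, 6796974, 12482564, 23371757, 42171572, 71951843,
  116015630, 177757546, 260515011, 367417762, 501240975, 664267330, 858162996, 1083872141,
  1341533880, 1630424913, 1948930192, 2294543022, 2663895062, 3052815615, 3456418641, 3869215010,
  4285246592, 4698238088, 5101761863, 5489410579, 5854972178, 6192601593, 6496983724, 6763482390,
  6988270481, 7168437060, 7302067926, 7388296990, 7427326722, 7420416951, 7369842248, 7278819166,
  7151405545, 6992374954, 6807070144, 6601240004, 6380865021, 6151976614, 5920475798, 5691956722,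
  5471540332, 5263723130, 5072245465, 4899983108, 4748865172, 4619820509, 4512753873, 4426552153,
  4359120062, 4307443767, 4267680076, 4235268079, 4205059464, 4171463223, 4128600111, 4070461973,
  3991071066, 3884634510, 3745689363, 3569234162, 3350843294, 3086761225, 2773974313, 2410258694,
  1994203584, 1525210079, 1003466388, 1665500660, 2397714058, 3183589727, 4020741845, 4906412522,
  5837584611, 6811096390, 7823754219, 8872439445, 9954206164, 11066366845, 12206563341, 13372821381,
  14563587262, 15777746106, 17014621713, 18273958639, 19555887748, 20860877004, 22189669699, 23543212710,
  24922577577, 26328877412, 27763182604, 29226438300, 30719386391, 32242494532, 33795894307, 35379330315,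
  36992121421, 38633134952, 40300774123, 41992978449, 43707236447, 45440609495, 47189765338, 48951019422,
  50720382034, 52493609045, 54266254045, 56033719666, 57791306025, 59534254422, 61257784678, 62957124851,
  64627532410, 66264306374, 67862790299, 69418366428, 70926441696, 72382426628, 73781708497, 75119620309,
  76391407443]
set_option maxRecDepth 100000 in
theorem T105_ok : FT ((105 : ℕ) / 100 : ℝ) 0 T105 := FK_sound (by decide +kernel)

def T125 : List Nat := [
  1556820, 3010910, 4452399, 7675803, 14519633, 27697063, 50503989, 86684824,
  140278349, 215449040, 316309786, 446742261, 610221298, 809649525, 1047208202, 1324229658,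
  1641096043, 1997168239, 2390747743, 2819073284, 3278352748, 3763829794, 4269883400, 4790157450,
  5317716467, 5845222703, 6365129042, 6869881655, 7352125972, 7804909376, 8221874131, 8597434305,
  8926930970, 9206760610, 9434472508, 9608831883, 9729846598, 9798756415, 9817984979, 9791055836,
  9722474960, 9617583276, 9482383629, 9323347384, 9147206502, 8960737337, 8770542637, 8582838235,
  8403250749, 8236632208, 8086896984, 7956885619, 7848259358, 7761428123, 7695513699, 7648348729,
  7616511100, 7595392143, 7579296138, 7561567668, 7534742590, 7490717747, 7420934073, 7316567461,
  7168721630, 6968617308, 6707772310, 6378167506, 5972394235, 5483779432, 4906485535, 4235583125,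
  3467095164, 2598012647, 2098417090, 3406791129, 4834006864, 6380527252, 8046204805, 9830398434,
  11732098983, 13750058870, 15882921276, 18129344475, 20488117178, 22958261213, 25539118372, 28230418892,
  31032329689, 33945481210, 36970972506, 40110354788, 43365594496, 46739017467, 50233236335, 53851063806,
  57595414686, 61469199879, 65475215566, 69616030869, 73893877066, 78310541300, 82867267296, 87564665266,
  92402632689, 97380287154, 102495911916, 107746914324, 113129796721, 118640139024, 124272591712, 130020877650,
  135877800919, 141835260627, 147884267624, 154014962057, 160216629770, 166477715820, 172785833552, 179127768089,
  185489473402, 191856062580, 198211791313, 204540035047, 210823260665, 217042993931, 223179784249, 229213168586,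
  235121636591]
set_option maxRecDepth 100000 in
theorem T125_ok : FT ((125 : ℕ) / 100 : ℝ) 0 T125 := FK_sound (by decide +kernel)

/-! ### The one dimensional integral after integrating by parts -/

noncomputable def ph (h y t : ℝ) : ℝ := Real.sin (z₁ t * y) * Real.sinh (y * (h * v0 t))

noncomputable def Fr (h y : ℝ) : ℝ := ∫ t in (0:ℝ)..π, x1 t * ph h y t

theorem cont_x1 : Continuous x1 := continuous_iff_continuousAt.2 fun t => (hasDerivAt_x1 t).continuousAt
theorem cont_z1 : Continuous z₁ := continuous_iff_continuousAt.2 fun t => (hasDerivAt_z1 t).continuousAt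
theorem cont_v0 : Continuous v0 := continuous_iff_continuousAt.2 fun t => (hasDerivAt_v0 t).continuousAt
theorem cont_v1 : Continuous v1 := continuous_iff_continuousAt.2 fun t => (hasDerivAt_v1 t).continuousAt

theorem cont_ph (h y : ℝ) : Continuous fun t => x1 t * ph h y t := by
  unfold ph
  have h1 := cont_x1
  have h2 := cont_z1
  have h3 := cont_v0
  fun_prop

theorem im_cos_wf (h y t : ℝ) : (Complex.cos ((y : ℂ) * wf h t)).im = - ph h y t := by
  have e : (y : ℂ) * wf h t = ((z₁ t * y : ℝ) : ℂ) + ((y * (h * v0 t) : ℝ) : ℂ) * Complex.I := by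
    unfold wf; push_cast; ring
  rw [e, Complex.cos_add_mul_I, ← Complex.ofReal_cos, ← Complex.ofReal_cosh, ← Complex.ofReal_sin, ← Complex.ofReal_sinh,
    ← Complex.ofReal_mul, ← Complex.ofReal_mul, Complex.sub_im, Complex.ofReal_im, Complex.im_ofReal_mul]
  simp only [Complex.I_im, ph]
  ring

theorem FI_im (h y s : ℝ) : (FI h y s).im = - ∫ t in (0:ℝ)..s, x1 t * ph h y t := by
  unfold FI
  have h0 := (FI_cont h y).intervalIntegrable (μ := volume) 0 s
  have h1 := ContinuousLinearMap.intervalIntegral_comp_comm Complex.imCLM h0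
  have h2 : (∫ t in (0:ℝ)..s, (x1 t : ℂ) * Complex.cos ((y : ℂ) * wf h t)).im
    = Complex.imCLM (∫ t in (0:ℝ)..s, (x1 t : ℂ) * Complex.cos ((y : ℂ) * wf h t)) := rfl
  rw [h2, ← h1, ← intervalIntegral.integral_neg]
  congr 1
  funext t
  simp only [Complex.imCLM_apply]
  rw [Complex.im_ofReal_mul, im_cos_wf]
  ring

theorem abs_sinh_le {x c : ℝ} (h : |x| ≤ c) : |Real.sinh x| ≤ Real.sinh c := by
  rw [Real.abs_sinh]
  exact Real.sinh_le_sinh.2 h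

theorem v0_over {t : ℝ} (h0 : π ≤ t) (h1 : t ≤ 3.15) : |v0 t| ≤ 0.01438 := by
  have hh : |v0 t - v0 π| ≤ 1.71 * |t - π| := by
    have := Convex.norm_image_sub_le_of_norm_hasDerivWithin_le (f := v0) (f' := v1) (s := Set.Ici 0) (x := π) (y := t) (C := 1.71)
      (fun x _ => (hasDerivAt_v0 x).hasDerivWithinAt) (fun x hx => v1_abs hx) (convex_Ici 0) Real.pi_pos.le (Real.pi_pos.le.trans h0)
    simpa using this
  rw [v0_pi, sub_zero, abs_of_nonneg (sub_nonneg.2 h0)] at hh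
  have := Real.pi_gt_d6
  linarith

theorem Fr_over {h y : ℝ} (hh : 0 ≤ h) (hh1 : h ≤ 1.25) (hy0 : 0 ≤ y) (hy : y ≤ 8) :
    |Fr h y| ≤ |(FI h y 3.15).im| + 0.00032 * y := by
  have e : ∫ t in (0:ℝ)..3.15, x1 t * ph h y t = Fr h y + ∫ t in π..3.15, x1 t * ph h y t := by
    unfold Fr
    rw [intervalIntegral.integral_add_adjacent_intervals] <;> exact (cont_ph h y).intervalIntegrable _ _
  have hpi := Real.pi_gt_d6
  have hpi2 := Real.pi_lt_d2
  have hb : ‖∫ t in π..3.15, x1 t * ph h y t‖ ≤ 2.01 * (0.0182 * y) * |3.15 - π| := by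
    apply intervalIntegral.norm_integral_le_of_norm_le_const
    intro t ht
    rw [Set.uIoc_of_le hpi2.le] at ht
    have h1 := x1_abs (by linarith [ht.1]) ht.2
    have h2 := v0_over ht.1.le ht.2
    have h3 : |ph h y t| ≤ 0.0182 * y := by
      unfold ph
      rw [abs_mul]
      have h4 : |y * (h * v0 t)| ≤ 0.017975 * y := by
        rw [abs_mul, abs_mul, abs_of_nonneg hy0, abs_of_nonneg hh]
        have : h * |v0 t| ≤ 1.25 * 0.01438 := by gcongr
        nlinarith
      have h5 := (abs_sinh_le h4).trans (sinh_le_mul_cosh (by positivity))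
      have h6 : Real.cosh (0.017975 * y) ≤ 1.0105 := by
        have h7 : |0.017975 * y| ≤ |(0.1438:ℝ)| := by
          rw [abs_of_nonneg (by positivity), abs_of_pos (by norm_num)]; linarith
        refine (Real.cosh_le_cosh.2 h7).trans ?_
        refine (Real.cosh_le_exp_half_sq _).trans ?_
        have h8 := Real.exp_bound' (x := (0.1438:ℝ) ^ 2 / 2) (by norm_num) (by norm_num) (n := 3) (by norm_num)
        refine h8.trans ?_
        norm_num [Finset.sum_range_succ, Nat.factorial]
      have h9 : |Real.sin (z₁ t * y)| ≤ 1 := Real.abs_sin_le_one _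
      calc |Real.sin (z₁ t * y)| * |Real.sinh (y * (h * v0 t))| ≤ 1 * (0.017975 * y * 1.0105) := by
            apply mul_le_mul h9 (h5.trans _) (abs_nonneg _) zero_le_one
            gcongr
        _ ≤ _ := by nlinarith
    rw [Real.norm_eq_abs, abs_mul]
    gcongr
  rw [Real.norm_eq_abs] at hb
  rw [FI_im, abs_neg, e]
  have h1 : |3.15 - π| ≤ 0.00841 := by
    rw [abs_of_nonneg (by linarith)]; linarith
  have h2 : 2.01 * (0.0182 * y) * |3.15 - π| ≤ 2.01 * (0.0182 * y) * 0.00841 := by gcongr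
  have h3 := abs_sub_abs_le_abs_sub (Fr h y) (-(∫ t in π..3.15, x1 t * ph h y t))
  rw [abs_neg, sub_neg_eq_add] at h3
  nlinarith

/-- derivatives in `h` -/
theorem ph_h {z v y h0 h1 h c : ℝ} (h01 : h0 < h1) (hh : h ∈ Set.Icc h0 h1) (h00 : 0 ≤ h0) (hy : 0 ≤ y) (hv : |v| ≤ c) :
    |Real.sin (z * y) * Real.sinh (y * (h * v)) - ((h1 - h) / (h1 - h0) * (Real.sin (z * y) * Real.sinh (y * (h0 * v)))
      + (h - h0) / (h1 - h0) * (Real.sin (z * y) * Real.sinh (y * (h1 * v))))| ≤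
      (y * c) ^ 2 * Real.cosh (y * (h1 * c)) * (h1 - h0) ^ 2 / 8 := by
  have hd : ∀ t : ℝ, HasDerivAt (fun t : ℝ => y * (t * v)) (y * v) t := fun t => by
    simpa using ((hasDerivAt_id t).mul_const v).const_mul y
  refine interp_bound (f := fun h => Real.sin (z * y) * Real.sinh (y * (h * v)))
    (f1 := fun h => Real.sin (z * y) * (Real.cosh (y * (h * v)) * (y * v)))
    (f2 := fun h => Real.sin (z * y) * (Real.sinh (y * (h * v)) * (y * v) * (y * v))) h01
    (fun t => (((Real.hasDerivAt_sinh _).comp t (hd t)).const_mul _))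
    (fun t => ((((Real.hasDerivAt_cosh _).comp t (hd t)).mul_const _).const_mul _)) ?_ hh
  intro t ht
  have hc : 0 ≤ c := (abs_nonneg v).trans hv
  have ht0 : 0 ≤ t := h00.trans ht.1
  have h1' : |y * (t * v)| ≤ y * (h1 * c) := by
    rw [abs_mul, abs_mul, abs_of_nonneg hy, abs_of_nonneg ht0]
    have := ht.2
    have := ht0.trans ht.2
    gcongr
  have h2 := (abs_sinh_le h1').trans (Real.sinh_lt_cosh _).le
  have h3 : |Real.sin (z * y)| ≤ 1 := Real.abs_sin_le_one _
  have h4 : |y * v| ≤ y * c := by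
    rw [abs_mul, abs_of_nonneg hy]; gcongr
  rw [abs_mul, abs_mul, abs_mul]
  have hch := Real.cosh_pos (y * (h1 * c))
  calc |Real.sin (z * y)| * (|Real.sinh (y * (t * v))| * |y * v| * |y * v|)
      ≤ 1 * (Real.cosh (y * (h1 * c)) * (y * c) * (y * c)) := by gcongr
    _ = _ := by ring

theorem ph_dd (z p y : ℝ) : |(p ^ 2 - z ^ 2) * (Real.sin (z * y) * Real.sinh (y * p)) + 2 * z * p * (Real.cos (z * y) * Real.cosh (y * p))|
    ≤ (z ^ 2 + p ^ 2) * Real.cosh (y * p) := by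
  have e : ((z : ℂ) + p * Complex.I) ^ 2 * Complex.cos (((z * y : ℝ) : ℂ) + ((y * p : ℝ) : ℂ) * Complex.I)
    = (((z ^ 2 - p ^ 2) * (Real.cos (z * y) * Real.cosh (y * p)) + 2 * z * p * (Real.sin (z * y) * Real.sinh (y * p)) : ℝ) : ℂ)
     + (((p ^ 2 - z ^ 2) * (Real.sin (z * y) * Real.sinh (y * p)) + 2 * z * p * (Real.cos (z * y) * Real.cosh (y * p)) : ℝ) : ℂ) * Complex.I := by
    rw [Complex.cos_add_mul_I, ← Complex.ofReal_cos, ← Complex.ofReal_cosh, ← Complex.ofReal_sin, ← Complex.ofReal_sinh]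
    apply Complex.ext <;> simp [pow_two] <;> ring
  have h1 := Complex.abs_im_le_norm (((z : ℂ) + p * Complex.I) ^ 2 * Complex.cos (((z * y : ℝ) : ℂ) + ((y * p : ℝ) : ℂ) * Complex.I))
  have h2 := norm_cos_le (((z * y : ℝ) : ℂ) + ((y * p : ℝ) : ℂ) * Complex.I)
  have h3 : (((z * y : ℝ) : ℂ) + ((y * p : ℝ) : ℂ) * Complex.I).im = y * p := by simp
  rw [h3] at h2
  have h4 : ‖((z : ℂ) + p * Complex.I)‖ ^ 2 = z ^ 2 + p ^ 2 := by
    rw [← Complex.normSq_eq_norm_sq]; simp [Complex.normSq_apply]; ring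
  rw [norm_mul, norm_pow, h4, e] at h1
  refine le_trans (le_of_eq ?_) (h1.trans (mul_le_mul_of_nonneg_left h2 (by positivity)))
  congr 1
  rw [Complex.add_im, Complex.ofReal_im, Complex.im_ofReal_mul, Complex.I_im]
  ring

theorem ph_y {z v h y0 y1 y c : ℝ} (h01 : y0 < y1) (hh : y ∈ Set.Icc y0 y1) (h00 : 0 ≤ y0) (hy : 0 ≤ h) (hv : h * |v| ≤ c) :
    |Real.sin (z * y) * Real.sinh (y * (h * v)) - ((y1 - y) / (y1 - y0) * (Real.sin (z * y0) * Real.sinh (y0 * (h * v)))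
      + (y - y0) / (y1 - y0) * (Real.sin (z * y1) * Real.sinh (y1 * (h * v))))| ≤
      (z ^ 2 + c ^ 2) * Real.cosh (y1 * c) * (y1 - y0) ^ 2 / 8 := by
  have hd : ∀ t : ℝ, HasDerivAt (fun t : ℝ => t * (h * v)) (h * v) t := fun t => by
    simpa using ((hasDerivAt_id t).mul_const (h * v))
  have hz : ∀ t : ℝ, HasDerivAt (fun t : ℝ => z * t) z t := fun t => by
    simpa using ((hasDerivAt_id t).const_mul z)
  have hs := fun t => (Real.hasDerivAt_sin (z * t)).comp t (hz t)
  have hc := fun t => (Real.hasDerivAt_cos (z * t)).comp t (hz t)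
  have hsh := fun t => (Real.hasDerivAt_sinh (t * (h * v))).comp t (hd t)
  have hch := fun t => (Real.hasDerivAt_cosh (t * (h * v))).comp t (hd t)
  refine interp_bound (f := fun y => Real.sin (z * y) * Real.sinh (y * (h * v)))
    (f1 := fun y => Real.cos (z * y) * z * Real.sinh (y * (h * v)) + Real.sin (z * y) * (Real.cosh (y * (h * v)) * (h * v)))
    (f2 := fun y => ((h * v) ^ 2 - z ^ 2) * (Real.sin (z * y) * Real.sinh (y * (h * v))) + 2 * z * (h * v) * (Real.cos (z * y) * Real.cosh (y * (h * v)))) h01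
    (fun t => (hs t).mul (hsh t))
    (fun t => ((((hc t).mul_const z).mul (hsh t)).add ((hs t).mul ((hch t).mul_const (h * v)))).congr_deriv (by
      simp only [Function.comp]; ring)) ?_ hh
  intro t ht
  refine (ph_dd z (h * v) t).trans ?_
  have ht0 : 0 ≤ t := h00.trans ht.1
  have hv' : |h * v| ≤ c := by rw [abs_mul, abs_of_nonneg hy]; exact hv
  have hc0 : 0 ≤ c := (abs_nonneg _).trans hv'
  have h1 : (h * v) ^ 2 ≤ c ^ 2 := sq_le_sq' (by linarith [neg_abs_le (h * v)]) ((le_abs_self _).trans hv')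
  have h2 : Real.cosh (t * (h * v)) ≤ Real.cosh (y1 * c) := by
    apply Real.cosh_le_cosh.2
    rw [abs_mul, abs_of_nonneg ht0, abs_of_nonneg (mul_nonneg (ht0.trans ht.2) hc0)]
    have := ht.2
    have := ht0.trans ht.2
    gcongr
  gcongr

theorem comb4 {φ a0 a1 b0 b1 d0 d1 l m s r e1 e2 : ℝ} (hl : 0 ≤ l) (hm : 0 ≤ m) (hlm : l + m = 1)
    (H : |φ - (l * a0 + m * a1)| ≤ e1) (H0 : |a0 - (s * b0 + r * d0)| ≤ e2) (H1 : |a1 - (s * b1 + r * d1)| ≤ e2) :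
    |φ - (l * (s * b0 + r * d0) + m * (s * b1 + r * d1))| ≤ e1 + e2 := by
  have e : φ - (l * (s * b0 + r * d0) + m * (s * b1 + r * d1))
    = (φ - (l * a0 + m * a1)) + (l * (a0 - (s * b0 + r * d0)) + m * (a1 - (s * b1 + r * d1))) := by ring
  rw [e]
  have h1 : |l * (a0 - (s * b0 + r * d0))| ≤ l * e2 := by
    rw [abs_mul, abs_of_nonneg hl]; gcongr
  have h2 : |m * (a1 - (s * b1 + r * d1))| ≤ m * e2 := by
    rw [abs_mul, abs_of_nonneg hm]; gcongr
  have h3 := abs_add_le (φ - (l * a0 + m * a1)) (l * (a0 - (s * b0 + r * d0)) + m * (a1 - (s * b1 + r * d1)))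
  have h4 := abs_add_le (l * (a0 - (s * b0 + r * d0))) (m * (a1 - (s * b1 + r * d1)))
  have h5 : l * e2 + m * e2 = e2 := by rw [← add_mul, hlm, one_mul]
  linarith

theorem int_x1 : ∫ t in (0:ℝ)..π, x1 t = π := by
  rw [intervalIntegral.integral_eq_sub_of_hasDerivAt (fun t _ => hasDerivAt_z1 t) (cont_x1.intervalIntegrable _ _), z1_zero]
  simp [z₁]

theorem int_x1z : ∫ t in (0:ℝ)..π, x1 t * z₁ t ^ 2 = π ^ 3 / 3 := by
  have h : ∀ t ∈ Set.uIcc 0 π, HasDerivAt (fun t => z₁ t ^ 3 / 3) (x1 t * z₁ t ^ 2) t := fun t _ => by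
    refine HasDerivAt.congr_deriv (f := fun t => z₁ t ^ 3 / 3) (((hasDerivAt_z1 t).pow 3).div_const 3) ?_
    push_cast; ring
  have c : Continuous fun t => x1 t * z₁ t ^ 2 := cont_x1.mul (cont_z1.pow 2)
  rw [intervalIntegral.integral_eq_sub_of_hasDerivAt h (c.intervalIntegrable _ _), z1_zero]
  simp [z₁]

theorem Fr_interp {h0 h1 h y0 y1 y A B : ℝ} (h01 : h0 < h1) (hh : h ∈ Set.Icc h0 h1) (h00 : 0 ≤ h0)
    (y01 : y0 < y1) (hy : y ∈ Set.Icc y0 y1) (y00 : 0 ≤ y0)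
    (A0 : |Fr h0 y0| ≤ A) (A1 : |Fr h1 y0| ≤ A) (B0 : |Fr h0 y1| ≤ B) (B1 : |Fr h1 y1| ≤ B) :
    |Fr h y| ≤ (y1 - y) / (y1 - y0) * A + (y - y0) / (y1 - y0) * B
      + ((y1 * 0.71) ^ 2 * π * (h1 - h0) ^ 2 + (π ^ 3 / 3 + (0.71 * h1) ^ 2 * π) * (y1 - y0) ^ 2) / 8 * Real.cosh (y1 * (0.71 * h1)) := by
  set l := (h1 - h) / (h1 - h0) with hl
  set m := (h - h0) / (h1 - h0) with hm
  set s := (y1 - y) / (y1 - y0) with hs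
  set r := (y - y0) / (y1 - y0) with hr
  have dh : 0 < h1 - h0 := sub_pos.2 h01
  have dy : 0 < y1 - y0 := sub_pos.2 y01
  have hl0 : 0 ≤ l := div_nonneg (sub_nonneg.2 hh.2) dh.le
  have hm0 : 0 ≤ m := div_nonneg (sub_nonneg.2 hh.1) dh.le
  have hs0 : 0 ≤ s := div_nonneg (sub_nonneg.2 hy.2) dy.le
  have hr0 : 0 ≤ r := div_nonneg (sub_nonneg.2 hy.1) dy.le
  have hlm : l + m = 1 := by rw [hl, hm, ← add_div, div_eq_one_iff_eq dh.ne']; ring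
  have hsr : s + r = 1 := by rw [hs, hr, ← add_div, div_eq_one_iff_eq dy.ne']; ring
  have y10 : 0 ≤ y := y00.trans hy.1
  have h10 : 0 ≤ h1 := h00.trans h01.le
  set C := Real.cosh (y1 * (0.71 * h1)) with hC
  set ψ : ℝ → ℝ := fun t => l * (s * ph h0 y0 t + r * ph h0 y1 t) + m * (s * ph h1 y0 t + r * ph h1 y1 t) with hψ
  have key : ∀ t ∈ Set.Ioc 0 π, ‖x1 t * ph h y t - x1 t * ψ t‖ ≤
      ((y1 * 0.71) ^ 2 * (h1 - h0) ^ 2 + (0.71 * h1) ^ 2 * (y1 - y0) ^ 2) / 8 * C * x1 t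
        + (y1 - y0) ^ 2 / 8 * C * (x1 t * z₁ t ^ 2) := by
    intro t ht
    have hv := v0_abs ht.1.le
    have k1 := ph_h (z := z₁ t) (v := v0 t) (y := y) (c := 0.71) h01 hh h00 y10 hv
    have hb : ∀ h', 0 ≤ h' → h' ≤ h1 → h' * |v0 t| ≤ 0.71 * h1 := fun h' a b => by
      rw [mul_comm (0.71:ℝ)]; gcongr
    have k2 := ph_y (z := z₁ t) (v := v0 t) (h := h0) (c := 0.71 * h1) y01 hy y00 h00 (hb _ h00 h01.le)
    have k3 := ph_y (z := z₁ t) (v := v0 t) (h := h1) (c := 0.71 * h1) y01 hy y00 h10 (hb _ h10 le_rfl)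
    have k4 := comb4 hl0 hm0 hlm k1 k2 k3
    have k5 : (y * 0.71) ^ 2 * Real.cosh (y * (h1 * 0.71)) * (h1 - h0) ^ 2 / 8 ≤ (y1 * 0.71) ^ 2 * C * (h1 - h0) ^ 2 / 8 := by
      have hc : Real.cosh (y * (h1 * 0.71)) ≤ C := by
        apply Real.cosh_le_cosh.2
        rw [mul_comm h1, abs_of_nonneg (by positivity), abs_of_nonneg (by have := y10.trans hy.2; positivity)]
        have := hy.2
        gcongr
      have := hy.2
      have := (Real.cosh_pos (y * (h1 * 0.71))).le
      gcongr
    have hx := x1_nonneg ht.1.le ht.2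
    rw [← mul_sub, norm_mul, Real.norm_eq_abs, Real.norm_eq_abs, abs_of_nonneg hx]
    calc x1 t * |ph h y t - ψ t| ≤ x1 t * ((y1 * 0.71) ^ 2 * C * (h1 - h0) ^ 2 / 8 + (z₁ t ^ 2 + (0.71 * h1) ^ 2) * C * (y1 - y0) ^ 2 / 8) := by
          apply mul_le_mul_of_nonneg_left _ hx
          exact k4.trans (add_le_add k5 le_rfl)
      _ = _ := by ring
  have I1 := (cont_ph h y).intervalIntegrable (μ := volume) 0 π
  have i00 := (cont_ph h0 y0).intervalIntegrable (μ := volume) 0 π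
  have i01 := (cont_ph h0 y1).intervalIntegrable (μ := volume) 0 π
  have i10 := (cont_ph h1 y0).intervalIntegrable (μ := volume) 0 π
  have i11 := (cont_ph h1 y1).intervalIntegrable (μ := volume) 0 π
  have eψ : (fun t => x1 t * ψ t) = fun t => (l * s) * (x1 t * ph h0 y0 t) + (l * r) * (x1 t * ph h0 y1 t)
     + ((m * s) * (x1 t * ph h1 y0 t) + (m * r) * (x1 t * ph h1 y1 t)) := by
    funext t; simp only [hψ]; ring
  have j1 := ((i00.const_mul (l * s)).add (i01.const_mul (l * r)))
  have j2 := ((i10.const_mul (m * s)).add (i11.const_mul (m * r)))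
  have I2 : IntervalIntegrable (fun t => x1 t * ψ t) volume 0 π := by
    rw [eψ]; exact j1.add j2
  have eI : ∫ t in (0:ℝ)..π, x1 t * ψ t = (l * s) * Fr h0 y0 + (l * r) * Fr h0 y1 + ((m * s) * Fr h1 y0 + (m * r) * Fr h1 y1) := by
    rw [eψ, intervalIntegral.integral_add j1 j2, intervalIntegral.integral_add (i00.const_mul (l * s)) (i01.const_mul (l * r)),
      intervalIntegral.integral_add (i10.const_mul (m * s)) (i11.const_mul (m * r))]
    simp only [intervalIntegral.integral_const_mul]
    rfl
  have cx := cont_x1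
  have cz := cont_z1
  have ib : IntervalIntegrable (fun t => ((y1 * 0.71) ^ 2 * (h1 - h0) ^ 2 + (0.71 * h1) ^ 2 * (y1 - y0) ^ 2) / 8 * C * x1 t
        + (y1 - y0) ^ 2 / 8 * C * (x1 t * z₁ t ^ 2)) volume 0 π := by
    apply Continuous.intervalIntegrable
    fun_prop
  have N := intervalIntegral.norm_integral_le_of_norm_le Real.pi_pos.le (Filter.Eventually.of_forall key) ib
  rw [intervalIntegral.integral_sub I1 I2, eI, intervalIntegral.integral_add
    ((by fun_prop : Continuous fun t => ((y1 * 0.71) ^ 2 * (h1 - h0) ^ 2 + (0.71 * h1) ^ 2 * (y1 - y0) ^ 2) / 8 * C * x1 t).intervalIntegrable _ _)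
    ((by fun_prop : Continuous fun t => (y1 - y0) ^ 2 / 8 * C * (x1 t * z₁ t ^ 2)).intervalIntegrable _ _),
    intervalIntegral.integral_const_mul, intervalIntegral.integral_const_mul, int_x1, int_x1z, Real.norm_eq_abs] at N
  change |Fr h y - _| ≤ _ at N
  have q : ∀ {u x X : ℝ}, 0 ≤ u → |x| ≤ X → u * x ≤ u * X ∧ -(u * X) ≤ u * x := fun {u x X} hu hx =>
    ⟨by have := (abs_le.1 hx).2; gcongr, by
      have := mul_le_mul_of_nonneg_left (abs_le.1 hx).1 hu
      linarith⟩
  have q1 := q (mul_nonneg hl0 hs0) A0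
  have q2 := q (mul_nonneg hl0 hr0) B0
  have q3 := q (mul_nonneg hm0 hs0) A1
  have q4 := q (mul_nonneg hm0 hr0) B1
  have e1 : l * s * A + m * s * A = s * A := by rw [← add_mul, ← add_mul, hlm, one_mul]
  have e2 : l * r * B + m * r * B = r * B := by rw [← add_mul, ← add_mul, hlm, one_mul]
  rw [abs_le] at N ⊢
  obtain ⟨N1, N2⟩ := N
  constructor <;> linarith [q1.1, q1.2, q2.1, q2.2, q3.1, q3.2, q4.1, q4.2]

noncomputable def br (h y : ℝ) : ℝ :=
  y * Real.cosh (y * (π / 2 - h)) - Real.sinh (y * h) / Real.tan h / Real.cosh (y * π / 2)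

noncomputable def Gx (h y : ℝ) : ℝ :=
  Real.cosh (y * (π / 2 - h)) / (Real.sinh (y * (π / 2 - h)) * Real.cosh (y * (π / 2 + h))) * br h y

theorem br_nonneg {h y : ℝ} (hh : 0 < h) (hh1 : h < π / 2) (hy : 0 < y) : 0 ≤ br h y := by
  unfold br
  have h1 := (Real.lt_tan hh hh1).le
  have h2 := sinh_le_mul_cosh (mul_pos hy hh).le
  have hc := Real.cosh_pos (y * π / 2)
  have h3 : Real.cosh (y * h) ≤ Real.cosh (y * π / 2) := by
    apply Real.cosh_le_cosh.2
    rw [abs_of_pos (by positivity), abs_of_pos (by positivity)]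
    nlinarith
  have h4 := Real.one_le_cosh (y * (π / 2 - h))
  have h5 : 0 ≤ Real.sinh (y * h) := Real.sinh_nonneg_iff.2 (by positivity)
  have h6 : Real.sinh (y * h) / Real.tan h ≤ y * Real.cosh (y * π / 2) := by
    calc Real.sinh (y * h) / Real.tan h ≤ Real.sinh (y * h) / h := by gcongr
      _ ≤ y * Real.cosh (y * h) := by
        rw [div_le_iff₀ hh]; linarith
      _ ≤ _ := by gcongr
  have h7 : Real.sinh (y * h) / Real.tan h / Real.cosh (y * π / 2) ≤ y := by
    rw [div_le_iff₀ hc]; exact h6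
  nlinarith

theorem AB_eq (h y : ℝ) : Real.sinh (π * y) - Real.sinh (2 * h * y)
    = 2 * (Real.sinh (y * (π / 2 - h)) * Real.cosh (y * (π / 2 + h))) := by
  have e1 : π * y = y * (π / 2 + h) + y * (π / 2 - h) := by ring
  have e2 : 2 * h * y = y * (π / 2 + h) - y * (π / 2 - h) := by ring
  rw [e1, e2, Real.sinh_add, Real.sinh_sub]; ring

noncomputable def gI (h K y γ : ℝ) : ℝ :=
      deriv (z₂ h) γ * Real.cos (z₁ γ * y) /
          ((Real.sinh (π * y) + K * Real.sinh (2 * h * y)) *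
            Real.cosh (y * π / 2)) *
        (2 * y * Real.cosh (y * π / 2 - y * h) * Real.cosh (y * π / 2) -
          2 * Real.sinh (y * h) / Real.tan h) *
        Real.cosh (y * z₂ h γ) * Real.cosh (y * (π / 2 - h))

noncomputable def Kf (h K y : ℝ) : ℝ :=
  1 / ((Real.sinh (π * y) + K * Real.sinh (2 * h * y)) * Real.cosh (y * π / 2)) *
        (2 * y * Real.cosh (y * π / 2 - y * h) * Real.cosh (y * π / 2) -
          2 * Real.sinh (y * h) / Real.tan h) * Real.cosh (y * (π / 2 - h))

theorem Kf_bound {h K y : ℝ} (hh : 0 < h) (hh1 : h < π / 2) (hK : -1 < K) (hK1 : K < 1) (hy : 0 < y) :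
    |K * Kf h K y| ≤ Gx h y := by
  have hb := br_nonneg hh hh1 hy
  set A := Real.sinh (π * y) with hA
  set B := Real.sinh (2 * h * y) with hB
  have hAB := AB_eq h y
  rw [← hA, ← hB] at hAB
  have hS : 0 < Real.sinh (y * (π / 2 - h)) := Real.sinh_pos_iff.2 (mul_pos hy (by linarith))
  have hc1 := Real.cosh_pos (y * (π / 2 + h))
  have hc2 := Real.cosh_pos (y * (π / 2 - h))
  have hc3 := Real.cosh_pos (y * π / 2)
  have hB0 : 0 < B := Real.sinh_pos_iff.2 (by positivity)
  set S := Real.sinh (y * (π / 2 - h)) * Real.cosh (y * (π / 2 + h)) with hSd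
  have hS0 : 0 < S := mul_pos hS hc1
  have hA0 : 0 < A := by linarith
  have hD : 0 < A + K * B := by nlinarith
  have hK2 : |K| * (A - B) ≤ A + K * B := by
    rcases abs_cases K with ⟨h1, h2⟩ | ⟨h1, h2⟩ <;> rw [h1] <;> nlinarith
  have e : K * Kf h K y = K * (2 * (br h y * Real.cosh (y * (π / 2 - h)))) / (A + K * B) := by
    unfold Kf br
    rw [← hA, ← hB]
    have : y * π / 2 - y * h = y * (π / 2 - h) := by ring
    rw [this]
    field_simp
  rw [e, abs_div, abs_mul, abs_of_pos hD, abs_of_nonneg (a := 2 * _) (by positivity), div_le_iff₀ hD]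
  unfold Gx
  rw [← hSd, div_mul_eq_mul_div, div_mul_eq_mul_div, le_div_iff₀ hS0]
  have : |K| * (2 * S) ≤ A + K * B := by rw [← hAB]; exact hK2
  have hp : 0 ≤ br h y * Real.cosh (y * (π / 2 - h)) := by positivity
  nlinarith [mul_le_mul_of_nonneg_right this hp]

theorem ibp (h : ℝ) {y : ℝ} (hy : 0 < y) :
    ∫ γ in (0:ℝ)..π, h * v1 γ * Real.cos (z₁ γ * y) * Real.cosh (y * (h * v0 γ)) = Fr h y := by
  have hd : ∀ t ∈ Set.uIcc 0 π, HasDerivAt (fun t => Real.cos (z₁ t * y) * (Real.sinh (y * (h * v0 t)) / y))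
      (h * v1 t * Real.cos (z₁ t * y) * Real.cosh (y * (h * v0 t)) - x1 t * ph h y t) t := by
    intro t _
    have h1 := (Real.hasDerivAt_cos (z₁ t * y)).comp t ((hasDerivAt_z1 t).mul_const y)
    have h2 := ((Real.hasDerivAt_sinh (y * (h * v0 t))).comp t (((hasDerivAt_v0 t).const_mul h).const_mul y)).div_const y
    refine (h1.mul h2).congr_deriv ?_
    simp only [Function.comp, ph]
    field_simp
    ring
  have cv := cont_v1
  have cv0 := cont_v0
  have cz := cont_z1
  have i1 : IntervalIntegrable (fun t => h * v1 t * Real.cos (z₁ t * y) * Real.cosh (y * (h * v0 t))) volume 0 π := by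
    apply Continuous.intervalIntegrable; fun_prop
  have i2 := (cont_ph h y).intervalIntegrable (μ := volume) 0 π
  have := intervalIntegral.integral_eq_sub_of_hasDerivAt hd (i1.sub i2)
  rw [intervalIntegral.integral_sub i1 i2, v0_pi, v0_zero] at this
  simp only [mul_zero, Real.sinh_zero, zero_div, sub_zero] at this
  unfold Fr
  linarith

theorem inner_eq {h K y : ℝ} (hy : 0 < y) : ∫ γ in Set.Ioi (0:ℝ), gI h K y γ = Kf h K y * Fr h y := by
  have h1 : ∫ γ in Set.Ioi (0:ℝ), gI h K y γ = ∫ γ in Set.Ioc (0:ℝ) π, gI h K y γ := by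
    apply setIntegral_eq_of_subset_of_forall_sdiff_eq_zero measurableSet_Ioi Set.Ioc_subset_Ioi_self
    intro γ hγ
    have h2 : 0 < γ := hγ.1
    have h3 : π < γ := by
      by_contra hc
      exact hγ.2 ⟨h2, not_lt.1 hc⟩
    unfold gI
    rw [deriv_z2_zero (by rwa [abs_of_pos h2])]
    simp
  rw [h1, integral_Ioc_eq_integral_Ioo, ← ibp h hy, intervalIntegral.integral_of_le Real.pi_pos.le,
    integral_Ioc_eq_integral_Ioo, ← integral_const_mul]
  apply setIntegral_congr_fun measurableSet_Ioo
  intro γ hγ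
  have h2 : |γ| < π := by rw [abs_of_pos hγ.1]; exact hγ.2
  simp only [gI, Kf]
  rw [deriv_z2 h2, z2_eq h2.le]
  ring

theorem I2_form {h K : ℝ} (hh : 0 < h) (hh1 : h < π / 2) (hK : -1 < K) (hK1 : K < 1) :
    ∃ Φ : ℝ → ℝ, IntegrableOn Φ (Set.Ioi 0) ∧ (∀ y, 0 < y → |Φ y| ≤ Gx h y * |Fr h y|) ∧
      I₂ h K = 4 * deriv (z₂ h) 0 * ∫ y in Set.Ioi 0, Φ y := by
  by_cases hi : IntegrableOn (fun p : ℝ × ℝ => gI h K p.1 p.2) (Set.Ioi (0 : ℝ) ×ˢ Set.Ioi (0 : ℝ))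
  · refine ⟨fun y => K * Kf h K y * Fr h y, ?_, ?_, ?_⟩
    · have h1 : Integrable (fun p : ℝ × ℝ => gI h K p.1 p.2) ((volume.restrict (Set.Ioi 0)).prod (volume.restrict (Set.Ioi 0))) := by
        rw [Measure.prod_restrict, ← Measure.volume_eq_prod]; exact hi
      have h2 := h1.integral_prod_left.const_mul K
      refine IntegrableOn.congr_fun (f := fun x => K * ∫ y in Set.Ioi 0, gI h K x y) h2 ?_ measurableSet_Ioi
      intro y hy
      simp only
      rw [inner_eq hy]; ring
    · intro y hy
      rw [abs_mul]
      exact mul_le_mul_of_nonneg_right (Kf_bound hh hh1 hK hK1 hy) (abs_nonneg _)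
    · have h3 := setIntegral_prod (μ := volume) (ν := volume) (fun p : ℝ × ℝ => gI h K p.1 p.2) hi
      have h4 : I₂ h K = 4 * deriv (z₂ h) 0 * K * ∫ p in Set.Ioi (0 : ℝ) ×ˢ Set.Ioi (0 : ℝ), gI h K p.1 p.2 := rfl
      rw [h4, Measure.volume_eq_prod, h3]
      have h5 : ∫ x in Set.Ioi (0:ℝ), ∫ y in Set.Ioi (0:ℝ), gI h K x y = ∫ x in Set.Ioi (0:ℝ), Kf h K x * Fr h x :=
        setIntegral_congr_fun measurableSet_Ioi fun x hx => inner_eq hx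
      have h6 : ∫ y in Set.Ioi (0:ℝ), K * Kf h K y * Fr h y = K * ∫ x in Set.Ioi (0:ℝ), Kf h K x * Fr h x := by
        rw [← integral_const_mul]; congr 1; funext x; ring
      rw [h5, h6]; ring
  · refine ⟨fun _ => 0, integrableOn_zero, ?_, ?_⟩
    · intro y hy
      rw [abs_zero]
      exact mul_nonneg ((abs_nonneg _).trans (Kf_bound hh hh1 hK hK1 hy)) (abs_nonneg _)
    · have h4 : I₂ h K = 4 * deriv (z₂ h) 0 * K * ∫ p in Set.Ioi (0 : ℝ) ×ˢ Set.Ioi (0 : ℝ), gI h K p.1 p.2 := rfl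
      rw [h4, integral_undef hi]
      simp

theorem nonneg_of_der {f f' : ℝ → ℝ} (hd : ∀ x, HasDerivAt f (f' x) x) (hn : ∀ x, 0 < x → 0 ≤ f' x) (h0 : f 0 = 0)
    {x : ℝ} (hx : 0 ≤ x) : 0 ≤ f x := by
  have : MonotoneOn f (Set.Ici 0) := by
    apply monotoneOn_of_deriv_nonneg (convex_Ici 0)
    · exact fun x _ => (hd x).continuousAt.continuousWithinAt
    · exact fun x _ => (hd x).differentiableAt.differentiableWithinAt
    · intro x hx
      rw [interior_Ici] at hx
      rw [(hd x).deriv]; exact hn x hx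
  rw [← h0]
  exact this Set.self_mem_Ici hx hx

theorem sinh_cubic {x : ℝ} (hx : 0 ≤ x) : x + x ^ 3 / 6 ≤ Real.sinh x := by
  have h1 : ∀ x : ℝ, 0 ≤ x → 0 ≤ Real.sinh x - x := fun x hx =>
    nonneg_of_der (f := fun x => Real.sinh x - x) (fun x => (Real.hasDerivAt_sinh x).sub (hasDerivAt_id x))
      (fun x _ => sub_nonneg.2 (Real.one_le_cosh x)) (by simp) hx
  have h2 : ∀ x : ℝ, 0 ≤ x → 0 ≤ Real.cosh x - (1 + x ^ 2 / 2) := fun x hx =>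
    nonneg_of_der (f := fun x => Real.cosh x - (1 + x ^ 2 / 2)) (f' := fun x => Real.sinh x - x)
      (fun x => by
        refine HasDerivAt.congr_deriv (f := fun x => Real.cosh x - (1 + x ^ 2 / 2)) ((Real.hasDerivAt_cosh x).sub (((hasDerivAt_pow 2 x).div_const 2).const_add 1)) ?_
        push_cast; ring)
      (fun x hx => h1 x hx.le) (by simp) hx
  have h3 := nonneg_of_der (f := fun x => Real.sinh x - (x + x ^ 3 / 6)) (f' := fun x => Real.cosh x - (1 + x ^ 2 / 2))
      (fun x => by
        refine HasDerivAt.congr_deriv (f := fun x => Real.sinh x - (x + x ^ 3 / 6)) ((Real.hasDerivAt_sinh x).sub ((hasDerivAt_id x).add ((hasDerivAt_pow 3 x).div_const 6))) ?_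
        push_cast; ring)
      (fun x hx => h2 x hx.le) (by simp) hx
  exact sub_nonneg.1 h3

theorem sinh_ratio {u v : ℝ} (hu : 0 ≤ u) (huv : u ≤ v) : v * Real.sinh u ≤ u * Real.sinh v := by
  rcases hu.eq_or_lt with h0 | h0
  · rw [← h0]; simp
  have hd : ∀ (x : ℝ), HasDerivAt (fun x => Real.sinh (v / u * x) - v / u * Real.sinh x) (v / u * (Real.cosh (v / u * x) - Real.cosh x)) x := by
    intro x
    have h1 : HasDerivAt (fun x : ℝ => v / u * x) (v / u) x := by simpa using (hasDerivAt_id x).const_mul (v / u)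
    refine (((Real.hasDerivAt_sinh (v / u * x)).comp x h1).sub ((Real.hasDerivAt_sinh x).const_mul (v / u))).congr_deriv ?_
    ring
  have hr : 1 ≤ v / u := (one_le_div h0).2 huv
  have h3 := nonneg_of_der hd (fun x hx => by
    refine mul_nonneg (by linarith) (sub_nonneg.2 (Real.cosh_le_cosh.2 ?_))
    rw [abs_of_pos hx, abs_of_pos (by positivity)]
    nlinarith) (by simp) hu
  have e : v / u * u = v := by field_simp
  rw [e] at h3
  have h4 : v / u * Real.sinh u ≤ Real.sinh v := by linarith
  have h5 := mul_le_mul_of_nonneg_left h4 hu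
  calc v * Real.sinh u = u * (v / u * Real.sinh u) := by field_simp
    _ ≤ _ := h5

/-- `t coth t` is increasing -/
theorem coth_mono {s t : ℝ} (hs : 0 < s) (hst : s ≤ t) :
    s * (Real.cosh s / Real.sinh s) ≤ t * (Real.cosh t / Real.sinh t) := by
  have h1 : 0 < Real.sinh s := Real.sinh_pos_iff.2 hs
  have h2 : 0 < Real.sinh t := Real.sinh_pos_iff.2 (hs.trans_le hst)
  have h3 := sinh_ratio (u := t - s) (v := t + s) (by linarith) (by linarith)
  rw [Real.sinh_add, Real.sinh_sub] at h3
  rw [← mul_div_assoc, ← mul_div_assoc, div_le_div_iff₀ h1 h2]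
  nlinarith

theorem cot_anti {s t : ℝ} (hs : 0 < s) (hst : s ≤ t) (ht : t < π / 2) : t / Real.tan t ≤ s / Real.tan s := by
  have h1 : 0 < Real.sin s := Real.sin_pos_of_pos_of_lt_pi hs (by linarith)
  have h2 : 0 < Real.sin t := Real.sin_pos_of_pos_of_lt_pi (by linarith) (by linarith)
  have h3 : (t - s) * Real.sin (t + s) ≤ (t + s) * Real.sin (t - s) := by
    have hq : 0 < t + s := by linarith
    have hm : t + s ∈ Set.Icc 0 π := ⟨by linarith, by linarith⟩
    have hz : (0:ℝ) ∈ Set.Icc 0 π := ⟨le_rfl, Real.pi_pos.le⟩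
    have ha : 0 ≤ (t - s) / (t + s) := div_nonneg (by linarith) hq.le
    have hb : 0 ≤ 1 - (t - s) / (t + s) := sub_nonneg.2 ((div_le_one hq).2 (by linarith))
    have := strictConcaveOn_sin_Icc.concaveOn.2 hm hz ha hb (by ring)
    simp only [smul_eq_mul, Real.sin_zero, mul_zero, add_zero] at this
    rw [div_mul_cancel₀ _ hq.ne', div_mul_eq_mul_div, div_le_iff₀ hq] at this
    linarith
  rw [Real.sin_add, Real.sin_sub] at h3
  rw [Real.tan_eq_sin_div_cos, Real.tan_eq_sin_div_cos, div_div_eq_mul_div, div_div_eq_mul_div, div_le_div_iff₀ h2 h1]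
  nlinarith

theorem cosh_ratio {a b y0 y1 : ℝ} (ha : 0 ≤ a) (hab : a ≤ b) (hy0 : 0 ≤ y0) (hy : y0 ≤ y1) :
    Real.cosh (y1 * a) / Real.cosh (y1 * b) ≤ Real.cosh (y0 * a) / Real.cosh (y0 * b) := by
  rw [div_le_div_iff₀ (Real.cosh_pos _) (Real.cosh_pos _)]
  have h1 : Real.cosh (y1 * a + y0 * b) ≤ Real.cosh (y0 * a + y1 * b) := by
    have : 0 ≤ y1 := hy0.trans hy
    have : 0 ≤ b := ha.trans hab
    apply Real.cosh_le_cosh.2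
    rw [abs_of_nonneg (by positivity), abs_of_nonneg (by positivity)]
    nlinarith
  have h2 : Real.cosh (y1 * a - y0 * b) ≤ Real.cosh (y0 * a - y1 * b) := by
    apply Real.cosh_le_cosh.2
    have h3 : y1 * b - y0 * a ≤ |y0 * a - y1 * b| := by rw [abs_sub_comm]; exact le_abs_self _
    refine le_trans ?_ h3
    rw [abs_le]
    constructor <;> nlinarith
  rw [Real.cosh_add, Real.cosh_add] at h1
  rw [Real.cosh_sub, Real.cosh_sub] at h2
  linarith

theorem Gx_box {h0 h1 h y0 y1 y : ℝ} (hh : h ∈ Set.Icc h0 h1) (h00 : 0 < h0) (h11 : h1 < π / 2)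
    (hy : y ∈ Set.Icc y0 y1) (hy0 : 0 ≤ y0) (hyp : 0 < y) :
    Gx h y ≤ (y1 * (Real.cosh (y1 * (π / 2 - h1)) / Real.sinh (y1 * (π / 2 - h1)))) *
      (Real.cosh (y0 * (π / 2 - h0)) / Real.cosh (y0 * (π / 2 + h0))
       - h1 / Real.tan h1 * (1 + (y0 * h0) ^ 2 / 6) / (Real.cosh (y1 * (π / 2 + h1)) * Real.cosh (y1 * π / 2))) := by
  obtain ⟨ha, hb⟩ := hh
  obtain ⟨hya, hyb⟩ := hy
  have hhp : 0 < h := h00.trans_le ha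
  have hh1 : h < π / 2 := hb.trans_lt h11
  have hy1 : 0 < y1 := hyp.trans_le hyb
  have hbr := br_nonneg hhp hh1 hyp
  have hS : 0 < Real.sinh (y * (π / 2 - h)) := Real.sinh_pos_iff.2 (mul_pos hyp (by linarith))
  have hc1 := Real.cosh_pos (y * (π / 2 + h))
  have hc2 := Real.cosh_pos (y * (π / 2 - h))
  have hc3 := Real.cosh_pos (y * π / 2)
  have ht : 0 < Real.tan h := Real.tan_pos_of_pos_of_lt_pi_div_two hhp hh1
  have ht1 : 0 < Real.tan h1 := Real.tan_pos_of_pos_of_lt_pi_div_two (by linarith) h11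
  -- factorization
  have e : Gx h y = (y * (Real.cosh (y * (π / 2 - h)) / Real.sinh (y * (π / 2 - h)))) * (br h y / (y * Real.cosh (y * (π / 2 + h)))) := by
    unfold Gx; field_simp
  have e2 : br h y / (y * Real.cosh (y * (π / 2 + h))) = Real.cosh (y * (π / 2 - h)) / Real.cosh (y * (π / 2 + h))
      - Real.sinh (y * h) / Real.tan h / y / (Real.cosh (y * (π / 2 + h)) * Real.cosh (y * π / 2)) := by
    unfold br; field_simp
  have f1 : y * (Real.cosh (y * (π / 2 - h)) / Real.sinh (y * (π / 2 - h))) ≤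
      y1 * (Real.cosh (y1 * (π / 2 - h1)) / Real.sinh (y1 * (π / 2 - h1))) := by
    have g1 : 0 < y * (π / 2 - h1) := mul_pos hyp (by linarith)
    have k1 := coth_mono g1 (t := y1 * (π / 2 - h1)) (mul_le_mul_of_nonneg_right hyb (by linarith))
    have k2 : Real.cosh (y * (π / 2 - h)) / Real.sinh (y * (π / 2 - h)) ≤ Real.cosh (y * (π / 2 - h1)) / Real.sinh (y * (π / 2 - h1)) := by
      rw [div_le_div_iff₀ hS (Real.sinh_pos_iff.2 g1)]
      have : 0 ≤ Real.sinh (y * (π / 2 - h) - y * (π / 2 - h1)) := Real.sinh_nonneg_iff.2 (by nlinarith)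
      rw [Real.sinh_sub] at this
      linarith
    have k3 : 0 < π / 2 - h1 := by linarith
    refine (mul_le_mul_of_nonneg_left k2 hyp.le).trans ?_
    refine le_of_mul_le_mul_right ?_ k3
    linarith
  have f2 : Real.cosh (y * (π / 2 - h)) / Real.cosh (y * (π / 2 + h)) ≤ Real.cosh (y0 * (π / 2 - h0)) / Real.cosh (y0 * (π / 2 + h0)) := by
    have k1 : Real.cosh (y * (π / 2 - h)) / Real.cosh (y * (π / 2 + h)) ≤ Real.cosh (y * (π / 2 - h0)) / Real.cosh (y * (π / 2 + h0)) := by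
      apply div_le_div₀ (Real.cosh_pos _).le _ (Real.cosh_pos _)
      · apply Real.cosh_le_cosh.2
        rw [abs_of_nonneg (mul_nonneg hyp.le (by linarith)), abs_of_nonneg (mul_nonneg hyp.le (by linarith))]
        gcongr
      · apply Real.cosh_le_cosh.2
        rw [abs_of_nonneg (mul_nonneg hyp.le (by linarith)), abs_of_nonneg (mul_nonneg hyp.le (by linarith))]
        gcongr
    exact k1.trans (cosh_ratio (by linarith) (by linarith) hy0 hya)
  have f3 : h1 / Real.tan h1 * (1 + (y0 * h0) ^ 2 / 6) / (Real.cosh (y1 * (π / 2 + h1)) * Real.cosh (y1 * π / 2)) ≤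
      Real.sinh (y * h) / Real.tan h / y / (Real.cosh (y * (π / 2 + h)) * Real.cosh (y * π / 2)) := by
    have hs := sinh_cubic (mul_pos hyp hhp).le
    have hcot := cot_anti hhp hb h11
    have k1 : h1 / Real.tan h1 * (1 + (y0 * h0) ^ 2 / 6) ≤ Real.sinh (y * h) / Real.tan h / y := by
      calc h1 / Real.tan h1 * (1 + (y0 * h0) ^ 2 / 6) ≤ h / Real.tan h * (1 + (y * h) ^ 2 / 6) := by gcongr
        _ = (y * h + (y * h) ^ 3 / 6) / Real.tan h / y := by field_simp
        _ ≤ _ := by gcongr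
    have k2 : Real.cosh (y * (π / 2 + h)) ≤ Real.cosh (y1 * (π / 2 + h1)) := by
      apply Real.cosh_le_cosh.2
      rw [abs_of_nonneg (mul_nonneg hyp.le (by linarith)), abs_of_nonneg (mul_nonneg hy1.le (by linarith))]
      gcongr
    have k3 : Real.cosh (y * π / 2) ≤ Real.cosh (y1 * π / 2) := by
      apply Real.cosh_le_cosh.2
      rw [abs_of_nonneg (by positivity), abs_of_nonneg (by positivity)]
      gcongr
    have k4 : 0 ≤ Real.sinh (y * h) := Real.sinh_nonneg_iff.2 (by positivity)
    exact div_le_div₀ (by positivity) k1 (by positivity) (mul_le_mul k2 k3 hc3.le (Real.cosh_pos _).le)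
  rw [e]
  have hn : 0 ≤ br h y / (y * Real.cosh (y * (π / 2 + h))) := by positivity
  refine mul_le_mul f1 (by rw [e2]; linarith) hn ?_
  exact le_trans (by positivity) f1

theorem cosh_form (x : ℝ) : Real.cosh x = Real.exp x * (1 + Real.exp (-(2 * x))) / 2 := by
  rw [Real.cosh_eq, mul_add, ← Real.exp_add]; ring_nf
theorem sinh_form (x : ℝ) : Real.sinh x = Real.exp x * (1 - Real.exp (-(2 * x))) / 2 := by
  rw [Real.sinh_eq, mul_sub, ← Real.exp_add]; ring_nf

/-- the box bound in terms of small exponentials -/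
theorem Gx_box' {h0 h1 h y0 y1 y A B C g q : ℝ} (hh : h ∈ Set.Icc h0 h1) (h00 : 0 < h0) (h11 : h1 < π / 2)
    (hy : y ∈ Set.Icc y0 y1) (hy0 : 0 ≤ y0) (hyp : 0 < y)
    (hA : A = Real.exp (-(2 * h0 * y0))) (hB : B = Real.exp (-((π - 2 * h0) * y0)))
    (hC : C = Real.exp (-((π - 2 * h1) * y1))) (hg : g = Real.exp (-(h1 * y1))) (hq : q = Real.exp (-(π * y1))) :
    Gx h y ≤ (y1 * ((1 + C) * (1 - C)⁻¹)) *
      (A * (1 + B) * (1 + B * (A * A))⁻¹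
       - h1 / Real.tan h1 * (1 + (y0 * h0) ^ 2 / 6) * (4 * (q * g * ((1 + q * g * g) * (1 + q))⁻¹))) := by
  refine (Gx_box hh h00 h11 hy hy0 hyp).trans (le_of_eq ?_)
  have e1 : Real.cosh (y1 * (π / 2 - h1)) / Real.sinh (y1 * (π / 2 - h1)) = (1 + C) * (1 - C)⁻¹ := by
    rw [cosh_form, sinh_form, hC, div_div_div_cancel_right₀ (by norm_num), mul_div_mul_left _ _ (Real.exp_pos _).ne', div_eq_mul_inv]
    ring_nf
  have e2 : Real.cosh (y0 * (π / 2 - h0)) / Real.cosh (y0 * (π / 2 + h0)) = A * (1 + B) * (1 + B * (A * A))⁻¹ := by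
    rw [cosh_form, cosh_form, div_div_div_cancel_right₀ (by norm_num), ← div_eq_mul_inv]
    have k1 : Real.exp (y0 * (π / 2 - h0)) = Real.exp (y0 * (π / 2 + h0)) * A := by
      rw [hA, ← Real.exp_add]; congr 1; ring
    have k2 : Real.exp (-(2 * (y0 * (π / 2 + h0)))) = B * (A * A) := by
      rw [hA, hB, ← Real.exp_add, ← Real.exp_add]; congr 1; ring
    have k3 : Real.exp (-(2 * (y0 * (π / 2 - h0)))) = B := by
      rw [hB]; congr 1; ring
    rw [k1, k2, k3, mul_assoc, mul_div_mul_left _ _ (Real.exp_pos _).ne']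
  have e3 : (Real.cosh (y1 * (π / 2 + h1)) * Real.cosh (y1 * π / 2))⁻¹ = 4 * (q * g * ((1 + q * g * g) * (1 + q))⁻¹) := by
    rw [cosh_form, cosh_form]
    have k1 : Real.exp (-(2 * (y1 * (π / 2 + h1)))) = q * g * g := by
      rw [hq, hg, ← Real.exp_add, ← Real.exp_add]; congr 1; ring
    have k2 : Real.exp (-(2 * (y1 * π / 2))) = q := by rw [hq]; congr 1; ring
    have k3 : Real.exp (y1 * (π / 2 + h1)) * Real.exp (y1 * π / 2) * (q * g) = 1 := by
      rw [hq, hg, ← Real.exp_add, ← Real.exp_add, ← Real.exp_add, Real.exp_eq_one_iff]; ring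
    rw [k1, k2]
    have hq0 : 0 < q := by rw [hq]; exact Real.exp_pos _
    have hg0 : 0 < g := by rw [hg]; exact Real.exp_pos _
    generalize Real.exp (y1 * (π / 2 + h1)) = E1 at k3
    generalize Real.exp (y1 * π / 2) = E2 at k3
    symm
    apply eq_inv_of_mul_eq_one_left
    have hn : ((1 + q * g * g) * (1 + q))⁻¹ * ((1 + q * g * g) * (1 + q)) = 1 := inv_mul_cancel₀ (by positivity)
    linear_combination (E1 * E2 * (q * g)) * hn + k3
  rw [e1, e2, div_eq_mul_inv _ (Real.cosh (y1 * (π / 2 + h1)) * Real.cosh (y1 * π / 2)), e3]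

structure Cn where
  kA : CB
  kB : CB
  kC : CB
  kg : CB
  kq : CB
  kap : CB
  H0 : Nat

def oneB : CB := ⟨18446744073709551616, 0, 0, 0, 0⟩
theorem mem_oneB : mem 1 oneB := mem_one

noncomputable def stepK (c : Cn) (i W : Nat) (A B C g q : CB) (acc : Nat)
    (k : CB → CB → CB → CB → CB → Nat → Bool) : Bool :=
  mulK A A fun A2 => mulK B A2 fun BA => fC (add oneB BA) fun d1 => invK d1 fun v1 =>
  fC (add oneB B) fun B1 => mulK A B1 fun AB => mulK AB v1 fun M1 =>
  mulK q g fun qg => mulK qg g fun qgg => fC (add oneB qgg) fun d2 => fC (add oneB q) fun d3 =>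
  mulK d2 d3 fun d4 => invK d4 fun v2 => mulK qg v2 fun M2 =>
  fC (add oneB (rat (Nat.mul (Nat.mul i c.H0) (Nat.mul i c.H0)) 245760000)) fun d5 =>
  mulK c.kap d5 fun ky => mulK ky M2 fun M3 =>
  fC (sub oneB C) fun d6 => invK d6 fun v3 => fC (add oneB C) fun d7 => mulK d7 v3 fun ct =>
  fC (sdiv (nmul (Nat.succ i) ct) 64) fun ct2 => fC (sub M1 (nmul 4 M3)) fun d8 =>
  mulK ct2 d8 fun G =>
  fN (Nat.add acc (Nat.mul (Nat.sub (Nat.add G.a G.e) G.b) W)) fun acc =>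
  mulK A c.kA fun A => mulK B c.kB fun B => mulK C c.kC fun C => mulK g c.kg fun g => mulK q c.kq fun q =>
  k A B C g q acc

structure CnOK (h0 h1 : ℝ) (c : Cn) : Prop where
  kA : mem ((Real.exp (-(2 * h0 * (1 / 64))) : ℝ) : ℂ) c.kA
  kB : mem ((Real.exp (-((π - 2 * h0) * (1 / 64))) : ℝ) : ℂ) c.kB
  kC : mem ((Real.exp (-((π - 2 * h1) * (1 / 64))) : ℝ) : ℂ) c.kC
  kg : mem ((Real.exp (-(h1 * (1 / 64))) : ℝ) : ℂ) c.kg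
  kq : mem ((Real.exp (-(π * (1 / 64))) : ℝ) : ℂ) c.kq
  kap : mem ((h1 / Real.tan h1 : ℝ) : ℂ) c.kap
  H0 : h0 = (c.H0 : ℝ) / 100

structure StOK (h0 h1 : ℝ) (i : ℕ) (A B C g q : CB) : Prop where
  A : mem ((Real.exp (-(2 * h0 * (i / 64))) : ℝ) : ℂ) A
  B : mem ((Real.exp (-((π - 2 * h0) * (i / 64))) : ℝ) : ℂ) B
  C : mem ((Real.exp (-((π - 2 * h1) * ((i + 1) / 64))) : ℝ) : ℂ) C
  g : mem ((Real.exp (-(h1 * ((i + 1) / 64))) : ℝ) : ℂ) g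
  q : mem ((Real.exp (-(π * ((i + 1) / 64))) : ℝ) : ℂ) q

theorem exp_step (a x y z : ℝ) {b c : CB} (hz : x + y = z) (h1 : mem ((Real.exp (-(a * x)) : ℝ) : ℂ) b)
    (h2 : mem ((Real.exp (-(a * y)) : ℝ) : ℂ) c) : mem ((Real.exp (-(a * z)) : ℝ) : ℂ) (mul b c) := by
  refine mem_neg1 ?_ (mem_mul h1 h2)
  rw [← Complex.ofReal_mul, ← Real.exp_add, ← hz]
  congr 2; ring

structure fOK (h : ℝ) (f : ℝ → ℝ) : Prop where
  int : ∀ a b : ℝ, 0 ≤ a → 0 ≤ b → IntervalIntegrable f volume a b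
  le : ∀ y, 0 < y → |f y| ≤ Gx h y * |Fr h y|

theorem stepK_sound {h0 h1 h : ℝ} {c : Cn} {f : ℝ → ℝ} (hc : CnOK h0 h1 c) (hf : fOK h f)
    (hh : h ∈ Set.Icc h0 h1) (h00 : 0 < h0) (h11 : h1 < π / 2) {i W acc : ℕ} {A B C g q : CB}
    {k : CB → CB → CB → CB → CB → Nat → Bool} (hs : StOK h0 h1 i A B C g q)
    (hW : ∀ y ∈ Set.Icc ((i : ℝ) / 64) (((i + 1 : ℕ) : ℝ) / 64), |Fr h y| ≤ (W : ℝ) / 17179869184)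
    (hacc : ∫ y in (0:ℝ)..((i : ℝ) / 64), f y ≤ (acc : ℝ) / (18446744073709551616 * 17179869184 * 64))
    (HH : stepK c i W A B C g q acc k = true) :
    ∃ (A' B' C' g' q' : CB) (acc' : ℕ), StOK h0 h1 (i + 1) A' B' C' g' q' ∧
      ∫ y in (0:ℝ)..(((i + 1 : ℕ) : ℝ) / 64), f y ≤ (acc' : ℝ) / (18446744073709551616 * 17179869184 * 64) ∧
      k A' B' C' g' q' acc' = true := by
  obtain ⟨hA, hB, hC, hg, hq⟩ := hs
  unfold stepK at HH
  rw [mulK_eq, mulK_eq, fC_eq] at HH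
  obtain ⟨v1, hv1, -, HH⟩ := invK_sound HH (mem_add mem_oneB (mem_mul hB (mem_mul hA hA)))
  rw [fC_eq, mulK_eq, mulK_eq, mulK_eq, mulK_eq, fC_eq, fC_eq, mulK_eq] at HH
  have hM1 := mem_mul (mem_mul hA (mem_add mem_oneB hB)) hv1
  have hqg := mem_mul hq hg
  obtain ⟨v2, hv2, -, HH⟩ := invK_sound HH (mem_mul (mem_add mem_oneB (mem_mul hqg hg)) (mem_add mem_oneB hq))
  rw [mulK_eq, fC_eq, mulK_eq, mulK_eq, fC_eq] at HH
  have hM2 := mem_mul hqg hv2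
  have hM3 := mem_mul (mem_mul hc.kap (mem_add mem_oneB (mem_rat (Nat.mul (Nat.mul i c.H0) (Nat.mul i c.H0)) 245760000 (by norm_num)))) hM2
  obtain ⟨v3, hv3, -, HH⟩ := invK_sound HH (mem_sub mem_oneB hC)
  rw [fC_eq, mulK_eq, fC_eq, fC_eq, mulK_eq, fN_eq, mulK_eq, mulK_eq, mulK_eq, mulK_eq, mulK_eq] at HH
  have hG := mem_mul (mem_sdiv (k := 64) (by norm_num) (mem_nmul (Nat.succ i) (mem_mul (mem_add mem_oneB hC) hv3))) (mem_sub hM1 (mem_nmul 4 hM3))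
  generalize hGb : (mul (sdiv (nmul (Nat.succ i) (mul (add oneB C) v3)) 64) _) = Gb at HH hG
  refine ⟨_, _, _, _, _, _, ⟨?_, ?_, ?_, ?_, ?_⟩, ?_, HH⟩
  · exact exp_step _ _ _ _ (by push_cast; ring) hA hc.kA
  · exact exp_step _ _ _ _ (by push_cast; ring) hB hc.kB
  · exact exp_step _ _ _ _ (by push_cast; ring) hC hc.kC
  · exact exp_step _ _ _ _ (by push_cast; ring) hg hc.kg
  · exact exp_step _ _ _ _ (by push_cast; ring) hq hc.kq
  have hup := re_le_up hG
  set Gr : ℝ := (((i:ℝ) + 1) / 64 * ((1 + (Real.exp (-((π - 2 * h1) * ((i + 1) / 64))))) * (1 - (Real.exp (-((π - 2 * h1) * ((i + 1) / 64)))))⁻¹)) *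
      ((Real.exp (-(2 * h0 * (i / 64)))) * (1 + (Real.exp (-((π - 2 * h0) * (i / 64))))) * (1 + (Real.exp (-((π - 2 * h0) * (i / 64)))) * ((Real.exp (-(2 * h0 * (i / 64)))) * (Real.exp (-(2 * h0 * (i / 64))))))⁻¹
       - h1 / Real.tan h1 * (1 + ((i:ℝ) / 64 * h0) ^ 2 / 6) * (4 * (Real.exp (-(π * ((i + 1) / 64))) * Real.exp (-(h1 * ((i + 1) / 64))) * ((1 + Real.exp (-(π * ((i + 1) / 64))) * Real.exp (-(h1 * ((i + 1) / 64))) * Real.exp (-(h1 * ((i + 1) / 64)))) * (1 + Real.exp (-(π * ((i + 1) / 64)))))⁻¹))) with hGr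
  have hre : ∀ z : ℂ, z = ((Gr : ℝ) : ℂ) → z.re = Gr := fun z hz => by rw [hz, Complex.ofReal_re]
  rw [hre _ (by
    rw [hGr, hc.H0]
    simp only [Nat.mul_eq, Nat.succ_eq_add_one]
    push_cast
    ring)] at hup
  set U : ℕ := Nat.sub (Nat.add Gb.a Gb.e) Gb.b with hU
  have hUr : Gr ≤ (U : ℝ) / 18446744073709551616 := by
    rw [le_div_iff₀ (by norm_num)]
    refine hup.trans ?_
    have : ((Gb.a + Gb.e : ℕ) : ℝ) ≤ ((U + Gb.b : ℕ) : ℝ) := Nat.cast_le.2 (by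
      rw [hU]; simp only [Nat.sub_eq, Nat.add_eq]; exact le_tsub_add)
    push_cast at this
    linarith
  have hi0 : (0:ℝ) ≤ (i : ℝ) / 64 := by positivity
  have hle : (i : ℝ) / 64 ≤ ((i + 1 : ℕ) : ℝ) / 64 := by push_cast; linarith
  have hb : ‖∫ y in ((i : ℝ) / 64)..(((i + 1 : ℕ) : ℝ) / 64), f y‖ ≤ ((U : ℝ) / 18446744073709551616 * ((W : ℝ) / 17179869184)) * |((i + 1 : ℕ) : ℝ) / 64 - (i : ℝ) / 64| := by
    apply intervalIntegral.norm_integral_le_of_norm_le_const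
    intro y hy
    rw [Set.uIoc_of_le hle] at hy
    have hy0 : 0 < y := hi0.trans_lt hy.1
    rw [Real.norm_eq_abs]
    refine (hf.le y hy0).trans ?_
    have hG2 : Gx h y ≤ Gr := Gx_box' (y0 := (i : ℝ) / 64) (y1 := ((i:ℝ) + 1) / 64) hh h00 h11 ⟨hy.1.le, by have := hy.2; push_cast at this; exact this⟩ hi0 hy0 rfl rfl rfl rfl rfl
    exact mul_le_mul (hG2.trans hUr) (hW y ⟨hy.1.le, hy.2⟩) (abs_nonneg _) (by positivity)
  have e : |((i + 1 : ℕ) : ℝ) / 64 - (i : ℝ) / 64| = 1 / 64 := by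
    rw [show ((i + 1 : ℕ) : ℝ) / 64 - (i : ℝ) / 64 = 1 / 64 by push_cast; ring]; norm_num
  rw [e] at hb
  rw [← intervalIntegral.integral_add_adjacent_intervals (hf.int 0 _ le_rfl hi0) (hf.int _ _ hi0 (hi0.trans hle))]
  have h3 := le_trans (le_abs_self _) hb
  have e2 : ((Nat.add acc (Nat.mul U W) : ℕ) : ℝ) = acc + U * W := by
    simp only [Nat.mul_eq, Nat.add_eq]; push_cast; ring
  rw [e2, add_div]
  refine add_le_add hacc (h3.trans (le_of_eq ?_))
  ring

def mxN (a b : Nat) : Nat := cond (Nat.ble a b) b a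
theorem le_mxN (a b : ℕ) : a ≤ mxN a b ∧ b ≤ mxN a b := by
  unfold mxN
  cases hb : Nat.ble a b with
  | true => simpa using Nat.le_of_ble_eq_true hb
  | false =>
    have : ¬ a ≤ b := fun h => by rw [Nat.ble_eq_true_of_le h] at hb; cases hb
    simp; omega

def wN (a b r er : Nat) : Nat :=
  Nat.add (mxN (Nat.add (Nat.mul (Nat.sub 4 r) a) (Nat.mul r b)) (Nat.add (Nat.mul (Nat.sub 3 r) a) (Nat.mul (Nat.succ r) b))) (Nat.mul 4 er)

def erN (H0 H1 j D : Nat) : Nat :=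
  Nat.succ (Nat.div (Nat.mul (Nat.add (Nat.add 1033600000 (Nat.mul 15837 (Nat.mul H1 H1)))
    (Nat.mul 15837 (Nat.mul (Nat.mul (Nat.sub H1 H0) (Nat.sub H1 H0)) (Nat.mul (Nat.succ j) (Nat.succ j)))))
    (Nat.add D 18446744073709551616)) 1759218604441600000000)

noncomputable def loopJ (c : Cn) (H1 d fin : Nat) (T0 : List Nat) :
    List Nat → Nat → Nat → Nat → CB → CB → CB → CB → CB → Nat → Bool :=
  List.rec (fun _ _ _ _ _ _ _ _ _ acc => Nat.ble acc fin)
    (fun t0 _ ih T1 j D a A B C g q acc =>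
      List.rec false (fun t1 T1' _ =>
        fN (mxN t0 t1) fun b => fN (erN c.H0 H1 j D) fun er =>
        fN (wN a b 0 er) fun w0 => fN (wN a b 1 er) fun w1 => fN (wN a b 2 er) fun w2 => fN (wN a b 3 er) fun w3 =>
        stepK c (Nat.mul 4 j) w0 A B C g q acc fun A B C g q acc =>
        stepK c (Nat.add (Nat.mul 4 j) 1) w1 A B C g q acc fun A B C g q acc =>
        stepK c (Nat.add (Nat.mul 4 j) 2) w2 A B C g q acc fun A B C g q acc =>
        stepK c (Nat.add (Nat.mul 4 j) 3) w3 A B C g q acc fun A B C g q acc =>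
        fN (Nat.succ (Nat.div (Nat.mul D d) 18446744073709551616)) fun D =>
        fN (Nat.succ j) fun j => ih T1' j D b A B C g q acc) T1) T0

theorem interp_max {a b r s : ℝ} {M : ℝ} (h1 : (4 - r) * a + r * b ≤ M) (h2 : (3 - r) * a + (r + 1) * b ≤ M)
    (hs : r ≤ s) (hs1 : s ≤ r + 1) : (4 - s) * a + s * b ≤ M := by
  have e : (4 - s) * a + s * b = (r + 1 - s) * ((4 - r) * a + r * b) + (s - r) * ((3 - r) * a + (r + 1) * b) := by ring
  rw [e]
  nlinarith

theorem cosh_up {x E : ℝ} (hx : 0 ≤ x) (h : Real.exp x ≤ E) : Real.cosh x ≤ (E + 1) / 2 := by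
  rw [Real.cosh_eq]
  have : Real.exp (-x) ≤ 1 := Real.exp_le_one_iff.2 (by linarith)
  linarith

theorem bin_bound {H0 H1 j D a b : ℕ} {h : ℝ} (hH : H0 < H1) (hh : h ∈ Set.Icc ((H0 : ℝ) / 100) ((H1 : ℝ) / 100))
    (hD : Real.exp (0.71 * ((H1 : ℝ) / 100) * (((j + 1 : ℕ) : ℝ) / 16)) * 18446744073709551616 ≤ D)
    (A0 : |Fr ((H0 : ℝ) / 100) ((j : ℝ) / 16)| ≤ (a : ℝ) / 4294967296)
    (A1 : |Fr ((H1 : ℝ) / 100) ((j : ℝ) / 16)| ≤ (a : ℝ) / 4294967296)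
    (B0 : |Fr ((H0 : ℝ) / 100) (((j + 1 : ℕ) : ℝ) / 16)| ≤ (b : ℝ) / 4294967296)
    (B1 : |Fr ((H1 : ℝ) / 100) (((j + 1 : ℕ) : ℝ) / 16)| ≤ (b : ℝ) / 4294967296) (r : ℕ) (hr : r ≤ 3) :
    ∀ y ∈ Set.Icc (((4 * j + r : ℕ) : ℝ) / 64) (((4 * j + r + 1 : ℕ) : ℝ) / 64),
      |Fr h y| ≤ (wN a b r (erN H0 H1 j D) : ℝ) / 17179869184 := by
  intro y hy
  obtain ⟨hy1, hy2⟩ := hy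
  push_cast at hy1 hy2
  have hr0 : (0:ℝ) ≤ r := Nat.cast_nonneg _
  have hr3 : (r:ℝ) ≤ 3 := by exact_mod_cast hr
  have hj0 : (0:ℝ) ≤ j := Nat.cast_nonneg _
  have key := Fr_interp (h0 := (H0 : ℝ) / 100) (h1 := (H1 : ℝ) / 100) (h := h) (y0 := (j : ℝ) / 16) (y1 := ((j + 1 : ℕ) : ℝ) / 16) (y := y)
    (by have : (H0 : ℝ) < H1 := by exact_mod_cast hH
        linarith) hh (by positivity) (by push_cast; linarith) ⟨by linarith, by push_cast; linarith⟩ (by positivity) A0 A1 B0 B1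
  refine key.trans ?_
  have ed : ((j + 1 : ℕ) : ℝ) / 16 - (j : ℝ) / 16 = 1 / 16 := by push_cast; ring
  rw [ed]
  -- the error
  have herr : ((((j + 1 : ℕ) : ℝ) / 16 * 0.71) ^ 2 * π * ((H1 : ℝ) / 100 - (H0 : ℝ) / 100) ^ 2 +
      (π ^ 3 / 3 + (0.71 * ((H1 : ℝ) / 100)) ^ 2 * π) * (1 / 16) ^ 2) / 8 *
      Real.cosh (((j + 1 : ℕ) : ℝ) / 16 * (0.71 * ((H1 : ℝ) / 100))) ≤ (erN H0 H1 j D : ℝ) / 4294967296 := by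
    have hp : 0.5041 * π ≤ 1.5837 := by have := Real.pi_lt_d4; linarith
    have hp3 : π ^ 3 / 3 ≤ 10.336 := by
      have h1 := Real.pi_lt_d4
      have h2 := Real.pi_pos
      have : π ^ 3 ≤ 3.1416 ^ 3 := by gcongr
      linarith
    have hc := cosh_up (x := ((j + 1 : ℕ) : ℝ) / 16 * (0.71 * ((H1 : ℝ) / 100))) (E := (D : ℝ) / 18446744073709551616) (by positivity)
      (by rw [le_div_iff₀ (by norm_num)]; rw [mul_comm (((j + 1 : ℕ) : ℝ) / 16)]; exact hD)
    set N : ℕ := (Nat.add (Nat.add 1033600000 (Nat.mul 15837 (Nat.mul H1 H1)))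
      (Nat.mul 15837 (Nat.mul (Nat.mul (Nat.sub H1 H0) (Nat.sub H1 H0)) (Nat.mul (Nat.succ j) (Nat.succ j))))) with hN
    have hNr : (N : ℝ) = 1033600000 + 15837 * (H1 * H1) + 15837 * (((H1 : ℝ) - H0) * (H1 - H0) * ((j + 1) * (j + 1))) := by
      rw [hN]
      simp only [Nat.mul_eq, Nat.add_eq, Nat.sub_eq, Nat.succ_eq_add_one]
      push_cast [Nat.cast_sub hH.le]
      ring
    have hd := nat_div_ge (N * (D + 18446744073709551616)) 1759218604441600000000 (by norm_num)
    have he : (erN H0 H1 j D : ℝ) = ((N * (D + 18446744073709551616) / 1759218604441600000000 : ℕ) : ℝ) + 1 := by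
      unfold erN
      rw [Nat.succ_eq_add_one, Nat.cast_add, Nat.cast_one]
      rfl
    rw [← he] at hd
    have hM : ((((j + 1 : ℕ) : ℝ) / 16 * 0.71) ^ 2 * π * ((H1 : ℝ) / 100 - (H0 : ℝ) / 100) ^ 2 +
      (π ^ 3 / 3 + (0.71 * ((H1 : ℝ) / 100)) ^ 2 * π) * (1 / 16) ^ 2) / 8 ≤ N / 204800000000 := by
      rw [hNr]
      push_cast
      have e1 : ((((j:ℝ) + 1) / 16 * 0.71) ^ 2 * π * ((H1 : ℝ) / 100 - (H0 : ℝ) / 100) ^ 2 +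
      (π ^ 3 / 3 + (0.71 * ((H1 : ℝ) / 100)) ^ 2 * π) * (1 / 16) ^ 2) / 8 = (100000000 * (π ^ 3 / 3) + 10000 * (0.5041 * π) * (H1 * H1) + 10000 * (0.5041 * π) * (((H1 : ℝ) - H0) ^ 2 * (j + 1) ^ 2)) / 204800000000 := by ring
      rw [e1]
      apply div_le_div_of_nonneg_right _ (by norm_num)
      have k1 : 10000 * (0.5041 * π) * ((H1:ℝ) * H1) ≤ 15837 * (H1 * H1) := mul_le_mul_of_nonneg_right (by linarith) (by positivity)
      have k2 : 10000 * (0.5041 * π) * (((H1 : ℝ) - H0) ^ 2 * (j + 1) ^ 2) ≤ 15837 * (((H1 : ℝ) - H0) ^ 2 * (j + 1) ^ 2) := mul_le_mul_of_nonneg_right (by linarith) (by positivity)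
      linarith
    calc _ ≤ (N : ℝ) / 204800000000 * (((D : ℝ) / 18446744073709551616 + 1) / 2) :=
          mul_le_mul hM hc (Real.cosh_pos _).le (by positivity)
      _ = (((N * (D + 18446744073709551616) : ℕ) : ℝ) / ((1759218604441600000000 : ℕ) : ℝ)) / 4294967296 := by push_cast; ring
      _ ≤ _ := div_le_div_of_nonneg_right hd (by norm_num)
  refine (add_le_add_right herr _).trans ?_
  generalize erN H0 H1 j D = er
  have hm := le_mxN (Nat.add (Nat.mul (Nat.sub 4 r) a) (Nat.mul r b)) (Nat.add (Nat.mul (Nat.sub 3 r) a) (Nat.mul (Nat.succ r) b))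
  unfold wN
  generalize mxN (Nat.add (Nat.mul (Nat.sub 4 r) a) (Nat.mul r b)) (Nat.add (Nat.mul (Nat.sub 3 r) a) (Nat.mul (Nat.succ r) b)) = M at hm
  obtain ⟨m1, m2⟩ := hm
  have m1' : ((4:ℝ) - r) * a + r * b ≤ M := by
    have := (Nat.cast_le (α := ℝ)).2 m1
    simp only [Nat.mul_eq, Nat.add_eq, Nat.sub_eq, Nat.succ_eq_add_one] at this
    push_cast [Nat.cast_sub (show r ≤ 4 by omega)] at this
    exact this
  have m2' : ((3:ℝ) - r) * a + (r + 1) * b ≤ M := by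
    have := (Nat.cast_le (α := ℝ)).2 m2
    simp only [Nat.mul_eq, Nat.add_eq, Nat.sub_eq, Nat.succ_eq_add_one] at this
    push_cast [Nat.cast_sub hr] at this
    exact this
  have := interp_max (s := 64 * y - 4 * j) m1' m2' (by linarith) (by linarith)
  have ew : ((Nat.add M (Nat.mul 4 er) : ℕ) : ℝ) = M + 4 * er := by
    simp only [Nat.mul_eq, Nat.add_eq]; push_cast; ring
  rw [ew]
  push_cast
  have e : (((j:ℝ) + 1) / 16 - y) / (1 / 16) * (a / 4294967296) + (y - j / 16) / (1 / 16) * (b / 4294967296) + er / 4294967296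
    = ((4 - (64 * y - 4 * j)) * a + (64 * y - 4 * j) * b + 4 * er) / 17179869184 := by ring
  rw [e]
  apply div_le_div_of_nonneg_right _ (by norm_num)
  linarith

theorem FT_head {H j t : ℕ} {T : List ℕ} (hH : H ≤ 125) (hj : j ≤ 128) (h : FT ((H : ℝ) / 100) j (t :: T)) :
    |Fr ((H : ℝ) / 100) ((j : ℝ) / 16)| ≤ (t : ℝ) / 4294967296 := by
  have hH' : (H : ℝ) ≤ 125 := by exact_mod_cast hH
  have hj' : (j : ℝ) ≤ 128 := by exact_mod_cast hj
  have h1 := Fr_over (h := (H : ℝ) / 100) (y := (j : ℝ) / 16) (by positivity) (by linarith) (by positivity) (by linarith)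
  have h2 := h.1
  refine (h1.trans (le_of_eq ?_)).trans h2
  ring

theorem loopJ_sound {H0 H1 d fin : ℕ} {c : Cn} {h : ℝ} {f : ℝ → ℝ} (hc : CnOK ((H0 : ℝ) / 100) ((H1 : ℝ) / 100) c) (hf : fOK h f)
    (hcH : c.H0 = H0) (hH0 : 0 < H0) (hH : H0 < H1) (hH1 : H1 ≤ 125) (hh : h ∈ Set.Icc ((H0 : ℝ) / 100) ((H1 : ℝ) / 100))
    (hd : Real.exp (0.71 * ((H1 : ℝ) / 100) * (1 / 16)) * 18446744073709551616 ≤ d) (T0 : List ℕ) :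
    ∀ (T1 : List ℕ) (j D a : ℕ) (A B C g q : CB) (acc : ℕ), j + T0.length ≤ 128 →
    FT ((H0 : ℝ) / 100) (j + 1) T0 → FT ((H1 : ℝ) / 100) (j + 1) T1 →
    Real.exp (0.71 * ((H1 : ℝ) / 100) * (((j + 1 : ℕ) : ℝ) / 16)) * 18446744073709551616 ≤ D →
    |Fr ((H0 : ℝ) / 100) ((j : ℝ) / 16)| ≤ (a : ℝ) / 4294967296 →
    |Fr ((H1 : ℝ) / 100) ((j : ℝ) / 16)| ≤ (a : ℝ) / 4294967296 →
    StOK ((H0 : ℝ) / 100) ((H1 : ℝ) / 100) (4 * j) A B C g q →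
    ∫ y in (0:ℝ)..(((4 * j : ℕ) : ℝ) / 64), f y ≤ (acc : ℝ) / (18446744073709551616 * 17179869184 * 64) →
    loopJ c H1 d fin T0 T1 j D a A B C g q acc = true →
    ∫ y in (0:ℝ)..(((4 * (j + T0.length) : ℕ) : ℝ) / 64), f y ≤ (fin : ℝ) / (18446744073709551616 * 17179869184 * 64) := by
  have h00 : (0:ℝ) < (H0 : ℝ) / 100 := by positivity
  have h11 : (H1 : ℝ) / 100 < π / 2 := by
    have := Real.pi_gt_d2
    have hH' : (H1 : ℝ) ≤ 125 := by exact_mod_cast hH1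
    linarith
  induction T0 with
  | nil =>
    intro T1 j D a A B C g q acc _ _ _ _ _ _ _ hacc HH
    have HH' : Nat.ble acc fin = true := HH
    have : (acc : ℝ) ≤ fin := Nat.cast_le.2 (Nat.le_of_ble_eq_true HH')
    refine hacc.trans (div_le_div_of_nonneg_right this (by norm_num))
  | cons t0 T0 ih =>
    intro T1 j D a A B C g q acc hlen hF0 hF1 hD ha0 ha1 hs hacc HH
    cases T1 with
    | nil => exact absurd HH (by simp [loopJ])
    | cons t1 T1 =>
      have HH' : (fN (mxN t0 t1) fun b => fN (erN c.H0 H1 j D) fun er =>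
        fN (wN a b 0 er) fun w0 => fN (wN a b 1 er) fun w1 => fN (wN a b 2 er) fun w2 => fN (wN a b 3 er) fun w3 =>
        stepK c (Nat.mul 4 j) w0 A B C g q acc fun A B C g q acc =>
        stepK c (Nat.add (Nat.mul 4 j) 1) w1 A B C g q acc fun A B C g q acc =>
        stepK c (Nat.add (Nat.mul 4 j) 2) w2 A B C g q acc fun A B C g q acc =>
        stepK c (Nat.add (Nat.mul 4 j) 3) w3 A B C g q acc fun A B C g q acc =>
        fN (Nat.succ (Nat.div (Nat.mul D d) 18446744073709551616)) fun D =>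
        fN (Nat.succ j) fun j => loopJ c H1 d fin T0 T1 j D b A B C g q acc) = true := HH
      clear HH
      simp only [fN_eq, hcH] at HH'
      rw [List.length_cons] at hlen
      obtain ⟨hm0, hm1⟩ := le_mxN t0 t1
      have hj : j + 1 ≤ 128 := by omega
      have hb0 : |Fr ((H0 : ℝ) / 100) (((j + 1 : ℕ) : ℝ) / 16)| ≤ (mxN t0 t1 : ℝ) / 4294967296 :=
        (FT_head (by omega) hj hF0).trans (div_le_div_of_nonneg_right (Nat.cast_le.2 hm0) (by norm_num))
      have hb1 : |Fr ((H1 : ℝ) / 100) (((j + 1 : ℕ) : ℝ) / 16)| ≤ (mxN t0 t1 : ℝ) / 4294967296 :=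
        (FT_head hH1 hj hF1).trans (div_le_div_of_nonneg_right (Nat.cast_le.2 hm1) (by norm_num))
      generalize mxN t0 t1 = b at hb0 hb1 HH'
      have hW := bin_bound hH hh hD ha0 ha1 hb0 hb1
      generalize erN H0 H1 j D = er at hW HH'
      obtain ⟨A, B, C, g, q, acc, hs, hacc, HH⟩ := stepK_sound hc hf hh h00 h11 hs (hW 0 (by norm_num)) hacc HH'
      obtain ⟨A, B, C, g, q, acc, hs, hacc, HH⟩ := stepK_sound (i := 4 * j + 1) hc hf hh h00 h11 hs (hW 1 (by norm_num)) hacc HH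
      obtain ⟨A, B, C, g, q, acc, hs, hacc, HH⟩ := stepK_sound (i := 4 * j + 2) hc hf hh h00 h11 hs (hW 2 (by norm_num)) hacc HH
      obtain ⟨A, B, C, g, q, acc, hs, hacc, HH⟩ := stepK_sound (i := 4 * j + 3) hc hf hh h00 h11 hs (hW 3 (by norm_num)) hacc HH
      have e4 : 4 * j + 3 + 1 = 4 * (j + 1) := by ring
      rw [e4] at hs hacc
      have := ih T1 (j + 1) _ b A B C g q acc (by omega) hF0.2 hF1.2 ?_ hb0 hb1 hs hacc HH
      · have e5 : j + (t0 :: T0).length = j + 1 + T0.length := by rw [List.length_cons]; ring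
        rw [e5]; exact this
      · have hg := nat_div_ge (D * d) 18446744073709551616 (by norm_num)
        have e6 : ((Nat.succ (Nat.div (Nat.mul D d) 18446744073709551616) : ℕ) : ℝ) = ((D * d / 18446744073709551616 : ℕ) : ℝ) + 1 := by
          rw [Nat.succ_eq_add_one, Nat.cast_add, Nat.cast_one]; rfl
        rw [e6]
        refine le_trans ?_ hg
        have e7 : Real.exp (0.71 * ((H1 : ℝ) / 100) * (((j + 1 + 1 : ℕ) : ℝ) / 16)) =
          Real.exp (0.71 * ((H1 : ℝ) / 100) * (((j + 1 : ℕ) : ℝ) / 16)) * Real.exp (0.71 * ((H1 : ℝ) / 100) * (1 / 16)) := by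
          rw [← Real.exp_add]; congr 1; push_cast; ring
        rw [e7]
        push_cast
        rw [le_div_iff₀ (by norm_num)]
        have := mul_le_mul hD hd (by positivity) (by positivity)
        refine le_trans (le_of_eq ?_) this
        push_cast
        ring

def piB : CB := ⟨57952155664616982739, 0, 0, 0, 8⟩

theorem mem_piB : mem ((π : ℝ) : ℂ) piB := by
  rw [mem_iff]
  have : ((π : ℝ) : ℂ) * 18446744073709551616 - piB.ctr
      = ((π * 18446744073709551616 - 57952155664616982739 : ℝ) : ℂ) := by
    apply Complex.ext <;> simp [ctr, piB]
  rw [this, Complex.norm_real, Real.norm_eq_abs, abs_le]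
  have h1 := Real.pi_gt_d20
  have h2 := Real.pi_lt_d20
  have e : (piB.e : ℝ) = 8 := by simp [piB]
  rw [e]
  constructor <;> norm_num at * <;> linarith

noncomputable def initK (H0 H1 fin t0 t1 : Nat) (T0 T1 : List Nat) : Bool :=
  cexpK (neg (rat (Nat.mul 2 H0) 6400)) fun kA =>
  cexpK (neg (sdiv (sub piB (rat (Nat.mul 2 H0) 100)) 64)) fun kB =>
  cexpK (neg (sdiv (sub piB (rat (Nat.mul 2 H1) 100)) 64)) fun kC =>
  cexpK (neg (rat H1 6400)) fun kg =>
  cexpK (neg (sdiv piB 64)) fun kq =>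
  fC (rat H1 100) fun HB =>
  cexpK (mulI HB) fun e => fC (imP e) fun s => invK s fun v => mulK HB (reP e) fun u => mulK u v fun kap =>
  cexpK (rat (Nat.mul 71 H1) 160000) fun dB => fN (nrm dB) fun d =>
  fN (mxN t0 t1) fun a =>
  loopJ ⟨kA, kB, kC, kg, kq, kap, H0⟩ H1 d fin T0 T1 0 d a oneB oneB kC kg kq 0

theorem initK_sound {H0 H1 fin t0 t1 : ℕ} {T0 T1 : List ℕ} {h : ℝ} {f : ℝ → ℝ} (hf : fOK h f)
    (hH0 : 0 < H0) (hH : H0 < H1) (hH1 : H1 ≤ 125) (hh : h ∈ Set.Icc ((H0 : ℝ) / 100) ((H1 : ℝ) / 100))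
    (hT0 : FT ((H0 : ℝ) / 100) 0 (t0 :: T0)) (hT1 : FT ((H1 : ℝ) / 100) 0 (t1 :: T1)) (hlen : T0.length = 128)
    (HH : initK H0 H1 fin t0 t1 T0 T1 = true) :
    ∫ y in (0:ℝ)..8, f y ≤ (fin : ℝ) / (18446744073709551616 * 17179869184 * 64) := by
  unfold initK at HH
  obtain ⟨kA, hkA, HH⟩ := cexpK_sound HH (mem_neg (mem_rat (Nat.mul 2 H0) 6400 (by norm_num)))
  obtain ⟨kB, hkB, HH⟩ := cexpK_sound HH (mem_neg (mem_sdiv (k := 64) (by norm_num) (mem_sub mem_piB (mem_rat (Nat.mul 2 H0) 100 (by norm_num)))))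
  obtain ⟨kC, hkC, HH⟩ := cexpK_sound HH (mem_neg (mem_sdiv (k := 64) (by norm_num) (mem_sub mem_piB (mem_rat (Nat.mul 2 H1) 100 (by norm_num)))))
  obtain ⟨kg, hkg, HH⟩ := cexpK_sound HH (mem_neg (mem_rat H1 6400 (by norm_num)))
  obtain ⟨kq, hkq, HH⟩ := cexpK_sound HH (mem_neg (mem_sdiv (k := 64) (by norm_num) mem_piB))
  rw [fC_eq] at HH
  have hHB := mem_rat H1 100 (by norm_num)
  obtain ⟨e, he, HH⟩ := cexpK_sound HH (mem_mulI hHB)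
  rw [fC_eq] at HH
  obtain ⟨v, hv, -, HH⟩ := invK_sound HH (mem_imP he)
  rw [mulK_eq, mulK_eq] at HH
  have hkap := mem_mul (mem_mul hHB (mem_reP he)) hv
  obtain ⟨dB, hdB, HH⟩ := cexpK_sound HH (mem_rat (Nat.mul 71 H1) 160000 (by norm_num))
  rw [fN_eq, fN_eq] at HH
  have hd : Real.exp (0.71 * ((H1 : ℝ) / 100) * (1 / 16)) * 18446744073709551616 ≤ (nrm dB : ℝ) := by
    have h1 := norm_le_nrm hdB
    have e1 : Complex.exp (((Nat.mul 71 H1 : ℕ) : ℂ) / ((160000 : ℕ) : ℂ)) = ((Real.exp (0.71 * ((H1 : ℝ) / 100) * (1 / 16)) : ℝ) : ℂ) := by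
      simp only [Nat.mul_eq]; push_cast; refine congrArg Complex.exp ?_; ring
    rw [e1, Complex.norm_real, Real.norm_eq_abs, abs_of_pos (Real.exp_pos _)] at h1
    exact h1
  have mA : mem ((Real.exp (-(2 * ((H0 : ℝ) / 100) * (1 / 64))) : ℝ) : ℂ) kA := by
    refine mem_neg1 ?_ hkA
    simp only [Nat.mul_eq]; push_cast; refine congrArg Complex.exp ?_; ring
  have mB : mem ((Real.exp (-((π - 2 * ((H0 : ℝ) / 100)) * (1 / 64))) : ℝ) : ℂ) kB := by
    refine mem_neg1 ?_ hkB
    simp only [Nat.mul_eq]; push_cast; refine congrArg Complex.exp ?_; ring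
  have mC : mem ((Real.exp (-((π - 2 * ((H1 : ℝ) / 100)) * (1 / 64))) : ℝ) : ℂ) kC := by
    refine mem_neg1 ?_ hkC
    simp only [Nat.mul_eq]; push_cast; refine congrArg Complex.exp ?_; ring
  have mg : mem ((Real.exp (-(((H1 : ℝ) / 100) * (1 / 64))) : ℝ) : ℂ) kg := by
    refine mem_neg1 ?_ hkg
    push_cast; refine congrArg Complex.exp ?_; ring
  have mq : mem ((Real.exp (-(π * (1 / 64))) : ℝ) : ℂ) kq := by
    refine mem_neg1 ?_ hkq
    push_cast; refine congrArg Complex.exp ?_; ring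
  have mk : mem (((H1 : ℝ) / 100 / Real.tan ((H1 : ℝ) / 100) : ℝ) : ℂ) (mul (mul (rat H1 100) (reP e)) v) := by
    refine mem_neg1 ?_ hkap
    have e1 : (H1 : ℂ) / ((100 : ℕ) : ℂ) * Complex.I = (((H1 : ℝ) / 100 : ℝ) : ℂ) * Complex.I := by push_cast; ring
    rw [e1, Complex.exp_ofReal_mul_I_re, Complex.exp_ofReal_mul_I_im, Real.tan_eq_sin_div_cos, div_div_eq_mul_div, div_eq_mul_inv]
    push_cast; ring
  obtain ⟨m0, m1⟩ := le_mxN t0 t1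
  have hb0 : |Fr ((H0 : ℝ) / 100) (((0 : ℕ) : ℝ) / 16)| ≤ (mxN t0 t1 : ℝ) / 4294967296 :=
    (FT_head (by omega) (by norm_num) hT0).trans (div_le_div_of_nonneg_right (Nat.cast_le.2 m0) (by norm_num))
  have hb1 : |Fr ((H1 : ℝ) / 100) (((0 : ℕ) : ℝ) / 16)| ≤ (mxN t0 t1 : ℝ) / 4294967296 :=
    (FT_head hH1 (by norm_num) hT1).trans (div_le_div_of_nonneg_right (Nat.cast_le.2 m1) (by norm_num))
  have := loopJ_sound (H0 := H0) (H1 := H1) (c := ⟨kA, kB, kC, kg, kq, _, H0⟩) ⟨mA, mB, mC, mg, mq, mk, rfl⟩ hf rfl hH0 hH hH1 hh hd T0 T1 0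
    (nrm dB) (mxN t0 t1) oneB oneB kC kg kq 0 (by rw [hlen]) hT0.2 hT1.2 (by convert hd using 4; norm_num) hb0 hb1
    ⟨mem_neg1 (by simp) mem_oneB, mem_neg1 (by simp) mem_oneB, by simpa using mC, by simpa using mg, by simpa using mq⟩ (by simp) HH
  rw [hlen] at this
  have e8 : ((4 * (0 + 128) : ℕ) : ℝ) / 64 = 8 := by norm_num
  rw [e8] at this
  exact this

noncomputable def init2 (H0 H1 fin : Nat) (T0 T1 : List Nat) : Bool :=
  List.rec false (fun t0 T0 _ => List.rec false (fun t1 T1 _ => initK H0 H1 fin t0 t1 T0 T1) T1) T0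

theorem init2_sound {H0 H1 fin : ℕ} {T0 T1 : List ℕ} {h : ℝ} {f : ℝ → ℝ} (hf : fOK h f)
    (hH0 : 0 < H0) (hH : H0 < H1) (hH1 : H1 ≤ 125) (hh : h ∈ Set.Icc ((H0 : ℝ) / 100) ((H1 : ℝ) / 100))
    (hT0 : FT ((H0 : ℝ) / 100) 0 T0) (hT1 : FT ((H1 : ℝ) / 100) 0 T1) (hlen : T0.length = 129)
    (HH : init2 H0 H1 fin T0 T1 = true) :
    ∫ y in (0:ℝ)..8, f y ≤ (fin : ℝ) / (18446744073709551616 * 17179869184 * 64) := by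
  cases T0 with
  | nil => exact absurd HH (by simp [init2])
  | cons t0 T0 =>
    cases T1 with
    | nil => exact absurd HH (by simp [init2])
    | cons t1 T1 => exact initK_sound hf hH0 hH hH1 hh hT0 hT1 (by simpa using hlen) HH

set_option maxRecDepth 100000 in
theorem j2c77 : init2 77 80 4766366256858142279411626409984 T77 T80 = true := by decide +kernel
set_option maxRecDepth 100000 in
theorem j2c80 : init2 80 90 6287546977132017786387651624960 T80 T90 = true := by decide +kernel
set_option maxRecDepth 100000 in
theorem j2c90 : init2 90 105 7707315649387634851171948036096 T90 T105 = true := by decide +kernel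
set_option maxRecDepth 100000 in
theorem j2c105 : init2 105 125 11763797570117968035241472819200 T105 T125 = true := by decide +kernel

theorem Fr_tail {h y : ℝ} (hh : 0 ≤ h) (hy : 0 ≤ y) : |Fr h y| ≤ π / 2 * Real.exp (0.71 * h * y) := by
  have h1 : ∀ t ∈ Set.Ioc 0 π, ‖x1 t * ph h y t‖ ≤ Real.exp (0.71 * h * y) / 2 * x1 t := by
    intro t ht
    have hx := x1_nonneg ht.1.le ht.2
    have hv := v0_abs ht.1.le
    rw [norm_mul, Real.norm_eq_abs, Real.norm_eq_abs, abs_of_nonneg hx, mul_comm]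
    refine mul_le_mul_of_nonneg_right ?_ hx
    unfold ph
    rw [abs_mul]
    have k1 := Real.abs_sin_le_one (z₁ t * y)
    have k2 : |Real.sinh (y * (h * v0 t))| ≤ Real.sinh (0.71 * h * y) := by
      apply abs_sinh_le
      rw [abs_mul, abs_mul, abs_of_nonneg hy, abs_of_nonneg hh]
      calc y * (h * |v0 t|) ≤ y * (h * 0.71) := by gcongr
        _ = _ := by ring
    have k3 : Real.sinh (0.71 * h * y) ≤ Real.exp (0.71 * h * y) / 2 := by
      rw [Real.sinh_eq]; have := Real.exp_pos (-(0.71 * h * y)); linarith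
    calc _ ≤ 1 * Real.sinh (0.71 * h * y) := mul_le_mul k1 k2 (abs_nonneg _) zero_le_one
      _ ≤ _ := by linarith
  have h2 := intervalIntegral.norm_integral_le_of_norm_le (μ := volume) Real.pi_pos.le (Filter.Eventually.of_forall h1)
    ((cont_x1.const_mul _).intervalIntegrable _ _)
  rw [intervalIntegral.integral_const_mul, int_x1] at h2
  have h3 : |Fr h y| ≤ Real.exp (0.71 * h * y) / 2 * π := h2
  linarith

theorem e5 : (148:ℝ) ≤ Real.exp 5 := by
  have := Real.exp_one_gt_d9
  have e : Real.exp 5 = Real.exp 1 ^ 5 := by rw [← Real.exp_nat_mul]; norm_num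
  rw [e]
  calc (148:ℝ) ≤ 2.718 ^ 5 := by norm_num
    _ ≤ _ := by gcongr; linarith

theorem Gx_tail {h y : ℝ} (hh : 0.77 ≤ h) (hh1 : h ≤ 1.25) (hy : 8 ≤ y) : Gx h y ≤ 1.03 * y * Real.exp (-(2 * h * y)) := by
  have hpi := Real.pi_gt_d4
  have hy0 : 0 < y := by linarith
  set x := y * (π / 2 - h) with hx
  have hx1 : 2.5 ≤ x := by nlinarith
  have ht : Real.exp (-(2 * x)) ≤ 1 / 148 := by
    rw [Real.exp_neg, inv_eq_one_div]
    apply one_div_le_one_div_of_le (by norm_num)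
    exact e5.trans (Real.exp_le_exp.2 (by linarith))
  have ht0 := Real.exp_pos (-(2 * x))
  have hbr : br h y ≤ y * Real.cosh x := by
    unfold br
    have htan := Real.tan_pos_of_pos_of_lt_pi_div_two (x := h) (by linarith) (by linarith)
    have : 0 ≤ Real.sinh (y * h) := Real.sinh_nonneg_iff.2 (by nlinarith)
    have h3 : 0 ≤ Real.sinh (y * h) / Real.tan h / Real.cosh (y * π / 2) := by
      have := Real.cosh_pos (y * π / 2); positivity
    linarith
  have hs : 0 < Real.sinh x := Real.sinh_pos_iff.2 (by linarith)
  have hc := Real.cosh_pos x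
  have hc2 := Real.cosh_pos (y * (π / 2 + h))
  have h1 : Gx h y ≤ Real.cosh x / (Real.sinh x * Real.cosh (y * (π / 2 + h))) * (y * Real.cosh x) :=
    mul_le_mul_of_nonneg_left hbr (by positivity)
  refine h1.trans ?_
  have hE := Real.exp_pos x
  have hE2 := Real.exp_pos (y * (π / 2 + h))
  have h2 : Real.exp (y * (π / 2 + h)) / 2 ≤ Real.cosh (y * (π / 2 + h)) := by
    rw [Real.cosh_eq]; have := Real.exp_pos (-(y * (π / 2 + h))); linarith
  have h3 : Real.exp (-(2 * h * y)) * Real.exp (y * (π / 2 + h)) = Real.exp x := by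
    rw [← Real.exp_add]; congr 1; rw [hx]; ring
  have h4 : Real.cosh x * Real.cosh x ≤ 1.03 * Real.sinh x * (Real.exp x / 2) := by
    rw [cosh_form, sinh_form]
    set t := Real.exp (-(2 * x))
    have : (1 + t) * (1 + t) ≤ 1.03 * (1 - t) := by nlinarith
    have h5 := mul_le_mul_of_nonneg_left this (by positivity : 0 ≤ Real.exp x * Real.exp x / 4)
    linarith
  rw [div_mul_eq_mul_div, div_le_iff₀ (by positivity)]
  have h6 : Real.exp x / 2 ≤ Real.exp (-(2 * h * y)) * Real.cosh (y * (π / 2 + h)) := by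
    rw [← h3]
    have := mul_le_mul_of_nonneg_left h2 (Real.exp_pos (-(2 * h * y))).le
    linarith
  have h7 : Real.cosh x * Real.cosh x ≤ 1.03 * Real.sinh x * (Real.exp (-(2 * h * y)) * Real.cosh (y * (π / 2 + h))) :=
    h4.trans (mul_le_mul_of_nonneg_left h6 (by positivity))
  have h8 := mul_le_mul_of_nonneg_left h7 hy0.le
  linarith

theorem Phi_tail {h y : ℝ} (hh : 0.77 ≤ h) (hh1 : h ≤ 1.25) (hy : 8 ≤ y) :
    Gx h y * |Fr h y| ≤ 4.79 * Real.exp (-0.868 * y) := by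
  have h1 := Gx_tail hh hh1 hy
  have h2 := Fr_tail (h := h) (y := y) (by linarith) (by linarith)
  have hy0 : 0 < y := by linarith
  have h3 := mul_le_mul h1 h2 (abs_nonneg _) (by positivity)
  refine h3.trans ?_
  have e1 : 1.03 * y * Real.exp (-(2 * h * y)) * (π / 2 * Real.exp (0.71 * h * y)) = 0.515 * π * (y * Real.exp (-(1.29 * h * y))) := by
    have : Real.exp (-(1.29 * h * y)) = Real.exp (-(2 * h * y)) * Real.exp (0.71 * h * y) := by
      rw [← Real.exp_add]; congr 1; ring
    rw [this]; ring
  rw [e1]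
  have h4 : y ≤ 8 * Real.exp (y / 8 - 1) := by
    have := Real.add_one_le_exp (y / 8 - 1); linarith
  have h5 : Real.exp (-(1.29 * h * y)) ≤ Real.exp (-0.9933 * y) := Real.exp_le_exp.2 (by nlinarith)
  have h6 : y * Real.exp (-(1.29 * h * y)) ≤ 8 * Real.exp (y / 8 - 1) * Real.exp (-0.9933 * y) :=
    mul_le_mul h4 h5 (Real.exp_pos _).le (by positivity)
  have h7 : Real.exp (y / 8 - 1) * Real.exp (-0.9933 * y) ≤ Real.exp (-1) * Real.exp (-0.868 * y) := by
    rw [← Real.exp_add, ← Real.exp_add]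
    apply Real.exp_le_exp.2; linarith
  have h8 : Real.exp (-1) ≤ 0.368 := by
    rw [Real.exp_neg, inv_eq_one_div, div_le_iff₀ (Real.exp_pos _)]
    have := Real.exp_one_gt_d9; linarith
  have h9 := Real.pi_lt_d4
  have h10 := Real.pi_pos
  have hX := Real.exp_pos (-0.868 * y)
  calc 0.515 * π * (y * Real.exp (-(1.29 * h * y))) ≤ 0.515 * 3.1416 * (8 * (0.368 * Real.exp (-0.868 * y))) := by
        refine mul_le_mul (by linarith) (h6.trans ?_) (by positivity) (by norm_num)
        have := mul_le_mul_of_nonneg_right h8 hX.le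
        linarith
    _ ≤ _ := by nlinarith

theorem tail_int : ∫ y in Set.Ioi (8:ℝ), 4.79 * Real.exp (-0.868 * y) ≤ 0.0058 := by
  rw [integral_const_mul, integral_exp_mul_Ioi (by norm_num)]
  have : Real.exp (-0.868 * 8) ≤ 1 / 962 := by
    have e : (-0.868 * 8 : ℝ) = -(6.944) := by norm_num
    rw [e, Real.exp_neg, inv_eq_one_div]
    apply one_div_le_one_div_of_le (by norm_num)
    have h1 := Real.quadratic_le_exp_of_nonneg (x := 0.944) (by norm_num)
    have h2 := Real.exp_one_gt_d9
    have e6 : Real.exp 6 = Real.exp 1 ^ 6 := by rw [← Real.exp_nat_mul]; norm_num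
    have e7 : (6.944 : ℝ) = 6 + 0.944 := by norm_num
    rw [e7, Real.exp_add, e6]
    have h3 : (403:ℝ) ≤ Real.exp 1 ^ 6 := by
      calc (403:ℝ) ≤ 2.718 ^ 6 := by norm_num
        _ ≤ _ := by gcongr; linarith
    have h4 : (2.3895:ℝ) ≤ Real.exp 0.944 := le_trans (by norm_num) h1
    calc (962:ℝ) ≤ 403 * 2.3895 := by norm_num
      _ ≤ _ := mul_le_mul h3 h4 (by norm_num) (by positivity)
  have h5 : 4.79 * (-Real.exp (-0.868 * 8) / -0.868) = 4.79 / 0.868 * Real.exp (-0.868 * 8) := by ring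
  rw [h5]
  calc (4.79 / 0.868 : ℝ) * Real.exp (-0.868 * 8) ≤ 4.79 / 0.868 * (1 / 962) := by gcongr
    _ ≤ _ := by norm_num

theorem Phi_int {h c : ℝ} {Φ : ℝ → ℝ} (hh : 0.77 ≤ h) (hh1 : h ≤ 1.25) (hi : IntegrableOn Φ (Set.Ioi 0))
    (hb : ∀ y, 0 < y → |Φ y| ≤ Gx h y * |Fr h y|)
    (H : fOK h (fun y => |Φ y|) → ∫ y in (0:ℝ)..8, |Φ y| ≤ c) : ∫ y in Set.Ioi 0, Φ y ≤ c + 0.0058 := by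
  have hia : IntegrableOn (fun y => |Φ y|) (Set.Ioi 0) := hi.abs
  have hf : fOK h (fun y => |Φ y|) := by
    refine ⟨fun a b ha hb => ?_, fun y hy => by rw [abs_abs]; exact hb y hy⟩
    rw [intervalIntegrable_iff]
    refine hia.mono_set fun x hx => ?_
    exact lt_of_le_of_lt (le_min ha hb) hx.1
  have h1 := H hf
  have h2 : ∫ y in Set.Ioi 0, Φ y ≤ ∫ y in Set.Ioi 0, |Φ y| :=
    integral_mono hi hia (fun y => le_abs_self _)
  have h3 : ∫ y in Set.Ioi 0, |Φ y| = (∫ y in (0:ℝ)..8, |Φ y|) + ∫ y in Set.Ioi 8, |Φ y| := by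
    rw [intervalIntegral.integral_of_le (by norm_num), ← setIntegral_union, Set.Ioc_union_Ioi_eq_Ioi (by norm_num)]
    · exact Set.Ioc_disjoint_Ioi le_rfl
    · exact measurableSet_Ioi
    · exact hia.mono_set Set.Ioc_subset_Ioi_self
    · exact hia.mono_set (Set.Ioi_subset_Ioi (by norm_num))
  have h4 : ∫ y in Set.Ioi (8:ℝ), |Φ y| ≤ ∫ y in Set.Ioi (8:ℝ), 4.79 * Real.exp (-0.868 * y) := by
    apply setIntegral_mono_on (hia.mono_set (Set.Ioi_subset_Ioi (by norm_num))) _ measurableSet_Ioi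
    · intro y hy
      have hy' : (8:ℝ) < y := hy
      exact (hb y (by linarith)).trans (Phi_tail hh hh1 hy'.le)
    · exact (integrableOn_exp_mul_Ioi (by norm_num) _).const_mul _
  have := tail_int
  linarith

/-- combination of the bounds for both parts -/
theorem final_comb {h K c d : ℝ} (hh : 0.77 ≤ h) (hh1 : h ≤ 1.25) (hK : -1 < K) (hK1 : K < 1)
    (H1 : ∫ t in (0.25:ℝ)..3.15, f1 h t ≤ -c)
    (H2 : ∀ f, fOK h f → ∫ y in (0:ℝ)..8, f y ≤ d)
    (hcd : -c + 0.0112 + 2 * (d + 0.0058) < 0) : I₁ h + I₂ h K < 0 := by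
  have hp : h < π / 2 := by linarith [Real.pi_gt_three]
  obtain ⟨Φ, hi, hb, e2⟩ := I2_form (by linarith) hp hK hK1
  have hd : deriv (z₂ h) 0 = h * v1 0 := deriv_z2 (by simpa using Real.pi_pos)
  have hdp : 0 < deriv (z₂ h) 0 := by
    rw [hd]; exact mul_pos (by linarith) v1_zero_pos
  have b1 := J1_bound hh hh1 (fun t ht => f1_cont ht) H1
  have b2 := Phi_int hh hh1 hi hb (fun hf => H2 _ hf)
  have e1 : I₁ h = 2 * deriv (z₂ h) 0 * ∫ β in Set.Ioi 0, fF h β := rfl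
  rw [e1, e2]
  have : (∫ β in Set.Ioi 0, fF h β) + 2 * ∫ y in Set.Ioi 0, Φ y < 0 := by linarith
  have := mul_neg_of_pos_of_neg hdp this
  linarith

theorem final_case {H0 H1 G0 G1 c fin : ℕ} {T0 T1 : List ℕ} {h K : ℝ} (hh : 0.77 ≤ h) (hh1 : h ≤ 1.25)
    (hK : -1 < K) (hK1 : K < 1)
    (hG0 : 0 < G0) (hG : G0 ≤ G1) (hG1 : G1 ≤ 125) (cG : j1All G0 G1 c = true)
    (mG : h ∈ Set.Icc ((G0 : ℝ) / 100) ((G1 : ℝ) / 100))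
    (hH0 : 0 < H0) (hH : H0 < H1) (hH1 : H1 ≤ 125) (mH : h ∈ Set.Icc ((H0 : ℝ) / 100) ((H1 : ℝ) / 100))
    (hT0 : FT ((H0 : ℝ) / 100) 0 T0) (hT1 : FT ((H1 : ℝ) / 100) 0 T1) (hlen : T0.length = 129)
    (cH : init2 H0 H1 fin T0 T1 = true)
    (hcd : -((c:ℝ)/18446744073709551616) + 0.0112
      + 2 * ((fin:ℝ)/(18446744073709551616 * 17179869184 * 64) + 0.0058) < 0) : I₁ h + I₂ h K < 0 :=
  final_comb hh hh1 hK hK1 (j1All_sound hG0 hG hG1 cG mG)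
    (fun _ hf => init2_sound hf hH0 hH hH1 mH hT0 hT1 hlen cH) hcd

/-- For every height `0.77 < h₂ < 1.25` of the permeability jump and every `K ∈ (-1,1)`,
`I₁(h₂) + I₂(h₂,K) < 0`: the curve undergoes a short-time stability shift,
independently of the permeability jump `K`. -/
theorem inhomogeneous_muskat_shift_for_all_K :
    ∀ h₂ : ℝ, 0.77 < h₂ → h₂ < 1.25 →
      ∀ K : ℝ, -1 < K → K < 1 → I₁ h₂ + I₂ h₂ K < 0 := by
  intro h hh hh1 K hK hK1
  by_cases a1 : h ≤ 0.8
  · exact final_case hh.le hh1.le hK hK1 (by norm_num) (by norm_num) (by norm_num) j1c1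
      (by constructor <;> norm_num at * <;> linarith) (by norm_num) (by norm_num) (by norm_num)
      (by constructor <;> norm_num at * <;> linarith) T77_ok T80_ok (by decide +kernel) j2c77 (by norm_num)
  by_cases a2 : h ≤ 0.9
  · exact final_case hh.le hh1.le hK hK1 (by norm_num) (by norm_num) (by norm_num) j1c2
      (by constructor <;> norm_num at * <;> linarith) (by norm_num) (by norm_num) (by norm_num)
      (by constructor <;> norm_num at * <;> linarith) T80_ok T90_ok (by decide +kernel) j2c80 (by norm_num)
  by_cases a3 : h ≤ 1.05
  · exact final_case hh.le hh1.le hK hK1 (by norm_num) (by norm_num) (by norm_num) j1c3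
      (by constructor <;> norm_num at * <;> linarith) (by norm_num) (by norm_num) (by norm_num)
      (by constructor <;> norm_num at * <;> linarith) T90_ok T105_ok (by decide +kernel) j2c90 (by norm_num)
  by_cases a4 : h ≤ 1.15
  · exact final_case hh.le hh1.le hK hK1 (by norm_num) (by norm_num) (by norm_num) j1c4
      (by constructor <;> norm_num at * <;> linarith) (by norm_num) (by norm_num) (by norm_num)
      (by constructor <;> norm_num at * <;> linarith) T105_ok T125_ok (by decide +kernel) j2c105 (by norm_num)
  · exact final_case hh.le hh1.le hK hK1 (by norm_num) (by norm_num) (by norm_num) j1c5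
      (by constructor <;> norm_num at * <;> linarith) (by norm_num) (by norm_num) (by norm_num)
      (by constructor <;> norm_num at * <;> linarith) T105_ok T125_ok (by decide +kernel) j2c105 (by norm_num)
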